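/- Let N, p, σ₂ be real numbers with p > 1, set δ := -(σ₂+2)/(p-1), K := N - 2 - 2(σ₂+2)/(p-1), and λ := ((σ₂+2)/(p-1))·(N - 2 - (σ₂+2)/(p-1)). Let I ⊆ ℝ be an open interval and let u be a classical radial solution of (E)[N,1,p,-2,σ₂] on (0,∞) × I (i.e. with m = 1 and σ₁ = -2). Then the function ψ(ȳ,t) := e^{-δ(ȳ - Kt)} u(e^{ȳ - Kt}, t) satisfies ∂_t ψ(ȳ,t) = ∂_ȳȳ ψ(ȳ,t) - λ ψ(ȳ,t) + ψ(ȳ,t)^p for all ȳ ∈ ℝ and t ∈ I. -/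

import Mathlib

open Real Set

noncomputable section

/-- `u` is a classical radial solution of (E)[N,m,p,σ₁,σ₂] on (0,∞) × I:
`u` is positive, differentiable in time, `r ↦ u(r,t)^m` is twice differentiable in `r`,
and `r^{σ₁} ∂_t u = ∂_rr(u^m) + ((N-1)/r) ∂_r(u^m) + r^{σ₂} u^p` holds pointwise. -/
def IsClassicalRadialSolution (N m p σ₁ σ₂ : ℝ) (I : Set ℝ) (u : ℝ → ℝ → ℝ) : Prop :=
  ∀ r : ℝ, 0 < r → ∀ t ∈ I,
    0 < u r t ∧
    DifferentiableAt ℝ (fun τ => u r τ) t ∧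
    DifferentiableAt ℝ (fun ρ => u ρ t ^ m) r ∧
    DifferentiableAt ℝ (deriv (fun ρ => u ρ t ^ m)) r ∧
    r ^ σ₁ * deriv (fun τ => u r τ) t =
      deriv (deriv (fun ρ => u ρ t ^ m)) r
        + ((N - 1) / r) * deriv (fun ρ => u ρ t ^ m) r
        + r ^ σ₂ * u r t ^ p

open Real Set
noncomputable section

namespace RS
open Filter Topology

/-- second derivative test at a local maximum -/
lemma snd_test {f f1 : ℝ → ℝ} {x c : ℝ} (h1 : ∀ᶠ y in 𝓝 x, HasDerivAt f (f1 y) y)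
    (h2 : HasDerivAt f1 c x) (hm : IsLocalMax f x) : f1 x = 0 ∧ c ≤ 0 := by
  have h0 : f1 x = 0 := hm.hasDerivAt_eq_zero h1.self_of_nhds
  refine ⟨h0, ?_⟩
  by_contra hc
  push Not at hc
  have hd : deriv f =ᶠ[𝓝 x] f1 := h1.mono fun y hy => hy.deriv
  have hdd : deriv (deriv f) x = c := by rw [hd.deriv_eq]; exact h2.deriv
  have hmin := isLocalMin_of_deriv_deriv_pos (f := f) (x₀ := x) (by rw [hdd]; exact hc)
    (by rw [hd.self_of_nhds]; exact h0) h1.self_of_nhds.continuousAt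
  have heq : f =ᶠ[𝓝 x] fun _ => f x := by
    filter_upwards [hm, hmin] with y a b
    exact le_antisymm a b
  have hd0 : deriv f =ᶠ[𝓝 x] fun _ => 0 := by
    have := heq.deriv
    filter_upwards [this] with y hy
    rw [hy]; simp
  have : deriv (deriv f) x = 0 := by rw [hd0.deriv_eq]; simp
  linarith

lemma left_test {g : ℝ → ℝ} {t c : ℝ} (h : HasDerivAt g c t)
    (hm : ∀ᶠ s in 𝓝[<] t, g s ≤ g t) : 0 ≤ c := by
  have h1 : Tendsto (slope g t) (𝓝[<] t) (𝓝 c) :=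
    (hasDerivAt_iff_tendsto_slope.1 h).mono_left (nhdsWithin_mono _ (by intro y hy; exact ne_of_lt hy))
  refine ge_of_tendsto h1 ?_
  filter_upwards [hm, self_mem_nhdsWithin] with s hs hst
  rw [slope_def_field]
  have : s < t := hst
  exact div_nonneg_of_nonpos (by linarith) (by linarith)

/-- pointwise solution of `v_t = v_xx + K v_x + H`. -/
def SolAt (K : ℝ) (v v1 v2 H : ℝ → ℝ → ℝ) (x t : ℝ) : Prop :=
  HasDerivAt (fun y => v y t) (v1 x t) x ∧ HasDerivAt (fun y => v1 y t) (v2 x t) x ∧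
  HasDerivAt (fun s => v x s) (v2 x t + K * v1 x t + H x t) t

set_option maxHeartbeats 1000000 in
lemma lip_mid {K r M : ℝ} (hr : 0 < r) (hr1 : r ≤ 1) (hM : 0 < M) {v v1 v2 H : ℝ → ℝ → ℝ}
    {m t0 : ℝ}
    (hs : ∀ x t, |x - m| ≤ 2 * r → t0 - r ^ 2 ≤ t → t ≤ t0 → SolAt K v v1 v2 H x t)
    (hc : ContinuousOn (fun z : ℝ × ℝ => v z.1 z.2)
      {z | |z.1 - m| ≤ 2 * r ∧ t0 - r ^ 2 ≤ z.2 ∧ z.2 ≤ t0})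
    (hb : ∀ x t, |x - m| ≤ 2 * r → t0 - r ^ 2 ≤ t → t ≤ t0 → |v x t| ≤ M)
    (hH : ∀ x t, |x - m| ≤ 2 * r → t0 - r ^ 2 ≤ t → t ≤ t0 → |H x t| ≤ M)
    {h : ℝ} (h0 : 0 ≤ h) (hhr : h ≤ r) :
    v (m + h) t0 - v (m - h) t0 ≤ 4 * M * (2 + |K|) / r * h := by
  set c1 : ℝ := 2 + |K| with hc1
  have hK0 : 0 ≤ |K| := abs_nonneg K
  let Ψ : ℝ → ℝ → ℝ → ℝ := fun x h t =>
    2 * M * (c1 * (2 * h / r - h ^ 2 / r ^ 2) + (x - m) ^ 2 / r ^ 2 + (t0 - t) / r ^ 2)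
  let Φ : ℝ × ℝ × ℝ → ℝ := fun z => v (z.1 + z.2.1) z.2.2 - v (z.1 - z.2.1) z.2.2 - Ψ z.1 z.2.1 z.2.2
  let D : Set (ℝ × ℝ × ℝ) := Icc (m - r) (m + r) ×ˢ (Icc 0 r ×ˢ Icc (t0 - r ^ 2) t0)
  have hr2 : 0 < r ^ 2 := by positivity
  have hDc : IsCompact D := isCompact_Icc.prod (isCompact_Icc.prod isCompact_Icc)
  have mem : ∀ z ∈ D, (|z.1 + z.2.1 - m| ≤ 2 * r) ∧ (|z.1 - z.2.1 - m| ≤ 2 * r) ∧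
      t0 - r ^ 2 ≤ z.2.2 ∧ z.2.2 ≤ t0 := by
    rintro ⟨x, h, t⟩ ⟨⟨a, b⟩, ⟨c, d⟩, ⟨e, f⟩⟩
    simp only at a b c d e f ⊢
    refine ⟨?_, ?_, e, f⟩ <;> rw [abs_le] <;> constructor <;> linarith
  have hΦc : ContinuousOn Φ D := by
    apply ContinuousOn.sub
    · apply ContinuousOn.sub
      · exact hc.comp (f := fun z : ℝ × ℝ × ℝ => (z.1 + z.2.1, z.2.2)) (by fun_prop)
          (fun z hz => ⟨(mem z hz).1, (mem z hz).2.2⟩)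
      · exact hc.comp (f := fun z : ℝ × ℝ × ℝ => (z.1 - z.2.1, z.2.2)) (by fun_prop)
          (fun z hz => ⟨(mem z hz).2.1, (mem z hz).2.2⟩)
    · apply Continuous.continuousOn
      simp only [Ψ]
      fun_prop
  -- it suffices to show Φ ≤ 0 on D
  have key : ∀ z ∈ D, Φ z ≤ 0 := by
    by_contra hcon
    push Not at hcon
    obtain ⟨z1, hz1, hz1p⟩ := hcon
    obtain ⟨⟨x, h, t⟩, hz, hmax⟩ := hDc.exists_isMaxOn ⟨z1, hz1⟩ hΦc
    have hpos : 0 < Φ (x, h, t) := lt_of_lt_of_le hz1p (hmax hz1)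
    have hmm := mem _ hz
    obtain ⟨⟨a, b⟩, ⟨c, d⟩, ⟨e, f⟩⟩ := hz
    simp only at a b c d e f hmm
    obtain ⟨m1, m2, -, -⟩ := hmm
    have hv1 := abs_le.1 (hb _ _ m1 e f)
    have hv2 := abs_le.1 (hb _ _ m2 e f)
    have hW : v (x + h) t - v (x - h) t ≤ 2 * M := by linarith
    have hposW : Ψ x h t < v (x + h) t - v (x - h) t := by
      simp only [Φ] at hpos; linarith
    have q1 : 0 ≤ 2 * h / r - h ^ 2 / r ^ 2 := by
      have : 2 * h / r - h ^ 2 / r ^ 2 = h * (2 * r - h) / r ^ 2 := by field_simp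
      rw [this]
      apply div_nonneg (mul_nonneg c (by linarith)) hr2.le
    have q2 : 0 ≤ (x - m) ^ 2 / r ^ 2 := by positivity
    have q3 : 0 ≤ (t0 - t) / r ^ 2 := div_nonneg (by linarith) hr2.le
    have q1' : 0 ≤ c1 * (2 * h / r - h ^ 2 / r ^ 2) := mul_nonneg (by linarith) q1
    have hsum : c1 * (2 * h / r - h ^ 2 / r ^ 2) + (x - m) ^ 2 / r ^ 2 + (t0 - t) / r ^ 2 < 1 := by
      have : Ψ x h t < 2 * M := lt_of_lt_of_le hposW hW
      simp only [Ψ] at this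
      nlinarith
    have hh0 : 0 < h := by
      rcases c.lt_or_eq with c | c
      · exact c
      · exfalso
        subst c
        simp only [Φ, Ψ] at hpos
        simp only [add_zero, sub_zero, sub_self] at hpos
        have : 0 ≤ 2 * M * ((x - m) ^ 2 / r ^ 2 + (t0 - t) / r ^ 2) := by positivity
        norm_num at hpos
        linarith
    have hhr' : h < r := by
      rcases d.lt_or_eq with d | d
      · exact d
      · exfalso
        subst d
        have : 2 * h / h - h ^ 2 / h ^ 2 = 1 := by field_simp; norm_num
        rw [this] at hsum
        linarith
    have hx1 : (x - m) ^ 2 < r ^ 2 := by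
      have : (x - m) ^ 2 / r ^ 2 < 1 := by linarith
      rwa [div_lt_one hr2] at this
    have hxx := abs_lt.1 (abs_lt_of_sq_lt_sq hx1 hr.le)
    have ht1 : t0 - t < r ^ 2 := by
      have : (t0 - t) / r ^ 2 < 1 := by linarith
      rwa [div_lt_one hr2] at this
    obtain ⟨s1, s2, s3⟩ := hs _ _ m1 e f
    obtain ⟨s1', s2', s3'⟩ := hs _ _ m2 e f
    -- x direction
    have mx : IsLocalMax (fun y => Φ (y, h, t)) x := by
      have : ∀ᶠ y in 𝓝 x, y ∈ Icc (m - r) (m + r) :=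
        Icc_mem_nhds (by linarith) (by linarith)
      filter_upwards [this] with y hy
      exact hmax (show (y, h, t) ∈ D from ⟨hy, ⟨c, d⟩, e, f⟩)
    have dx : HasDerivAt (fun y => Φ (y, h, t))
        (v1 (x + h) t - v1 (x - h) t - 2 * M * (2 * (x - m) / r ^ 2)) x := by
      have A := (HasDerivAt.comp_add_const x h s1)
      have B := (HasDerivAt.comp_sub_const x h s1')
      have C : HasDerivAt (fun y => Ψ y h t) (2 * M * (2 * (x - m) / r ^ 2)) x := by
        have := ((((hasDerivAt_id x).sub_const m).pow 2).div_const (r ^ 2))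
        have := ((this.const_add (c1 * (2 * h / r - h ^ 2 / r ^ 2))).add_const ((t0 - t) / r ^ 2)).const_mul (2 * M)
        exact this.congr_deriv (by simp)
      exact (A.sub B).sub C
    have ex := mx.hasDerivAt_eq_zero dx
    -- h direction
    have mh : IsLocalMax (fun y => Φ (x, y, t)) h := by
      have : ∀ᶠ y in 𝓝 h, y ∈ Icc 0 r := Icc_mem_nhds hh0 hhr'
      filter_upwards [this] with y hy
      exact hmax (show (x, y, t) ∈ D from ⟨⟨a, b⟩, hy, e, f⟩)
    have dh : ∀ᶠ y in 𝓝 h, HasDerivAt (fun y => Φ (x, y, t))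
        (v1 (x + y) t + v1 (x - y) t - 2 * M * (c1 * (2 / r - 2 * y / r ^ 2))) y := by
      have : ∀ᶠ y in 𝓝 h, y ∈ Icc 0 r := Icc_mem_nhds hh0 hhr'
      filter_upwards [this] with y hy
      have hm' := mem (x, y, t) ⟨⟨a, b⟩, hy, e, f⟩
      simp only at hm'
      have A := HasDerivAt.comp_const_add x y (hs _ _ hm'.1 e f).1
      have B := HasDerivAt.comp_const_sub x y (hs _ _ hm'.2.1 e f).1
      have C : HasDerivAt (fun y => Ψ x y t) (2 * M * (c1 * (2 / r - 2 * y / r ^ 2))) y := by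
        have e1 := ((hasDerivAt_id y).const_mul 2).div_const r
        have e2 := ((hasDerivAt_id y).pow 2).div_const (r ^ 2)
        have := ((((e1.sub e2).const_mul c1).add_const ((x - m) ^ 2 / r ^ 2)).add_const ((t0 - t) / r ^ 2)).const_mul (2 * M)
        exact this.congr_deriv (by simp)
      refine ((A.sub B).sub C).congr_deriv ?_
      ring
    have dhh : HasDerivAt (fun y => v1 (x + y) t + v1 (x - y) t - 2 * M * (c1 * (2 / r - 2 * y / r ^ 2)))
        (v2 (x + h) t - v2 (x - h) t + 2 * M * (c1 * (2 / r ^ 2))) h := by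
      have A := HasDerivAt.comp_const_add x h s2
      have B := HasDerivAt.comp_const_sub x h s2'
      have C : HasDerivAt (fun y => 2 * M * (c1 * (2 / r - 2 * y / r ^ 2))) (2 * M * (c1 * (- (2 / r ^ 2)))) h := by
        have e1 := ((hasDerivAt_id h).const_mul 2).div_const (r ^ 2)
        have := ((e1.const_sub (2 / r)).const_mul c1).const_mul (2 * M)
        exact this.congr_deriv (by simp)
      refine ((A.add B).sub C).congr_deriv ?_
      ring
    have eh := (snd_test dh dhh mh).2
    -- t direction
    have mt : ∀ᶠ s in 𝓝[<] t, Φ (x, h, s) ≤ Φ (x, h, t) := by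
      have h1 : ∀ᶠ s in 𝓝[<] t, t0 - r ^ 2 < s :=
        (eventually_gt_nhds (by linarith)).filter_mono nhdsWithin_le_nhds
      filter_upwards [h1, self_mem_nhdsWithin] with s hs1 hs2
      have : s < t := hs2
      exact hmax (show (x, h, s) ∈ D from ⟨⟨a, b⟩, ⟨c, d⟩, hs1.le, by simp only; linarith⟩)
    have dt : HasDerivAt (fun s => Φ (x, h, s))
        ((v2 (x + h) t + K * v1 (x + h) t + H (x + h) t) -
          (v2 (x - h) t + K * v1 (x - h) t + H (x - h) t) + 2 * M / r ^ 2) t := by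
      have C : HasDerivAt (fun s => Ψ x h s) (- (2 * M / r ^ 2)) t := by
        have e1 := ((hasDerivAt_id t).const_sub t0).div_const (r ^ 2)
        have := (e1.const_add (c1 * (2 * h / r - h ^ 2 / r ^ 2) + (x - m) ^ 2 / r ^ 2)).const_mul (2 * M)
        exact this.congr_deriv (by field_simp)
      refine ((s3.sub s3').sub C).congr_deriv ?_
      ring
    have et := left_test dt mt
    have hH1 := abs_le.1 (hH _ _ m1 e f)
    have hH2 := abs_le.1 (hH _ _ m2 e f)
    have exK : K * (v1 (x + h) t - v1 (x - h) t) ≤ |K| * (4 * M / r) := by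
      have : v1 (x + h) t - v1 (x - h) t = 2 * M * (2 * (x - m) / r ^ 2) := by linarith
      rw [this]
      calc K * (2 * M * (2 * (x - m) / r ^ 2)) ≤ |K * (2 * M * (2 * (x - m) / r ^ 2))| := le_abs_self _
        _ = |K| * (4 * M * |x - m| / r ^ 2) := by
          rw [abs_mul]
          congr 1
          rw [abs_mul, abs_div, abs_mul, abs_mul, abs_of_pos hM, abs_of_pos hr2]
          norm_num
          ring
        _ ≤ |K| * (4 * M / r) := by
          apply mul_le_mul_of_nonneg_left _ hK0
          rw [div_le_div_iff₀ hr2 hr]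
          have : |x - m| ≤ r := abs_le.2 ⟨by linarith, by linarith⟩
          have : 4 * M * |x - m| * r ≤ 4 * M * r * r := by gcongr
          nlinarith
    have fin : -(2 * M * (c1 * (2 / r ^ 2))) + |K| * (4 * M / r) + 2 * M + 2 * M / r ^ 2 < 0 := by
      have : -(2 * M * (c1 * (2 / r ^ 2))) + |K| * (4 * M / r) + 2 * M + 2 * M / r ^ 2
          = 2 * M * (-2 * c1 + 2 * |K| * r + r ^ 2 + 1) / r ^ 2 := by
        field_simp; ring
      rw [this]
      apply div_neg_of_neg_of_pos _ hr2
      apply mul_neg_of_pos_of_neg (by positivity)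
      nlinarith
    rw [mul_sub] at exK
    linarith
  have hz : (m, h, t0) ∈ D := ⟨⟨by linarith, by linarith⟩, ⟨h0, hhr⟩, by simp only; linarith, le_refl _⟩
  have := key _ hz
  simp only [Φ, Ψ] at this
  have h2 : 2 * M * (c1 * (2 * h / r - h ^ 2 / r ^ 2) + (m - m) ^ 2 / r ^ 2 + (t0 - t0) / r ^ 2)
      ≤ 4 * M * c1 / r * h := by
    have : 4 * M * c1 / r * h - 2 * M * (c1 * (2 * h / r - h ^ 2 / r ^ 2) + (m - m) ^ 2 / r ^ 2 + (t0 - t0) / r ^ 2) = 2 * M * c1 * (h ^ 2 / r ^ 2) := by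
      field_simp; ring
    have : 0 ≤ 2 * M * c1 * (h ^ 2 / r ^ 2) := by positivity
    linarith
  linarith
end RS
end
open Real Set
noncomputable section
namespace RS
open Filter Topology

def InQ (c : ℝ × ℝ) (ρ x t : ℝ) : Prop := |x - c.1| ≤ ρ ∧ |t - c.2| ≤ ρ
def Sol (K : ℝ) (v v1 v2 H : ℝ → ℝ → ℝ) (c : ℝ × ℝ) (ρ : ℝ) : Prop :=
  ∀ x t, InQ c ρ x t → SolAt K v v1 v2 H x t
def Bd (f : ℝ → ℝ → ℝ) (c : ℝ × ℝ) (ρ M : ℝ) : Prop := ∀ x t, InQ c ρ x t → |f x t| ≤ M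
def Lp (f : ℝ → ℝ → ℝ) (c : ℝ × ℝ) (ρ M : ℝ) : Prop :=
  ∀ x y t, InQ c ρ x t → InQ c ρ y t → |f x t - f y t| ≤ M * |x - y|
def Ct (f : ℝ → ℝ → ℝ) (c : ℝ × ℝ) (ρ : ℝ) : Prop :=
  ContinuousOn (fun z : ℝ × ℝ => f z.1 z.2) {z | InQ c ρ z.1 z.2}
def Dx (f f1 : ℝ → ℝ → ℝ) (c : ℝ × ℝ) (ρ : ℝ) : Prop :=
  ∀ x t, InQ c ρ x t → HasDerivAt (fun y => f y t) (f1 x t) x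
def Dk (k : ℝ) (f : ℝ → ℝ → ℝ) : ℝ → ℝ → ℝ := fun x t => (f (x + k) t - f x t) / k

lemma InQ.mono {c : ℝ × ℝ} {σ ρ x t : ℝ} (h : InQ c σ x t) (hs : σ ≤ ρ) : InQ c ρ x t :=
  ⟨h.1.trans hs, h.2.trans hs⟩
lemma InQ.shift {c : ℝ × ℝ} {σ ρ x t k : ℝ} (h : InQ c σ x t) (k0 : 0 ≤ k) (hs : σ + k ≤ ρ) :
    InQ c ρ (x + k) t := by
  refine ⟨?_, h.2.trans (by linarith)⟩
  have := abs_le.1 h.1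
  rw [abs_le]; constructor <;> linarith

lemma Bd.mono {f : ℝ → ℝ → ℝ} {c : ℝ × ℝ} {σ ρ M M' : ℝ} (h : Bd f c ρ M) (hs : σ ≤ ρ) (hM : M ≤ M') :
    Bd f c σ M' := fun x t hx => (h x t (hx.mono hs)).trans hM
lemma Lp.mono {f : ℝ → ℝ → ℝ} {c : ℝ × ℝ} {σ ρ M M' : ℝ} (h : Lp f c ρ M) (hs : σ ≤ ρ) (hM : M ≤ M') :
    Lp f c σ M' := fun x y t hx hy => (h x y t (hx.mono hs) (hy.mono hs)).trans
      (mul_le_mul_of_nonneg_right hM (abs_nonneg _))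
lemma Dx.mono {f f1 : ℝ → ℝ → ℝ} {c : ℝ × ℝ} {σ ρ : ℝ} (h : Dx f f1 c ρ) (hs : σ ≤ ρ) :
    Dx f f1 c σ := fun x t hx => (h x t (hx.mono hs))
lemma Sol.mono {K : ℝ} {v v1 v2 H : ℝ → ℝ → ℝ} {c : ℝ × ℝ} {σ ρ : ℝ} (h : Sol K v v1 v2 H c ρ)
    (hs : σ ≤ ρ) : Sol K v v1 v2 H c σ := fun x t hx => (h x t (hx.mono hs))
lemma Ct.mono {f : ℝ → ℝ → ℝ} {c : ℝ × ℝ} {σ ρ : ℝ} (h : Ct f c ρ) (hs : σ ≤ ρ) :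
    Ct f c σ := ContinuousOn.mono h (fun _ hz => InQ.mono hz hs)
lemma Sol.dx {K : ℝ} {v v1 v2 H : ℝ → ℝ → ℝ} {c : ℝ × ℝ} {ρ : ℝ} (h : Sol K v v1 v2 H c ρ) :
    Dx v v1 c ρ := fun x t hx => (h x t hx).1
lemma Sol.dx1 {K : ℝ} {v v1 v2 H : ℝ → ℝ → ℝ} {c : ℝ × ℝ} {ρ : ℝ} (h : Sol K v v1 v2 H c ρ) :
    Dx v1 v2 c ρ := fun x t hx => (h x t hx).2.1

lemma Dx.dk {f f1 : ℝ → ℝ → ℝ} {c : ℝ × ℝ} {σ ρ k : ℝ} (h : Dx f f1 c ρ) (k0 : 0 < k)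
    (hs : σ + k ≤ ρ) : Dx (Dk k f) (Dk k f1) c σ := by
  intro x t hx
  have A := HasDerivAt.comp_add_const x k (h _ _ (hx.shift k0.le hs))
  exact (A.sub (h x t (hx.mono (by linarith)))).div_const k

lemma Sol.dk {K : ℝ} {v v1 v2 H : ℝ → ℝ → ℝ} {c : ℝ × ℝ} {σ ρ k : ℝ} (h : Sol K v v1 v2 H c ρ)
    (k0 : 0 < k) (hs : σ + k ≤ ρ) : Sol K (Dk k v) (Dk k v1) (Dk k v2) (Dk k H) c σ := by
  intro x t hx
  refine ⟨h.dx.dk k0 hs x t hx, h.dx1.dk k0 hs x t hx, ?_⟩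
  have A := (h _ _ (hx.shift k0.le hs)).2.2
  have B := (h _ _ (hx.mono (show σ ≤ ρ by linarith))).2.2
  refine ((A.sub B).div_const k).congr_deriv ?_
  simp only [Dk]
  ring

lemma Ct.dk {f : ℝ → ℝ → ℝ} {c : ℝ × ℝ} {σ ρ k : ℝ} (h : Ct f c ρ)
    (k0 : 0 < k) (hs : σ + k ≤ ρ) : Ct (Dk k f) c σ := by
  have A : ContinuousOn (fun z : ℝ × ℝ => f (z.1 + k) z.2) {z | InQ c σ z.1 z.2} :=
    ContinuousOn.comp (f := fun z : ℝ × ℝ => (z.1 + k, z.2)) h (by fun_prop)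
      (fun z hz => InQ.shift hz k0.le hs)
  exact (A.sub (h.mono (show σ ≤ ρ by linarith))).div_const k

lemma Lp.bd_dk {f : ℝ → ℝ → ℝ} {c : ℝ × ℝ} {σ ρ k M : ℝ} (h : Lp f c ρ M)
    (k0 : 0 < k) (hs : σ + k ≤ ρ) : Bd (Dk k f) c σ M := by
  intro x t hx
  have := h _ _ _ (hx.shift k0.le hs) (hx.mono (by linarith))
  rw [Dk, abs_div, abs_of_pos k0, div_le_iff₀ k0]
  simpa [abs_of_pos k0] using this

lemma Bd.lp {f f1 : ℝ → ℝ → ℝ} {c : ℝ × ℝ} {ρ M : ℝ} (hd : Dx f f1 c ρ) (h : Bd f1 c ρ M) :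
    Lp f c ρ M := by
  intro x y t hx hy
  have hconv : Convex ℝ (Icc (c.1 - ρ) (c.1 + ρ)) := convex_Icc _ _
  have mem : ∀ z, z ∈ Icc (c.1 - ρ) (c.1 + ρ) → InQ c ρ z t := fun z hz =>
    ⟨abs_le.2 ⟨by linarith [hz.1], by linarith [hz.2]⟩, hx.2⟩
  have mem' : ∀ z, InQ c ρ z t → z ∈ Icc (c.1 - ρ) (c.1 + ρ) := fun z hz => by
    have := abs_le.1 hz.1
    exact ⟨by linarith, by linarith⟩
  exact hconv.norm_image_sub_le_of_norm_hasDerivWithin_le (f := fun z => f z t)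
    (f' := fun z => f1 z t) (fun z hz => (hd z t (mem z hz)).hasDerivWithinAt)
    (fun z hz => h z t (mem z hz)) (mem' y hy) (mem' x hx)

lemma Lp.bd {f f1 : ℝ → ℝ → ℝ} {c : ℝ × ℝ} {σ ρ M : ℝ} (hM : 0 ≤ M) (h : Lp f c ρ M)
    (hd : Dx f f1 c ρ) (hs : σ < ρ) : Bd f1 c σ M := by
  intro x t hx
  have := (hd x t (hx.mono hs.le)).hasFDerivAt.le_of_lip' hM (by
    have : ∀ᶠ y in 𝓝 x, |y - x| < ρ - σ := by
      have := Metric.ball_mem_nhds x (sub_pos.2 hs)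
      filter_upwards [this] with y hy using hy
    filter_upwards [this] with y hy
    refine h y x t ⟨?_, hx.2.trans hs.le⟩ (hx.mono hs.le)
    calc |y - c.1| = |(y - x) + (x - c.1)| := by ring_nf
      _ ≤ _ := abs_add_le _ _
      _ ≤ ρ := by linarith [hx.1])
  simpa using this

lemma Lp.lp_dk {f f1 : ℝ → ℝ → ℝ} {c : ℝ × ℝ} {σ ρ k M : ℝ} (h : Lp f1 c ρ M) (hd : Dx f f1 c ρ)
    (k0 : 0 < k) (hs : σ + k ≤ ρ) : Lp (Dk k f) c σ M :=
  (h.bd_dk k0 hs).lp (hd.dk k0 hs)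

lemma dk_tendsto {f f1 : ℝ → ℝ → ℝ} {x t : ℝ} (h : HasDerivAt (fun y => f y t) (f1 x t) x) :
    Tendsto (fun k => Dk k f x t) (𝓝[>] 0) (𝓝 (f1 x t)) := by
  have := (hasDerivAt_iff_tendsto_slope_zero.1 h).mono_left
    (nhdsWithin_mono (0 : ℝ) (by intro y hy; exact ne_of_gt hy : Ioi (0:ℝ) ⊆ {0}ᶜ))
  refine this.congr fun k => ?_
  simp [Dk, div_eq_inv_mul]

lemma lp_lim {f f1 : ℝ → ℝ → ℝ} {c : ℝ × ℝ} {σ M ε : ℝ} (he : 0 < ε)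
    (h : ∀ k, 0 < k → k < ε → Lp (Dk k f) c σ M) (hd : Dx f f1 c σ) : Lp f1 c σ M := by
  intro x y t hx hy
  have A := ((dk_tendsto (hd x t hx)).sub (dk_tendsto (hd y t hy))).abs
  refine le_of_tendsto A ?_
  have : ∀ᶠ k in 𝓝[>] (0:ℝ), k < ε := (eventually_lt_nhds he).filter_mono nhdsWithin_le_nhds
  filter_upwards [this, self_mem_nhdsWithin] with k hk hk0
  exact h k hk0 hk x y t hx hy

/-- S0 -/
lemma S0 {K σ ρ M : ℝ} (hsr : σ < ρ) (hs0 : 0 < σ) (hr : ρ ≤ 1) (hM : 0 < M) {c : ℝ × ℝ}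
    {w w1 w2 H : ℝ → ℝ → ℝ} (hs : Sol K w w1 w2 H c ρ) (hc : Ct w c ρ) (hb : Bd w c ρ M)
    (hH : Bd H c ρ M) : Lp w c σ (4 * (2 + |K|) / (ρ - σ) * M) := by
  have hK := abs_nonneg K
  -- ordered version
  have main : ∀ x y t, InQ c σ x t → InQ c σ y t → y ≤ x → ∀ s : ℝ, (s = 1 ∨ s = -1) →
      s * (w x t - w y t) ≤ 4 * (2 + |K|) / (ρ - σ) * M * (x - y) := by
    intro x y t hx hy hxy s hsgn
    have d0 : 0 < ρ - σ := by linarith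
    have hss : |s| = 1 := by rcases hsgn with h | h <;> simp [h]
    rcases le_or_gt (x - y) (ρ - σ) with hle | hgt
    · have := abs_le.1 hx.1
      have := abs_le.1 hy.1
      have := abs_le.1 hx.2
      have inq : ∀ x' t', |x' - (x + y) / 2| ≤ 2 * ((ρ - σ) / 2) → t - ((ρ - σ) / 2) ^ 2 ≤ t' → t' ≤ t →
          InQ c ρ x' t' := by
        intro x' t' h1 h2 h3
        have := abs_le.1 h1
        refine ⟨abs_le.2 ⟨by linarith, by linarith⟩, abs_le.2 ⟨by nlinarith, by linarith⟩⟩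
      have := lip_mid (K := K) (r := (ρ - σ) / 2) (M := M) (by linarith) (by linarith) hM
        (v := fun x t => s * w x t) (v1 := fun x t => s * w1 x t) (v2 := fun x t => s * w2 x t)
        (H := fun x t => s * H x t) (m := (x + y) / 2) (t0 := t)
        (fun x' t' h1 h2 h3 => by
          obtain ⟨a1, a2, a3⟩ := hs x' t' (inq x' t' h1 h2 h3)
          exact ⟨a1.const_mul s, a2.const_mul s, (a3.const_mul s).congr_deriv (by ring)⟩)
        (ContinuousOn.mul continuousOn_const (ContinuousOn.mono hc (fun z hz => inq _ _ hz.1 hz.2.1 hz.2.2)))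
        (fun x' t' h1 h2 h3 => by
          rw [abs_mul, hss, one_mul]; exact hb _ _ (inq x' t' h1 h2 h3))
        (fun x' t' h1 h2 h3 => by
          rw [abs_mul, hss, one_mul]; exact hH _ _ (inq x' t' h1 h2 h3))
        (h := (x - y) / 2) (by linarith) (by linarith)
      have e1 : (x + y) / 2 + (x - y) / 2 = x := by ring
      have e2 : (x + y) / 2 - (x - y) / 2 = y := by ring
      simp only [e1, e2] at this
      rw [mul_sub]
      refine this.trans (le_of_eq ?_)
      field_simp
    · have h1 := abs_le.1 (hb _ _ (hx.mono hsr.le))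
      have h2 := abs_le.1 (hb _ _ (hy.mono hsr.le))
      have h3 : s * (w x t - w y t) ≤ 2 * M := by
        rcases hsgn with h | h <;> rw [h] <;> linarith
      refine h3.trans ?_
      have : 4 * (2 + |K|) / (ρ - σ) * M * (x - y) = 4 * (2 + |K|) * M * ((x - y) / (ρ - σ)) := by
        field_simp
      rw [this]
      have h4 : 1 ≤ (x - y) / (ρ - σ) := by rw [le_div_iff₀ d0]; linarith
      have h5 : 0 ≤ |K| * M := by positivity
      have h6 : 2 * M ≤ 4 * (2 + |K|) * M := by nlinarith
      calc 2 * M ≤ 4 * (2 + |K|) * M := h6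
        _ ≤ _ := le_mul_of_one_le_right (by positivity) h4
  intro x y t hx hy
  rcases le_total y x with h | h
  · have a := main x y t hx hy h 1 (Or.inl rfl)
    have b := main x y t hx hy h (-1) (Or.inr rfl)
    rw [abs_of_nonneg (sub_nonneg.2 h), abs_le]
    constructor <;> linarith
  · have a := main y x t hy hx h 1 (Or.inl rfl)
    have b := main y x t hy hx h (-1) (Or.inr rfl)
    rw [abs_of_nonpos (sub_nonpos.2 h), abs_le]
    constructor <;> linarith

/-- the constants -/
def C0 (K d : ℝ) : ℝ := 4 * (2 + |K|) / d
lemma C0_ge {K d : ℝ} (h0 : 0 < d) (h1 : d ≤ 1) : 1 ≤ C0 K d := by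
  unfold C0
  rw [le_div_iff₀ h0]
  nlinarith [abs_nonneg K]

lemma S1 {K d σ M : ℝ} (hd : 0 < d) (hs0 : 0 < σ) (hr : σ + 3 * d ≤ 1) (hM : 0 < M) {c : ℝ × ℝ}
    {w w1 w2 H : ℝ → ℝ → ℝ} (hs : Sol K w w1 w2 H c (σ + 3 * d)) (hc : Ct w c (σ + 3 * d))
    (hb : Bd w c (σ + 3 * d) M) (hH : Bd H c (σ + 3 * d) M) (hHl : Lp H c (σ + 3 * d) M) :
    Lp w1 c σ (C0 K d * (C0 K d * M)) := by
  have c1 : 1 ≤ C0 K d := C0_ge hd (by linarith)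
  have L := S0 (σ := σ + 2 * d) (ρ := σ + 3 * d) (by linarith) (by linarith) hr hM hs hc hb hH
  rw [show σ + 3 * d - (σ + 2 * d) = d by ring] at L
  have hM' : M ≤ C0 K d * M := by nlinarith
  refine lp_lim hd (fun k k0 kd => ?_) (hs.dx.mono (by linarith))
  have := S0 (σ := σ) (ρ := σ + d) (by linarith) hs0 (by linarith) (M := C0 K d * M) (by positivity)
    (hs.dk k0 (by linarith)) (hc.dk k0 (by linarith)) (L.bd_dk k0 (by linarith))
    ((hHl.bd_dk k0 (by linarith)).mono le_rfl hM')
  rwa [show σ + d - σ = d by ring] at this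

lemma S2 {K d σ M : ℝ} (hd : 0 < d) (hs0 : 0 < σ) (hr : σ + 5 * d ≤ 1) (hM : 0 < M) {c : ℝ × ℝ}
    {w w1 w2 H H1 : ℝ → ℝ → ℝ} (hs : Sol K w w1 w2 H c (σ + 5 * d)) (hc : Ct w c (σ + 5 * d))
    (hb : Bd w c (σ + 5 * d) M) (hH : Bd H c (σ + 5 * d) M) (hHl : Lp H c (σ + 5 * d) M)
    (hHd : Dx H H1 c (σ + 5 * d)) (hH1 : Lp H1 c (σ + 5 * d) M) :
    Lp w2 c σ (C0 K d * (C0 K d * (C0 K d * M))) := by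
  have c1 : 1 ≤ C0 K d := C0_ge hd (by linarith)
  have L := S0 (σ := σ + 4 * d) (ρ := σ + 5 * d) (by linarith) (by linarith) hr hM hs hc hb hH
  rw [show σ + 5 * d - (σ + 4 * d) = d by ring] at L
  have hM' : M ≤ C0 K d * M := by nlinarith
  refine lp_lim hd (fun k k0 kd => ?_) (hs.dx1.mono (by linarith))
  exact S1 (σ := σ) (d := d) hd hs0 (by linarith) (M := C0 K d * M) (by positivity)
    (hs.dk k0 (by linarith)) (hc.dk k0 (by linarith)) (L.bd_dk k0 (by linarith))
    ((hHl.bd_dk k0 (by linarith)).mono le_rfl hM')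
    ((hH1.lp_dk hHd k0 (by linarith)).mono le_rfl hM')

lemma S3 {K d σ M k : ℝ} (hd : 0 < d) (hs0 : 0 < σ) (hr : σ + 7 * d ≤ 1) (hM : 0 < M) {c : ℝ × ℝ}
    {w w1 w2 H H1 H2 : ℝ → ℝ → ℝ} (hs : Sol K w w1 w2 H c (σ + 7 * d)) (hc : Ct w c (σ + 7 * d))
    (hb : Bd w c (σ + 7 * d) M) (hH : Bd H c (σ + 7 * d) M) (hHl : Lp H c (σ + 7 * d) M)
    (hHd : Dx H H1 c (σ + 7 * d)) (hH1 : Lp H1 c (σ + 7 * d) M)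
    (hHd1 : Dx H1 H2 c (σ + 7 * d)) (hH2 : Lp H2 c (σ + 7 * d) M) (k0 : 0 < k) (kd : k < d) :
    Lp (Dk k w2) c σ (C0 K d * (C0 K d * (C0 K d * (C0 K d * M)))) := by
  have c1 : 1 ≤ C0 K d := C0_ge hd (by linarith)
  have L := S0 (σ := σ + 6 * d) (ρ := σ + 7 * d) (by linarith) (by linarith) hr hM hs hc hb hH
  rw [show σ + 7 * d - (σ + 6 * d) = d by ring] at L
  have hM' : M ≤ C0 K d * M := by nlinarith
  exact S2 (σ := σ) (d := d) hd hs0 (by linarith) (M := C0 K d * M) (by positivity)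
    (hs.dk k0 (by linarith)) (hc.dk k0 (by linarith)) (L.bd_dk k0 (by linarith))
    ((hHl.bd_dk k0 (by linarith)).mono le_rfl hM')
    ((hH1.lp_dk hHd k0 (by linarith)).mono le_rfl hM') (hHd.dk k0 (by linarith))
    ((hH2.lp_dk hHd1 k0 (by linarith)).mono le_rfl hM')

end RS
end
open Real Set
noncomputable section
namespace RS
open Filter Topology

def BdAt (f : ℝ → ℝ → ℝ) (z : ℝ × ℝ) : Prop := ∃ M, 0 < M ∧ ∀ᶠ ρ in 𝓝[>] (0:ℝ), Bd f z ρ M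
def BLAt (f : ℝ → ℝ → ℝ) (z : ℝ × ℝ) : Prop :=
  ∃ M, 0 < M ∧ ∀ᶠ ρ in 𝓝[>] (0:ℝ), Bd f z ρ M ∧ Lp f z ρ M

lemma BLAt.bdAt {f : ℝ → ℝ → ℝ} {z : ℝ × ℝ} (h : BLAt f z) : BdAt f z := by
  obtain ⟨M, hM, h⟩ := h
  exact ⟨M, hM, h.mono fun _ h => h.1⟩

lemma ev_of_one {f : ℝ → Prop} {ρ : ℝ} (hρ : 0 < ρ) (h : ∀ σ, 0 < σ → σ ≤ ρ → f σ) :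
    ∀ᶠ σ in 𝓝[>] (0:ℝ), f σ := by
  have : ∀ᶠ k in 𝓝[>] (0:ℝ), k < ρ := (eventually_lt_nhds hρ).filter_mono nhdsWithin_le_nhds
  filter_upwards [this, self_mem_nhdsWithin] with k hk hk0 using h k hk0 hk.le

lemma ev_pick {f : ℝ → Prop} (h : ∀ᶠ σ in 𝓝[>] (0:ℝ), f σ) {b : ℝ} (hb : 0 < b) :
    ∃ σ, 0 < σ ∧ σ < b ∧ f σ := by
  have h1 : ∀ᶠ k in 𝓝[>] (0:ℝ), k < b := (eventually_lt_nhds hb).filter_mono nhdsWithin_le_nhds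
  obtain ⟨σ, a, b, c⟩ := (h.and (h1.and self_mem_nhdsWithin)).exists
  exact ⟨σ, c, b, a⟩

lemma inQ_nhds (z : ℝ × ℝ) {ρ : ℝ} (hρ : 0 < ρ) : {y : ℝ × ℝ | InQ z ρ y.1 y.2} ∈ 𝓝 z := by
  have : Metric.closedBall z ρ ∈ 𝓝 z := Metric.closedBall_mem_nhds z hρ
  refine mem_of_superset this fun y hy => ?_
  rw [Metric.mem_closedBall, Prod.dist_eq, max_le_iff] at hy
  exact hy

lemma ev_of_nhds {P : ℝ × ℝ → Prop} {z : ℝ × ℝ} (h : ∀ᶠ y in 𝓝 z, P y) :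
    ∀ᶠ ρ in 𝓝[>] (0:ℝ), ∀ x t, InQ z ρ x t → P (x, t) := by
  obtain ⟨ε, he, h⟩ := Metric.eventually_nhds_iff.1 h
  refine ev_of_one (ρ := ε / 2) (by linarith) fun σ s0 hs x t hx => h ?_
  rw [Prod.dist_eq, max_lt_iff]
  exact ⟨lt_of_le_of_lt hx.1 (by linarith), lt_of_le_of_lt hx.2 (by linarith)⟩

lemma inQ_self (z : ℝ × ℝ) {ρ : ℝ} (hρ : 0 < ρ) : InQ z ρ z.1 z.2 := by
  constructor <;> simp [hρ.le]

lemma bdAt_of_cont {f : ℝ → ℝ → ℝ} {z : ℝ × ℝ}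
    (h : ContinuousAt (fun y : ℝ × ℝ => f y.1 y.2) z) : BdAt f z := by
  refine ⟨|f z.1 z.2| + 1, by positivity, ?_⟩
  have : ∀ᶠ y : ℝ × ℝ in 𝓝 z, |f y.1 y.2| < |f z.1 z.2| + 1 := h.abs.eventually_lt_const (by simp)
  exact (ev_of_nhds this).mono fun ρ h x t hx => (h x t hx).le

lemma BLAt.add {f g : ℝ → ℝ → ℝ} {z : ℝ × ℝ} (hf : BLAt f z) (hg : BLAt g z) :
    BLAt (fun x t => f x t + g x t) z := by
  obtain ⟨M, hM, hf⟩ := hf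
  obtain ⟨M', hM', hg⟩ := hg
  refine ⟨M + M', by positivity, ?_⟩
  filter_upwards [hf, hg] with ρ ⟨a, b⟩ ⟨c, d⟩
  refine ⟨fun x t hx => (abs_add_le _ _).trans (add_le_add (a x t hx) (c x t hx)), fun x y t hx hy => ?_⟩
  have h1 := b x y t hx hy
  have h2 := d x y t hx hy
  calc _ = |(f x t - f y t) + (g x t - g y t)| := by ring_nf
    _ ≤ _ := abs_add_le _ _
    _ ≤ _ := by linarith

lemma BLAt.mul {f g : ℝ → ℝ → ℝ} {z : ℝ × ℝ} (hf : BLAt f z) (hg : BLAt g z) :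
    BLAt (fun x t => f x t * g x t) z := by
  obtain ⟨M, hM, hf⟩ := hf
  obtain ⟨M', hM', hg⟩ := hg
  refine ⟨2 * (M * M'), by positivity, ?_⟩
  filter_upwards [hf, hg] with ρ ⟨a, b⟩ ⟨c, d⟩
  refine ⟨fun x t hx => ?_, fun x y t hx hy => ?_⟩
  · rw [abs_mul]
    have := mul_le_mul (a x t hx) (c x t hx) (abs_nonneg _) hM.le
    nlinarith [mul_pos hM hM']
  have h1 := b x y t hx hy
  have h2 := d x y t hx hy
  calc _ = |(f x t - f y t) * g x t + f y t * (g x t - g y t)| := by ring_nf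
    _ ≤ |f x t - f y t| * |g x t| + |f y t| * |g x t - g y t| := by
      rw [← abs_mul, ← abs_mul]; exact abs_add_le _ _
    _ ≤ (M * |x - y|) * M' + M * (M' * |x - y|) := by
      gcongr
      · exact c x t hx
      · exact a y t hy
    _ = _ := by ring

lemma BLAt.const (a : ℝ) (z : ℝ × ℝ) : BLAt (fun _ _ => a) z := by
  refine ⟨|a| + 1, by positivity, Eventually.of_forall fun ρ => ⟨fun x t _ => by simp, fun x y t _ _ => ?_⟩⟩
  simp only [sub_self, abs_zero]; positivity

lemma BLAt.comp {F : ℝ → ℝ} {f : ℝ → ℝ → ℝ} {z : ℝ × ℝ} (hf : BLAt f z)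
    (hc : ContinuousAt (fun y : ℝ × ℝ => f y.1 y.2) z) (hF : ContDiffAt ℝ 1 F (f z.1 z.2)) :
    BLAt (fun x t => F (f x t)) z := by
  obtain ⟨L, s, hs, hL⟩ := hF.exists_lipschitzOnWith
  obtain ⟨M, hM, hf⟩ := hf
  have hc' : ContinuousAt (fun y : ℝ × ℝ => F (f y.1 y.2)) z :=
    ContinuousAt.comp (f := fun y : ℝ × ℝ => f y.1 y.2) (x := z) hF.continuousAt hc
  obtain ⟨M', hM', hb⟩ := bdAt_of_cont (f := fun x t => F (f x t)) hc'
  have h1 : ∀ᶠ y : ℝ × ℝ in 𝓝 z, f y.1 y.2 ∈ s := hc hs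
  refine ⟨M' + L * M, by positivity, ?_⟩
  filter_upwards [hf, hb, ev_of_nhds h1] with ρ ⟨_, a⟩ b c
  refine ⟨b.mono le_rfl (le_add_of_nonneg_right (by positivity)), fun x y t hx hy => ?_⟩
  have h2 := hL.dist_le_mul _ (c x t hx) _ (c y t hy)
  rw [Real.dist_eq, Real.dist_eq] at h2
  have h3 := a x y t hx hy
  calc _ ≤ L * |f x t - f y t| := h2
    _ ≤ L * (M * |x - y|) := by gcongr
    _ ≤ _ := by nlinarith [mul_nonneg hM'.le (abs_nonneg (x - y))]

lemma dk_sub_le {f f1 : ℝ → ℝ → ℝ} {c : ℝ × ℝ} {σ ρ k M x t : ℝ} (hM : 0 ≤ M) (hd : Dx f f1 c ρ)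
    (h : Lp f1 c ρ M)
    (k0 : 0 < k) (hs : σ + k ≤ ρ) (hx : InQ c σ x t) : |Dk k f x t - f1 x t| ≤ M * k := by
  have mem : ∀ y ∈ Icc x (x + k), InQ c ρ y t := by
    intro y hy
    have := hx.shift (k := y - x) (ρ := ρ) (by linarith [hy.1]) (by linarith [hy.2])
    simpa using this
  have := (convex_Icc x (x + k)).norm_image_sub_le_of_norm_hasDerivWithin_le
    (f := fun y => f y t - f1 x t * y) (f' := fun y => f1 y t - f1 x t) (C := M * k)
    (fun y hy => ((hd y t (mem y hy)).sub (((hasDerivAt_id y).const_mul (f1 x t)))).congr_deriv (by simp) |>.hasDerivWithinAt)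
    (fun y hy => by
      refine (h y x t (mem y hy) (mem x ⟨le_rfl, by linarith⟩)).trans ?_
      gcongr
      rw [abs_of_nonneg (by linarith [hy.1])]; linarith [hy.2])
    (x := x) (y := x + k) ⟨le_rfl, by linarith⟩ ⟨by linarith, le_rfl⟩
  have e : Dk k f x t - f1 x t = (f (x + k) t - f1 x t * (x + k) - (f x t - f1 x t * x)) / k := by
    unfold Dk; field_simp; ring
  rw [e, abs_div, abs_of_pos k0, div_le_iff₀ k0]
  simpa [abs_of_pos k0] using this

lemma dk_unif {f f1 : ℝ → ℝ → ℝ} {c : ℝ × ℝ} {σ ρ M : ℝ} (hM : 0 < M) (hd : Dx f f1 c ρ)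
    (h : Lp f1 c ρ M) (hs : σ < ρ) :
    TendstoUniformlyOn (fun k (z : ℝ × ℝ) => Dk k f z.1 z.2) (fun z : ℝ × ℝ => f1 z.1 z.2)
      (𝓝[>] (0:ℝ)) {z | InQ c σ z.1 z.2} := by
  rw [Metric.tendstoUniformlyOn_iff]
  intro ε he
  have : 0 < ε / (2 * M) := by positivity
  refine ev_of_one (ρ := min (ρ - σ) (ε / (2 * M))) (lt_min (by linarith) this) fun k k0 hk z hz => ?_
  rw [le_min_iff] at hk
  rw [dist_comm, Real.dist_eq]
  refine (dk_sub_le hM.le hd h k0 (by linarith [hk.1]) hz).trans_lt ?_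
  have := hk.2
  rw [le_div_iff₀ (by positivity)] at this
  linarith

lemma BLAt.continuousAt {f f1 : ℝ → ℝ → ℝ} {G : Set (ℝ × ℝ)} (hG : IsOpen G) {z : ℝ × ℝ} (hz : z ∈ G)
    (hf : ContinuousOn (fun z : ℝ × ℝ => f z.1 z.2) G)
    (hd : ∀ z ∈ G, HasDerivAt (fun y => f y z.2) (f1 z.1 z.2) z.1) (h : BLAt f1 z) :
    ContinuousAt (fun z : ℝ × ℝ => f1 z.1 z.2) z := by
  obtain ⟨M, hM, h⟩ := h
  obtain ⟨ρ, r0, -, ⟨-, h1⟩, h2⟩ := ev_pick (h.and (ev_of_nhds (hG.mem_nhds hz))) one_pos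
  have := dk_unif (σ := ρ / 2) hM (fun x t hx => hd (x, t) (h2 x t hx)) h1 (by linarith)
  have hct : Ct f z ρ := hf.mono fun y hy => h2 _ _ hy
  have h3 := this.continuousOn (Eventually.frequently (ev_of_one (ρ := ρ / 2) (by linarith)
    fun k k0 hk => hct.dk (σ := ρ / 2) k0 (by linarith)))
  exact h3.continuousAt (inQ_nhds z (by linarith))

lemma diff_of_equiLip {g : ℝ → ℝ} {x0 σ M C d : ℝ} (hσ : 0 < σ) (hd : 0 < d) (hM : 0 < M) (hC : 0 < C)
    (hL : ∀ x ∈ Icc (x0 - σ) (x0 + σ), ∀ y ∈ Icc (x0 - σ) (x0 + σ), |g x - g y| ≤ M * |x - y|)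
    (hD : ∀ k, 0 < k → k < d → ∀ x ∈ Icc (x0 - σ) (x0 + σ), ∀ y ∈ Icc (x0 - σ) (x0 + σ),
      |(g (x + k) - g x) / k - (g (y + k) - g y) / k| ≤ C * |x - y|) :
    DifferentiableAt ℝ g x0 := by
  have hx0 : x0 ∈ Icc (x0 - σ) (x0 + σ) := ⟨by linarith, by linarith⟩
  have lip : LipschitzOnWith (M.toNNReal) g (Icc (x0 - σ) (x0 + σ)) := by
    refine LipschitzOnWith.of_dist_le_mul fun x hx y hy => ?_
    rw [Real.coe_toNNReal _ hM.le]
    exact hL x hx y hy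
  have ae := lip.ae_differentiableWithinAt_of_mem (μ := MeasureTheory.volume)
  have dense : ∀ ε, 0 < ε → ∃ y ∈ Ioo x0 (x0 + σ), y < x0 + ε ∧ DifferentiableAt ℝ g y := by
    intro ε he
    have hpos : MeasureTheory.volume (Ioo x0 (x0 + min ε σ)) ≠ 0 := by
      rw [Real.volume_Ioo]
      have := lt_min he hσ
      simp
      exact ⟨he, hσ⟩
    have := MeasureTheory.frequently_ae_mem_iff.2 hpos
    obtain ⟨y, h1, h2⟩ := (this.and_eventually ae).exists
    have a := h1.2
    have b := min_le_left ε σ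
    have c := min_le_right ε σ
    refine ⟨y, ⟨h1.1, by linarith⟩, by linarith, ?_⟩
    exact (h2 ⟨by linarith [h1.1], by linarith⟩).differentiableAt (Icc_mem_nhds (by linarith [h1.1]) (by linarith))
  -- Cauchy
  have right : ∃ L, Tendsto (fun k => (g (x0 + k) - g x0) / k) (𝓝[>] 0) (𝓝 L) := by
    apply cauchy_map_iff_exists_tendsto.1
    rw [Metric.cauchy_iff]
    refine ⟨inferInstance, fun ε he => ?_⟩
    obtain ⟨y, hy, hy1, hy2⟩ := dense (ε / (8 * C)) (by positivity)
    have hyC : C * |x0 - y| ≤ ε / 8 := by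
      rw [abs_of_neg (by linarith [hy.1])]
      have : y - x0 < ε / (8 * C) := by linarith
      rw [lt_div_iff₀ (by positivity)] at this
      linarith
    have T := dk_tendsto (f := fun x _ => g x) (f1 := fun _ _ => deriv g y) (x := y) (t := 0) hy2.hasDerivAt
    have ev := (Metric.tendsto_nhds.1 T) (ε / 8) (by positivity)
    have ev2 := ev.and (ev_of_one (f := fun k => 0 < k ∧ k < d) (ρ := d / 2) (by linarith)
      fun k a b => ⟨a, by linarith⟩)
    refine ⟨_, image_mem_map ev2, ?_⟩
    have est : ∀ k, (dist (Dk k (fun x _ => g x) y (0:ℝ)) (deriv g y) < ε / 8 ∧ 0 < k ∧ k < d) →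
        |(g (x0 + k) - g x0) / k - deriv g y| < ε / 4 := by
      rintro k ⟨h1, h2, h3⟩
      have h4 := hD k h2 h3 x0 hx0 y ⟨by linarith [hy.1], hy.2.le⟩
      rw [Real.dist_eq] at h1
      simp only [Dk] at h1
      have := abs_le.1 h4
      have := abs_lt.1 h1
      rw [abs_lt]
      constructor <;> linarith
    rintro _ ⟨k, hk, rfl⟩ _ ⟨k', hk', rfl⟩
    have a := abs_lt.1 (est k hk)
    have b := abs_lt.1 (est k' hk')
    rw [Real.dist_eq, abs_lt]
    constructor <;> linarith
  obtain ⟨L, hL'⟩ := right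
  refine HasDerivAt.differentiableAt (f' := L) ?_
  rw [hasDerivAt_iff_tendsto_slope_zero, ← Iio_union_Ioi, nhdsWithin_union, tendsto_sup]
  constructor
  · have neg : Tendsto (fun k : ℝ => -k) (𝓝[<] 0) (𝓝[>] 0) := by
      have := tendsto_neg_nhdsLT (a := (0:ℝ))
      simpa using this
    have h1 : Tendsto (fun k : ℝ => (g (x0 + -k) - g x0) / (-k)) (𝓝[<] 0) (𝓝 L) := hL'.comp neg
    have h2 : Tendsto (fun k : ℝ => k⁻¹ • (g (x0 + k) - g x0) - (g (x0 + -k) - g x0) / (-k)) (𝓝[<] 0) (𝓝 0) := by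
      have hb : Tendsto (fun k : ℝ => C * (-k)) (𝓝[<] 0) (𝓝 0) := by
        have : Continuous fun k : ℝ => C * (-k) := by fun_prop
        have := (this.tendsto 0).mono_left (nhdsWithin_le_nhds (s := Iio 0))
        simpa using this
      refine squeeze_zero_norm' ?_ hb
      have e1 : ∀ᶠ k in 𝓝[<] (0:ℝ), -min d σ < k :=
        (eventually_gt_nhds (by simp [hd, hσ])).filter_mono nhdsWithin_le_nhds
      filter_upwards [e1, self_mem_nhdsWithin] with k hk hk0
      have hk0 : k < 0 := hk0
      have := min_le_left d σ
      have := min_le_right d σ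
      have h4 := hD (-k) (by linarith) (by linarith) (x0 + k) ⟨by linarith, by linarith⟩ x0 hx0
      rw [show x0 + k + -k = x0 by ring, show x0 + k - x0 = k by ring, abs_of_neg hk0] at h4
      rw [Real.norm_eq_abs]
      convert h4 using 3
      rw [smul_eq_mul]
      field_simp
      ring
    have := h2.add h1
    simpa using this
  · refine hL'.congr fun k => ?_
    simp [div_eq_inv_mul]
end RS
end
open Real Set
noncomputable section
namespace RS
open Filter Topology

def SolOn (K : ℝ) (G : Set (ℝ × ℝ)) (w w1 w2 H : ℝ → ℝ → ℝ) : Prop :=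
  ∀ z ∈ G, SolAt K w w1 w2 H z.1 z.2
def CtOn (G : Set (ℝ × ℝ)) (f : ℝ → ℝ → ℝ) : Prop := ContinuousOn (fun z : ℝ × ℝ => f z.1 z.2) G
def DxOn (G : Set (ℝ × ℝ)) (f f1 : ℝ → ℝ → ℝ) : Prop :=
  ∀ z ∈ G, HasDerivAt (fun y => f y z.2) (f1 z.1 z.2) z.1
def BLOn (G : Set (ℝ × ℝ)) (f : ℝ → ℝ → ℝ) : Prop := ∀ z ∈ G, BLAt f z

lemma BLAt.of_one {f : ℝ → ℝ → ℝ} {z : ℝ × ℝ} {ρ M M' : ℝ} (hρ : 0 < ρ) (hM : 0 ≤ M) (hM' : 0 < M')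
    (h : Bd f z ρ M) (h' : Lp f z ρ M') : BLAt f z :=
  ⟨M + M', by linarith, ev_of_one hρ fun _ _ hσ =>
    ⟨h.mono hσ (by linarith), h'.mono hσ (by linarith)⟩⟩

section
variable {K : ℝ} {G : Set (ℝ × ℝ)} (hG : IsOpen G) {w w1 w2 H H1 H2 : ℝ → ℝ → ℝ}

lemma T0 (hG : IsOpen G) (hs : SolOn K G w w1 w2 H) (hc : CtOn G w) (hH : ∀ z ∈ G, BdAt H z) :
    BLOn G w := by
  intro z hz
  obtain ⟨M, hM, h1⟩ := bdAt_of_cont (hc.continuousAt (hG.mem_nhds hz))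
  obtain ⟨M', hM', h2⟩ := hH z hz
  obtain ⟨ρ, r0, r1, ⟨h1, h2⟩, h3⟩ := ev_pick ((h1.and h2).and (ev_of_nhds (hG.mem_nhds hz))) one_pos
  have := S0 (σ := ρ / 2) (ρ := ρ) (M := M + M') (by linarith) (by linarith) r1.le (by linarith)
    (fun x t hx => hs _ (h3 x t hx)) (hc.mono fun y hy => h3 _ _ hy) (h1.mono le_rfl (by linarith))
    (h2.mono le_rfl (by linarith))
  refine BLAt.of_one (ρ := ρ / 2) (by linarith) hM.le ?_ (h1.mono (by linarith) le_rfl) this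
  have : 0 < C0 K (ρ - ρ / 2) := lt_of_lt_of_le one_pos (C0_ge (by linarith) (by linarith))
  exact mul_pos this (by linarith)

lemma T1 (hG : IsOpen G) (hs : SolOn K G w w1 w2 H) (hc : CtOn G w) (hH : BLOn G H) :
    BLOn G w1 := by
  intro z hz
  obtain ⟨M, hM, h1⟩ := T0 hG hs hc (fun z hz => (hH z hz).bdAt) z hz
  obtain ⟨M', hM', h2⟩ := hH z hz
  obtain ⟨ρ, r0, r1, ⟨⟨h1, h1'⟩, h2, h2'⟩, h3⟩ :=
    ev_pick ((h1.and h2).and (ev_of_nhds (hG.mem_nhds hz))) one_pos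
  have hsol : Sol K w w1 w2 H z ρ := fun x t hx => hs _ (h3 x t hx)
  have hct : Ct w z ρ := hc.mono fun y hy => h3 _ _ hy
  have e : ρ / 4 + 3 * (ρ / 4) = ρ := by ring
  have := S1 (K := K) (c := z) (w := w) (w1 := w1) (w2 := w2) (H := H) (σ := ρ / 4) (d := ρ / 4)
    (M := M + M') (by linarith) (by linarith) (by linarith) (by linarith)
    (by rw [e]; exact hsol) (by rw [e]; exact hct) (by rw [e]; exact h1.mono le_rfl (by linarith))
    (by rw [e]; exact h2.mono le_rfl (by linarith)) (by rw [e]; exact h2'.mono le_rfl (by linarith))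
  refine BLAt.of_one (ρ := ρ / 4) (by linarith) hM.le ?_ (h1'.bd hM.le hsol.dx (by linarith)) this
  have : 0 < C0 K (ρ / 4) := lt_of_lt_of_le one_pos (C0_ge (by linarith) (by linarith))
  positivity

lemma T2 (hG : IsOpen G) (hs : SolOn K G w w1 w2 H) (hc : CtOn G w) (hH : BLOn G H)
    (hd : DxOn G H H1) (hH1 : BLOn G H1) : BLOn G w2 := by
  intro z hz
  obtain ⟨M, hM, h1⟩ := T0 hG hs hc (fun z hz => (hH z hz).bdAt) z hz
  obtain ⟨M', hM', h2⟩ := hH z hz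
  obtain ⟨M1, hM1, h4⟩ := hH1 z hz
  obtain ⟨N, hN, h5⟩ := T1 hG hs hc hH z hz
  obtain ⟨ρ, r0, r1, ⟨⟨⟨⟨h1, h1'⟩, h2, h2'⟩, h4, h4'⟩, h5, h5'⟩, h3⟩ :=
    ev_pick ((((h1.and h2).and h4).and h5).and (ev_of_nhds (hG.mem_nhds hz))) one_pos
  have hsol : Sol K w w1 w2 H z ρ := fun x t hx => hs _ (h3 x t hx)
  have hct : Ct w z ρ := hc.mono fun y hy => h3 _ _ hy
  have hdx : Dx H H1 z ρ := fun x t hx => hd _ (h3 x t hx)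
  have e : ρ / 6 + 5 * (ρ / 6) = ρ := by ring
  have := S2 (K := K) (c := z) (w := w) (w1 := w1) (w2 := w2) (H := H) (H1 := H1) (σ := ρ / 6) (d := ρ / 6)
    (M := M + M' + M1) (by linarith) (by linarith) (by linarith) (by linarith)
    (by rw [e]; exact hsol) (by rw [e]; exact hct) (by rw [e]; exact h1.mono le_rfl (by linarith))
    (by rw [e]; exact h2.mono le_rfl (by linarith)) (by rw [e]; exact h2'.mono le_rfl (by linarith))
    (by rw [e]; exact hdx) (by rw [e]; exact h4'.mono le_rfl (by linarith))
  refine BLAt.of_one (ρ := ρ / 6) (by linarith) hN.le ?_ (h5'.bd hN.le hsol.dx1 (by linarith)) this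
  have : 0 < C0 K (ρ / 6) := lt_of_lt_of_le one_pos (C0_ge (by linarith) (by linarith))
  positivity

lemma T3 (hG : IsOpen G) (hs : SolOn K G w w1 w2 H) (hc : CtOn G w) (hH : BLOn G H)
    (hd : DxOn G H H1) (hH1 : BLOn G H1) (hd1 : DxOn G H1 H2) (hH2 : BLOn G H2) :
    ∃ w3, DxOn G w2 w3 ∧ BLOn G w3 := by
  have key : ∀ z ∈ G, ∃ ρ > 0, ∃ d > 0, ∃ M > 0, ∃ C > 0, Lp w2 z ρ M ∧
      (∀ k, 0 < k → k < d → Lp (Dk k w2) z ρ C) ∧ ∀ x t, InQ z ρ x t → (x, t) ∈ G := by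
    intro z hz
    obtain ⟨M, hM, h1⟩ := T0 hG hs hc (fun z hz => (hH z hz).bdAt) z hz
    obtain ⟨M', hM', h2⟩ := hH z hz
    obtain ⟨M1, hM1, h4⟩ := hH1 z hz
    obtain ⟨M2, hM2, h6⟩ := hH2 z hz
    obtain ⟨N, hN, h5⟩ := T2 hG hs hc hH hd hH1 z hz
    obtain ⟨ρ, r0, r1, ⟨⟨⟨⟨⟨h1, h1'⟩, h2, h2'⟩, h4, h4'⟩, h5, h5'⟩, h6, h6'⟩, h3⟩ :=
      ev_pick (((((h1.and h2).and h4).and h5).and h6).and (ev_of_nhds (hG.mem_nhds hz))) one_pos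
    have hsol : Sol K w w1 w2 H z ρ := fun x t hx => hs _ (h3 x t hx)
    have hct : Ct w z ρ := hc.mono fun y hy => h3 _ _ hy
    have hdx : Dx H H1 z ρ := fun x t hx => hd _ (h3 x t hx)
    have hdx1 : Dx H1 H2 z ρ := fun x t hx => hd1 _ (h3 x t hx)
    have e : ρ / 8 + 7 * (ρ / 8) = ρ := by ring
    refine ⟨ρ / 8, by linarith, ρ / 8, by linarith, N, hN,
      C0 K (ρ / 8) * (C0 K (ρ / 8) * (C0 K (ρ / 8) * (C0 K (ρ / 8) * (M + M' + M1 + M2)))), ?_, h5'.mono (by linarith) le_rfl,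
      fun k k0 kd => ?_, fun x t hx => h3 x t (hx.mono (by linarith))⟩
    rotate_left
    · exact S3 (K := K) (c := z) (w := w) (w1 := w1) (w2 := w2) (H := H) (H1 := H1) (H2 := H2) (σ := ρ / 8) (d := ρ / 8)
        (M := M + M' + M1 + M2) (by linarith) (by linarith) (by linarith) (by linarith)
        (by rw [e]; exact hsol) (by rw [e]; exact hct) (by rw [e]; exact h1.mono le_rfl (by linarith))
        (by rw [e]; exact h2.mono le_rfl (by linarith)) (by rw [e]; exact h2'.mono le_rfl (by linarith))
        (by rw [e]; exact hdx) (by rw [e]; exact h4'.mono le_rfl (by linarith))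
        (by rw [e]; exact hdx1) (by rw [e]; exact h6'.mono le_rfl (by linarith)) k0 kd
    · have : 0 < C0 K (ρ / 8) := lt_of_lt_of_le one_pos (C0_ge (by linarith) (by linarith))
      show 0 < _
      positivity
  have hdiff : DxOn G w2 (fun x t => deriv (fun y => w2 y t) x) := by
    intro z hz
    obtain ⟨ρ, r0, d, d0, M, hM, C, hC, h1, h2, -⟩ := key z hz
    refine (diff_of_equiLip (g := fun y => w2 y z.2) r0 d0 hM hC (fun x hx y hy => ?_)
      fun k k0 kd x hx y hy => ?_).hasDerivAt
    · exact h1 x y z.2 ⟨abs_le.2 ⟨by linarith [hx.1], by linarith [hx.2]⟩, by simp [r0.le]⟩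
        ⟨abs_le.2 ⟨by linarith [hy.1], by linarith [hy.2]⟩, by simp [r0.le]⟩
    · exact h2 k k0 kd x y z.2 ⟨abs_le.2 ⟨by linarith [hx.1], by linarith [hx.2]⟩, by simp [r0.le]⟩
        ⟨abs_le.2 ⟨by linarith [hy.1], by linarith [hy.2]⟩, by simp [r0.le]⟩
  refine ⟨_, hdiff, fun z hz => ?_⟩
  obtain ⟨ρ, r0, d, d0, M, hM, C, hC, h1, h2, h3⟩ := key z hz
  have hdx : Dx w2 (fun x t => deriv (fun y => w2 y t) x) z ρ := fun x t hx => hdiff _ (h3 x t hx)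
  exact BLAt.of_one (ρ := ρ / 2) (by linarith) hM.le hC (h1.bd hM.le hdx (by linarith))
    ((lp_lim d0 h2 hdx).mono (by linarith) le_rfl)

lemma T4 (hG : IsOpen G) {f f1 : ℝ → ℝ → ℝ} (hf : CtOn G f) (hd : DxOn G f f1) (h : BLOn G f1) :
    CtOn G f1 := fun z hz => (BLAt.continuousAt hG hz hf hd (h z hz)).continuousWithinAt

lemma T5 (hG : IsOpen G) (hs : SolOn K G w w1 w2 H) {w3 : ℝ → ℝ → ℝ}
    (hd : DxOn G H H1) (h1 : BLOn G w1) (h2 : BLOn G w2) (h3 : BLOn G w3) (hH1 : BLOn G H1)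
    (hw3 : DxOn G w2 w3) : SolOn K G w1 w2 w3 H1 := by
  intro z hz
  refine ⟨(hs z hz).2.1, hw3 z hz, ?_⟩
  obtain ⟨M1, hM1, a1⟩ := h1 z hz
  obtain ⟨M2, hM2, a2⟩ := h2 z hz
  obtain ⟨M3, hM3, a3⟩ := h3 z hz
  obtain ⟨M4, hM4, a4⟩ := hH1 z hz
  obtain ⟨ρ, r0, r1, ⟨⟨⟨⟨-, a1⟩, -, a2⟩, -, a3⟩, -, a4⟩, inG⟩ :=
    ev_pick ((((a1.and a2).and a3).and a4).and (ev_of_nhds (hG.mem_nhds hz))) one_pos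
  have u2 := dk_unif (σ := ρ / 2) hM2 (fun x t hx => (hs _ (inG x t hx)).2.1) a2 (by linarith)
  have u3 := dk_unif (σ := ρ / 2) hM3 (fun x t hx => hw3 _ (inG x t hx)) a3 (by linarith)
  have u4 := dk_unif (σ := ρ / 2) hM4 (fun x t hx => hd _ (inG x t hx)) a4 (by linarith)
  have hsol : Sol K w w1 w2 H z ρ := fun x t hx => hs _ (inG x t hx)
  have inq : ∀ t ∈ Ioo (z.2 - ρ / 2) (z.2 + ρ / 2), InQ z (ρ / 2) z.1 t := fun t ht =>
    ⟨by simp; linarith, abs_le.2 ⟨by linarith [ht.1], by linarith [ht.2]⟩⟩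
  refine hasDerivAt_of_tendstoUniformlyOn (l := 𝓝[>] (0:ℝ)) (s := Ioo (z.2 - ρ / 2) (z.2 + ρ / 2))
    (f := fun k t => Dk k w z.1 t) (f' := fun k t => Dk k w2 z.1 t + K * Dk k w1 z.1 t + Dk k H z.1 t)
    (g := fun t => w1 z.1 t) (g' := fun t => w3 z.1 t + K * w2 z.1 t + H1 z.1 t) isOpen_Ioo ?_ ?_ ?_
    ⟨by linarith, by linarith⟩
  · rw [Metric.tendstoUniformlyOn_iff] at u2 u3 u4 ⊢
    intro ε he
    have hK := abs_nonneg K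
    filter_upwards [u2 (ε / (4 * (|K| + 1))) (by positivity), u3 (ε / 4) (by positivity),
      u4 (ε / 4) (by positivity)] with k b2 b3 b4 t ht
    have b2 := b2 (z.1, t) (inq t ht)
    have b3 := b3 (z.1, t) (inq t ht)
    have b4 := b4 (z.1, t) (inq t ht)
    simp only [Real.dist_eq] at b2 b3 b4 ⊢
    rw [lt_div_iff₀ (by positivity)] at b2
    have b5 : |K * (w2 z.1 t - Dk k w1 z.1 t)| ≤ ε / 4 := by
      rw [abs_mul]
      nlinarith [abs_nonneg (w2 z.1 t - Dk k w1 z.1 t)]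
    rw [abs_lt] at b3 b4 ⊢
    rw [abs_le] at b5
    constructor <;> linarith
  · refine ev_of_one (ρ := ρ / 2) (by linarith) fun k k0 hk t ht => ?_
    exact (hsol.dk (σ := ρ / 2) k0 (by linarith) z.1 t (inq t ht)).2.2
  · intro t ht
    exact dk_tendsto (hs _ (inG _ _ ((inq t ht).mono (by linarith)))).1
end

/-- Regularity of continuous solutions of the semilinear equation. -/
theorem regularity {K : ℝ} {G : Set (ℝ × ℝ)} (hG : IsOpen G) {v v1 v2 : ℝ → ℝ → ℝ}
    {F F1 F2 F3 : ℝ → ℝ} (hF : ∀ y, 0 < y → HasDerivAt F (F1 y) y)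
    (hF1 : ∀ y, 0 < y → HasDerivAt F1 (F2 y) y) (hF2 : ∀ y, 0 < y → HasDerivAt F2 (F3 y) y)
    (cF : ∀ y, 0 < y → ContDiffAt ℝ 1 F y) (cF1 : ∀ y, 0 < y → ContDiffAt ℝ 1 F1 y)
    (cF2 : ∀ y, 0 < y → ContDiffAt ℝ 1 F2 y) (cF3 : ∀ y, 0 < y → ContDiffAt ℝ 1 F3 y)
    (hs : SolOn K G v v1 v2 (fun x t => F (v x t))) (hp : ∀ z ∈ G, 0 < v z.1 z.2)
    (hc : CtOn G v) : ∃ v3 v4, CtOn G v1 ∧ CtOn G v2 ∧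
      SolOn K G v1 v2 v3 (fun x t => F1 (v x t) * v1 x t) ∧
      SolOn K G v2 v3 v4 (fun x t => F2 (v x t) * v1 x t ^ 2 + F1 (v x t) * v2 x t) := by
  have ca : ∀ z ∈ G, ContinuousAt (fun y : ℝ × ℝ => v y.1 y.2) z := fun z hz => hc.continuousAt (hG.mem_nhds hz)
  have bH : ∀ z ∈ G, BdAt (fun x t => F (v x t)) z := fun z hz =>
    bdAt_of_cont (ContinuousAt.comp (f := fun y : ℝ × ℝ => v y.1 y.2) (x := z)
      (cF _ (hp z hz)).continuousAt (ca z hz))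
  have b0 := T0 hG hs hc bH
  have bF : BLOn G (fun x t => F (v x t)) := fun z hz => (b0 z hz).comp (ca z hz) (cF _ (hp z hz))
  have bF1 : BLOn G (fun x t => F1 (v x t)) := fun z hz => (b0 z hz).comp (ca z hz) (cF1 _ (hp z hz))
  have bF2 : BLOn G (fun x t => F2 (v x t)) := fun z hz => (b0 z hz).comp (ca z hz) (cF2 _ (hp z hz))
  have bF3 : BLOn G (fun x t => F3 (v x t)) := fun z hz => (b0 z hz).comp (ca z hz) (cF3 _ (hp z hz))
  have b1 := T1 hG hs hc bF
  have dv : DxOn G v v1 := fun z hz => (hs z hz).1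
  have dv1 : DxOn G v1 v2 := fun z hz => (hs z hz).2.1
  have d0 : DxOn G (fun x t => F (v x t)) (fun x t => F1 (v x t) * v1 x t) := fun z hz =>
    (hF _ (hp z hz)).comp z.1 (dv z hz)
  have d1 : DxOn G (fun x t => F1 (v x t)) (fun x t => F2 (v x t) * v1 x t) := fun z hz =>
    (hF1 _ (hp z hz)).comp z.1 (dv z hz)
  have d2 : DxOn G (fun x t => F2 (v x t)) (fun x t => F3 (v x t) * v1 x t) := fun z hz =>
    (hF2 _ (hp z hz)).comp z.1 (dv z hz)
  have bH1 : BLOn G (fun x t => F1 (v x t) * v1 x t) := fun z hz => (bF1 z hz).mul (b1 z hz)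
  have b2 := T2 hG hs hc bF d0 bH1
  have sq : (fun x t => v1 x t ^ 2) = fun x t => v1 x t * v1 x t := by ext; ring
  have bH2 : BLOn G (fun x t => F2 (v x t) * v1 x t ^ 2 + F1 (v x t) * v2 x t) := fun z hz =>
    ((bF2 z hz).mul (by rw [sq]; exact (b1 z hz).mul (b1 z hz))).add ((bF1 z hz).mul (b2 z hz))
  have dH1 : DxOn G (fun x t => F1 (v x t) * v1 x t)
      (fun x t => F2 (v x t) * v1 x t ^ 2 + F1 (v x t) * v2 x t) := fun z hz =>
    ((d1 z hz).mul (dv1 z hz)).congr_deriv (by ring)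
  obtain ⟨v3, dv2, b3⟩ := T3 hG hs hc bF d0 bH1 dH1 bH2
  have s1 := T5 hG hs d0 b1 b2 b3 bH1 dv2
  have c1 := T4 hG hc dv b1
  have c2 := T4 hG c1 dv1 b2
  have dH2 : DxOn G (fun x t => F2 (v x t) * v1 x t ^ 2 + F1 (v x t) * v2 x t)
      (fun x t => F3 (v x t) * v1 x t * (v1 x t * v1 x t) + 3 * (F2 (v x t) * (v1 x t * v2 x t))
        + F1 (v x t) * v3 x t) := fun z hz =>
    (((d2 z hz).mul ((dv1 z hz).pow 2)).add ((d1 z hz).mul (dv2 z hz))).congr_deriv (by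
      simp; ring)
  have bH3 : BLOn G (fun x t => F3 (v x t) * v1 x t * (v1 x t * v1 x t) + 3 * (F2 (v x t) * (v1 x t * v2 x t))
        + F1 (v x t) * v3 x t) := fun z hz =>
    (((((bF3 z hz).mul (b1 z hz)).mul ((b1 z hz).mul (b1 z hz)))).add
      ((BLAt.const 3 z).mul ((bF2 z hz).mul ((b1 z hz).mul (b2 z hz))))).add ((bF1 z hz).mul (b3 z hz))
  obtain ⟨v4, dv3, b4⟩ := T3 hG s1 c1 bH1 dH1 bH2 dH2 bH3
  have s2 := T5 hG s1 dH1 b2 b3 b4 bH2 dv3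
  exact ⟨v3, v4, c1, c2, s1, s2⟩
end RS
end
open Real Set
noncomputable section
namespace RS
open Filter Topology

/-- log-solution with enough derivatives -/
structure FS (K lam q : ℝ) (G : Set (ℝ × ℝ)) (f f1 f2 f3 f4 : ℝ → ℝ → ℝ) : Prop where
  c0 : CtOn G f
  c1 : CtOn G f1
  c2 : CtOn G f2
  d0 : DxOn G f f1
  d1 : DxOn G f1 f2
  d2 : DxOn G f2 f3
  d3 : DxOn G f3 f4
  t0 : ∀ z ∈ G, HasDerivAt (fun s => f z.1 s)
    (f2 z.1 z.2 + f1 z.1 z.2 ^ 2 + K * f1 z.1 z.2 - lam + exp (q * f z.1 z.2)) z.2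
  t1 : ∀ z ∈ G, HasDerivAt (fun s => f1 z.1 s)
    (f3 z.1 z.2 + 2 * f1 z.1 z.2 * f2 z.1 z.2 + K * f2 z.1 z.2 + q * exp (q * f z.1 z.2) * f1 z.1 z.2) z.2
  t2 : ∀ z ∈ G, HasDerivAt (fun s => f2 z.1 s)
    (f4 z.1 z.2 + 2 * f2 z.1 z.2 ^ 2 + 2 * f1 z.1 z.2 * f3 z.1 z.2 + K * f3 z.1 z.2
      + q * exp (q * f z.1 z.2) * f2 z.1 z.2 + q ^ 2 * exp (q * f z.1 z.2) * f1 z.1 z.2 ^ 2) z.2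

def Zc (a s ρ x t : ℝ) : ℝ := (t - (s - ρ ^ 2)) * ((ρ ^ 2 - (x - a) ^ 2) ^ 2 / ρ ^ 4)

set_option maxHeartbeats 1000000 in
lemma LY_max {K lam q : ℝ} {G : Set (ℝ × ℝ)} (hG : IsOpen G) {f f1 f2 f3 f4 : ℝ → ℝ → ℝ}
    (hf : FS K lam q G f f1 f2 f3 f4) {a s ρ α β k ω : ℝ} (hρ : 0 < ρ) (hω : 0 < ω)
    (hcyl : ∀ x t, |x - a| ≤ ρ → s - ρ ^ 2 ≤ t → t ≤ s → (x, t) ∈ G) :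
    -(f2 a s + α * f1 a s ^ 2 + β * exp (q * f a s)) * exp (k * f a s) * (ρ ^ 2) ^ ω ≤ 0 ∨
    ∃ x t B, |x - a| < ρ ∧ s - ρ ^ 2 < t ∧ t ≤ s ∧ 0 < B ∧
      f2 x t + α * f1 x t ^ 2 + β * exp (q * f x t) = -B ∧
      -(f2 a s + α * f1 a s ^ 2 + β * exp (q * f a s)) * exp (k * f a s) * (ρ ^ 2) ^ ω
        ≤ B * exp (k * f x t) * (Zc a s ρ x t) ^ ω ∧
      2 * (1 - α) * f2 x t ^ 2 - q * exp (q * f x t) * B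
        + q * exp (q * f x t) * f1 x t ^ 2 * (q + α - β * (1 + q)) - β * lam * q * exp (q * f x t)
        + B * (k * (1 - k) * f1 x t ^ 2 - k * exp (q * f x t) + k * lam
          - K * (4 * ω * (x - a) / (ρ ^ 2 - (x - a) ^ 2))
          - 2 * (1 - k) * (4 * ω * (x - a) / (ρ ^ 2 - (x - a) ^ 2)) * f1 x t
          - (4 * ω * (x - a) / (ρ ^ 2 - (x - a) ^ 2)) ^ 2 - ω / (t - (s - ρ ^ 2))
          - ω * (4 / (ρ ^ 2 - (x - a) ^ 2) + 8 * (x - a) ^ 2 / (ρ ^ 2 - (x - a) ^ 2) ^ 2)) ≤ 0 := by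
  have hρ2 : 0 < ρ ^ 2 := by positivity
  let P : ℝ → ℝ → ℝ := fun x t => f2 x t + α * f1 x t ^ 2 + β * exp (q * f x t)
  let Φ : ℝ × ℝ → ℝ := fun z => -P z.1 z.2 * exp (k * f z.1 z.2) * (Zc a s ρ z.1 z.2) ^ ω
  let D : Set (ℝ × ℝ) := Icc (a - ρ) (a + ρ) ×ˢ Icc (s - ρ ^ 2) s
  have hDG : D ⊆ G := by
    rintro ⟨x, t⟩ ⟨⟨h1, h2⟩, h3, h4⟩
    simp only at h1 h2 h3 h4
    exact hcyl x t (abs_le.2 ⟨by linarith, by linarith⟩) h3 h4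
  have hDc : IsCompact D := isCompact_Icc.prod isCompact_Icc
  have hc0 : ContinuousOn (fun z : ℝ × ℝ => f z.1 z.2) D := hf.c0.mono hDG
  have hc1 : ContinuousOn (fun z : ℝ × ℝ => f1 z.1 z.2) D := hf.c1.mono hDG
  have hc2 : ContinuousOn (fun z : ℝ × ℝ => f2 z.1 z.2) D := hf.c2.mono hDG
  have hZc : Continuous (fun z : ℝ × ℝ => Zc a s ρ z.1 z.2) := by unfold Zc; fun_prop
  have hΦc : ContinuousOn Φ D := by
    refine ContinuousOn.mul ?_ (hZc.continuousOn.rpow_const fun _ _ => Or.inr hω.le)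
    simp only [P]
    fun_prop
  have haD : (a, s) ∈ D := ⟨⟨by simp only; linarith, by simp only; linarith⟩, by simp only; linarith, le_rfl⟩
  have hZa : Zc a s ρ a s = ρ ^ 2 := by unfold Zc; field_simp; ring
  rcases le_or_gt (Φ (a, s)) 0 with h | hpos
  · left
    simpa only [Φ, P, hZa] using h
  right
  obtain ⟨⟨x, t⟩, hz, hmax⟩ := hDc.exists_isMaxOn ⟨_, haD⟩ hΦc
  have hm0 : 0 < Φ (x, t) := lt_of_lt_of_le hpos (hmax haD)
  have hzG := hDG hz
  obtain ⟨⟨h1, h2⟩, h3, h4⟩ := hz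
  simp only at h1 h2 h3 h4
  have hξ2 : (x - a) ^ 2 ≤ ρ ^ 2 := by nlinarith
  have hZne : Zc a s ρ x t ≠ 0 := by
    intro h0
    simp only [Φ, h0, Real.zero_rpow hω.ne', mul_zero, lt_irrefl] at hm0
  have hZ0 : 0 ≤ Zc a s ρ x t := mul_nonneg (by linarith) (by positivity)
  have hZp : 0 < Zc a s ρ x t := lt_of_le_of_ne hZ0 (Ne.symm hZne)
  have hτ : 0 < t - (s - ρ ^ 2) := by
    rcases (show 0 ≤ t - (s - ρ ^ 2) by linarith).lt_or_eq with h | h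
    · exact h
    · exact absurd (by unfold Zc; rw [← h]; ring) hZne
  have hr : 0 < ρ ^ 2 - (x - a) ^ 2 := by
    rcases (show 0 ≤ ρ ^ 2 - (x - a) ^ 2 by linarith).lt_or_eq with h | h
    · exact h
    · exact absurd (by unfold Zc; rw [← h]; ring) hZne
  have hxa : |x - a| < ρ := abs_lt_of_sq_lt_sq (by linarith) hρ.le
  have hxa' := abs_lt.1 hxa
  set m := Φ (x, t) with hm
  -- barrier
  let Bf : ℝ → ℝ → ℝ := fun y τ =>
    m * exp (-ω * (log (τ - (s - ρ ^ 2)) + 2 * log (ρ ^ 2 - (y - a) ^ 2) - log (ρ ^ 4)) - k * f y τ)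
  have hBf : ∀ y τ, 0 < τ - (s - ρ ^ 2) → 0 < ρ ^ 2 - (y - a) ^ 2 →
      Bf y τ * exp (k * f y τ) * (Zc a s ρ y τ) ^ ω = m := by
    intro y τ h1 h2
    have : (Zc a s ρ y τ) ^ ω = exp (ω * (log (τ - (s - ρ ^ 2)) + 2 * log (ρ ^ 2 - (y - a) ^ 2) - log (ρ ^ 4))) := by
      have hz : 0 < Zc a s ρ y τ := by unfold Zc; positivity
      rw [Real.rpow_def_of_pos hz]
      congr 1
      unfold Zc
      rw [Real.log_mul h1.ne' (by positivity), Real.log_div (by positivity) (by positivity),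
        Real.log_pow]
      push_cast; ring
    simp only [Bf]
    rw [this, mul_assoc, mul_assoc, ← Real.exp_add, ← Real.exp_add]
    rw [show ∀ X : ℝ, -ω * X - k * f y τ + (k * f y τ + ω * X) = 0 by intro X; ring]
    simp
  have hcmp : ∀ y τ, (y, τ) ∈ D → 0 < τ - (s - ρ ^ 2) → 0 < ρ ^ 2 - (y - a) ^ 2 →
      0 ≤ P y τ + Bf y τ := by
    intro y τ hD h1 h2
    have hz : 0 < Zc a s ρ y τ := by unfold Zc; positivity
    have h3 : -P y τ * exp (k * f y τ) * (Zc a s ρ y τ) ^ ω ≤ m := hmax hD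
    rw [← hBf y τ h1 h2, mul_assoc, mul_assoc] at h3
    have := le_of_mul_le_mul_right h3 (by positivity)
    linarith
  have heq : P x t + Bf x t = 0 := by
    have h3 : -P x t * exp (k * f x t) * (Zc a s ρ x t) ^ ω = m := rfl
    have h4 := hBf x t hτ hr
    rw [← h4, mul_assoc, mul_assoc] at h3
    have := mul_right_cancel₀ (by positivity) h3
    linarith
  have hB0 : 0 < Bf x t := by simp only [Bf]; positivity
  refine ⟨x, t, Bf x t, hxa, by linarith, h4, hB0, by simp only [P] at heq; linarith, ?_, ?_⟩
  · rw [hBf x t hτ hr]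
    have : Φ (a, s) ≤ m := hmax haD
    simpa only [Φ, P, hZa] using this
  -- neighbourhoods
  have evG : ∀ᶠ y in 𝓝 x, (y, t) ∈ G := by
    have : Continuous fun y : ℝ => (y, t) := by fun_prop
    exact this.continuousAt.eventually (hG.mem_nhds hzG)
  have evr : ∀ᶠ y in 𝓝 x, 0 < ρ ^ 2 - (y - a) ^ 2 := by
    have : Continuous fun y : ℝ => ρ ^ 2 - (y - a) ^ 2 := by fun_prop
    exact this.continuousAt.eventually (lt_mem_nhds hr)
  have evI : ∀ᶠ y in 𝓝 x, y ∈ Icc (a - ρ) (a + ρ) := Icc_mem_nhds (by linarith) (by linarith)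
  -- first derivative function
  let b1 : ℝ → ℝ := fun y => 4 * ω * (y - a) / (ρ ^ 2 - (y - a) ^ 2) - k * f1 y t
  let W1 : ℝ → ℝ := fun y => -(f3 y t + α * (2 * f1 y t * f2 y t) + β * (exp (q * f y t) * (q * f1 y t))
    + Bf y t * b1 y)
  have dr : ∀ y : ℝ, HasDerivAt (fun y => ρ ^ 2 - (y - a) ^ 2) (-(2 * (y - a))) y := by
    intro y
    exact ((((hasDerivAt_id y).sub_const a).pow 2).const_sub (ρ ^ 2)).congr_deriv (by simp)
  have dg : ∀ y, (y, t) ∈ G → HasDerivAt (fun y => exp (q * f y t)) (exp (q * f y t) * (q * f1 y t)) y :=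
    fun y hy => ((hf.d0 _ hy).const_mul q).exp
  have dB : ∀ y, (y, t) ∈ G → 0 < ρ ^ 2 - (y - a) ^ 2 → HasDerivAt (fun y => Bf y t) (Bf y t * b1 y) y := by
    intro y hy h
    have e1 := ((dr y).log h.ne').const_mul 2
    have e2 := (((e1.const_add (log (t - (s - ρ ^ 2)))).sub_const (log (ρ ^ 4))).const_mul (-ω)).sub
      ((hf.d0 _ hy).const_mul k)
    refine (e2.exp.const_mul m).congr_deriv ?_
    simp only [Bf, b1, Pi.sub_apply]
    field_simp
    ring
  have dW : ∀ᶠ y in 𝓝 x, HasDerivAt (fun y => -(P y t + Bf y t)) (W1 y) y := by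
    filter_upwards [evG, evr] with y hy hr'
    have := (((hf.d2 _ hy).add (((hf.d1 _ hy).pow 2).const_mul α)).add ((dg y hy).const_mul β)).add (dB y hy hr')
    refine this.neg.congr_deriv ?_
    simp [W1]
  have dW1 : HasDerivAt W1 (-(f4 x t + α * (2 * f2 x t ^ 2 + 2 * f1 x t * f3 x t)
      + β * (exp (q * f x t) * (q * f1 x t) * (q * f1 x t) + exp (q * f x t) * (q * f2 x t))
      + (Bf x t * b1 x * b1 x + Bf x t * (ω * (4 / (ρ ^ 2 - (x - a) ^ 2) +
        8 * (x - a) ^ 2 / (ρ ^ 2 - (x - a) ^ 2) ^ 2) - k * f2 x t)))) x := by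
    have db1 : HasDerivAt b1 (ω * (4 / (ρ ^ 2 - (x - a) ^ 2) +
        8 * (x - a) ^ 2 / (ρ ^ 2 - (x - a) ^ 2) ^ 2) - k * f2 x t) x := by
      have e1 := (((hasDerivAt_id x).sub_const a).const_mul (4 * ω)).div (dr x) hr.ne'
      refine (e1.sub ((hf.d1 _ hzG).const_mul k)).congr_deriv ?_
      simp only [id]
      field_simp
      ring
    have e := (((hf.d3 _ hzG).add ((((hf.d1 _ hzG).const_mul 2).mul (hf.d2 _ hzG)).const_mul α)).add
      (((dg x hzG).mul ((hf.d1 _ hzG).const_mul q)).const_mul β)).add ((dB x hzG hr).mul db1)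
    refine e.neg.congr_deriv ?_
    ring
  have hloc : IsLocalMax (fun y => -(P y t + Bf y t)) x := by
    filter_upwards [evI, evr] with y hy hy'
    simp only [heq]
    have := hcmp y t ⟨hy, h3, h4⟩ hτ hy'
    linarith
  obtain ⟨hx1, hx2⟩ := snd_test dW dW1 hloc
  -- time derivative
  have dT : HasDerivAt (fun τ => -(P x τ + Bf x τ)) (-((f4 x t + 2 * f2 x t ^ 2 + 2 * f1 x t * f3 x t + K * f3 x t
      + q * exp (q * f x t) * f2 x t + q ^ 2 * exp (q * f x t) * f1 x t ^ 2)
      + α * (2 * f1 x t * (f3 x t + 2 * f1 x t * f2 x t + K * f2 x t + q * exp (q * f x t) * f1 x t))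
      + β * (exp (q * f x t) * (q * (f2 x t + f1 x t ^ 2 + K * f1 x t - lam + exp (q * f x t))))
      + Bf x t * (-ω / (t - (s - ρ ^ 2)) - k * (f2 x t + f1 x t ^ 2 + K * f1 x t - lam + exp (q * f x t))))) t := by
    have e0 := ((hasDerivAt_id t).sub_const (s - ρ ^ 2)).log hτ.ne'
    have e1 := (((e0.add_const (2 * log (ρ ^ 2 - (x - a) ^ 2))).sub_const (log (ρ ^ 4))).const_mul (-ω)).sub
      ((hf.t0 _ hzG).const_mul k)
    have e2 := e1.exp.const_mul m
    have e3 := (((hf.t2 _ hzG).add (((hf.t1 _ hzG).pow 2).const_mul α)).add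
      ((((hf.t0 _ hzG).const_mul q).exp).const_mul β)).add e2
    refine e3.neg.congr_deriv ?_
    simp only [Bf, id, Pi.sub_apply]
    push_cast
    field_simp
  have hT := left_test dT (by
    have e1 : ∀ᶠ τ in 𝓝[<] t, s - ρ ^ 2 < τ :=
      (eventually_gt_nhds (by linarith)).filter_mono nhdsWithin_le_nhds
    filter_upwards [e1, self_mem_nhdsWithin] with τ h5 h6
    have h6 : τ < t := h6
    simp only [heq]
    have := hcmp x τ ⟨⟨h1, h2⟩, h5.le, by simp only; linarith⟩ (by linarith) hr
    linarith)
  simp only [W1] at hx1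
  have hP : f2 x t + α * f1 x t ^ 2 + β * exp (q * f x t) = - Bf x t := by
    simp only [P] at heq; linarith
  set e := 4 * ω * (x - a) / (ρ ^ 2 - (x - a) ^ 2) with he
  have hb1 : b1 x = e - k * f1 x t := rfl
  rw [hb1] at hx1 hx2
  rw [show -ω / (t - (s - ρ ^ 2)) = -(ω / (t - (s - ρ ^ 2))) by ring] at hT
  generalize ω / (t - (s - ρ ^ 2)) = X1 at *
  generalize ω * (4 / (ρ ^ 2 - (x - a) ^ 2) + 8 * (x - a) ^ 2 / (ρ ^ 2 - (x - a) ^ 2) ^ 2) = X2 at *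
  generalize exp (q * f x t) = g at *
  have hP' : Bf x t = -(f2 x t + α * f1 x t ^ 2 + β * g) := by linarith
  have hmul : (2 * f1 x t + K) * (f3 x t + α * (2 * f1 x t * f2 x t) + β * (g * (q * f1 x t)) +
    Bf x t * (e - k * f1 x t)) = 0 := by
    rw [neg_eq_zero] at hx1; rw [hx1, mul_zero]
  generalize Bf x t = Bv at *
  clear_value e
  have key : q * g * Bv = -(q * g * (f2 x t + α * f1 x t ^ 2 + β * g)) := by rw [hP']; ring
  rw [show 2 * (1 - α) * f2 x t ^ 2 - q * g * Bv = 2 * (1 - α) * f2 x t ^ 2 + q * g * (f2 x t + α * f1 x t ^ 2 + β * g) by linarith]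
  clear hP hP' key heq
  linarith
end RS
end
open Real Set
noncomputable section
namespace RS
open Filter Topology

set_option maxHeartbeats 1000000 in
lemma quadU {q : ℝ} (hq : 0 < q) : ∃ k κ : ℝ, 0 < k ∧ k ≤ 1 / 2 ∧ 0 < κ ∧ ∀ B g Y : ℝ, 0 ≤ B → 0 ≤ g →
    κ * (g ^ 2 + B ^ 2) ≤ 2 * (1 + q / 4) * (B - q / 4 * Y + q / (2 * (1 + q)) * g) ^ 2
      - (q + k) * g * B + q * (q / 4) * g * Y + k * (1 - k) / 2 * B * Y := by
  set G0 : ℝ := 6 * q ^ 2 / ((2 + 2 * q) * (8 + 2 * q)) with hG0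
  have G0p : 0 < G0 := by positivity
  set k : ℝ := min (1 / 2) (min (q / 2) (2 * G0 / (9 * q))) with hk
  have kp : 0 < k := by positivity
  have k1 : k ≤ 1 / 2 := min_le_left _ _
  have k2 : k ≤ q / 2 := (min_le_right _ _).trans (min_le_left _ _)
  have k3 : k ≤ 2 * G0 / (9 * q) := (min_le_right _ _).trans (min_le_right _ _)
  clear_value k
  refine ⟨k, min (G0 / 2) (k / (4 * q)), kp, k1, by positivity, fun B g Y hB hg => ?_⟩
  set β : ℝ := q / (2 * (1 + q)) with hβ
  have βp : 0 < β := by positivity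
  set D := B - q / 4 * Y + β * g with hD
  set k' : ℝ := 2 * k * (1 - k) / q with hk'
  have k'1 : k / q ≤ k' := by
    rw [hk', div_le_div_iff_of_pos_right hq]; nlinarith
  have k'2 : k' ≤ 2 * k / q := by
    rw [hk', div_le_div_iff_of_pos_right hq]; nlinarith
  have k'3 : k' ≤ 1 := by
    refine k'2.trans ?_
    rw [div_le_one hq]; linarith
  have k'p : 0 < k' := lt_of_lt_of_le (by positivity) k'1
  have hqk' : q * k' ≤ 2 * k := by
    rw [hk']; field_simp; nlinarith
  have eY : q / 4 * Y = B + β * g - D := by rw [hD]; ring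
  have e1 : q * (q / 4) * g * Y = q * g * (B + β * g - D) := by rw [← eY]; ring
  have e2 : k * (1 - k) / 2 * B * Y = k' * B * (B + β * g - D) := by
    rw [← eY, hk']; field_simp; ring
  rw [e1, e2]
  have d8 : 0 < 8 + 2 * q := by linarith
  -- complete the square
  have hsq : 2 * (1 + q / 4) * D ^ 2 - D * (q * g + k' * B) ≥ -(q * g + k' * B) ^ 2 / (8 + 2 * q) := by
    have : 2 * (1 + q / 4) * D ^ 2 - D * (q * g + k' * B) + (q * g + k' * B) ^ 2 / (8 + 2 * q)
      = (2 * (1 + q / 4)) * (D - 2 * (q * g + k' * B) / (8 + 2 * q)) ^ 2 := by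
      field_simp; ring
    have h2 : 0 ≤ (2 * (1 + q / 4)) * (D - 2 * (q * g + k' * B) / (8 + 2 * q)) ^ 2 := by positivity
    rw [ge_iff_le, neg_div]; linarith
  have hG : q * β - q ^ 2 / (8 + 2 * q) = G0 := by
    rw [hβ, hG0]; field_simp; ring
  have t1 : (q * g + k' * B) ^ 2 / (8 + 2 * q) ≤ q ^ 2 / (8 + 2 * q) * g ^ 2 + k / 2 * (g * B) + k' / 8 * B ^ 2 := by
    have e : (q * g + k' * B) ^ 2 / (8 + 2 * q) = q ^ 2 / (8 + 2 * q) * g ^ 2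
      + 2 * (q * k') / (8 + 2 * q) * (g * B) + k' ^ 2 / (8 + 2 * q) * B ^ 2 := by
      field_simp; ring
    rw [e]
    have a1 : 2 * (q * k') / (8 + 2 * q) ≤ k / 2 := by
      rw [div_le_iff₀ d8]; nlinarith
    have a2 : k' ^ 2 / (8 + 2 * q) ≤ k' / 8 := by
      rw [div_le_iff₀ d8]; nlinarith
    have := mul_le_mul_of_nonneg_right a1 (mul_nonneg hg hB)
    have := mul_le_mul_of_nonneg_right a2 (sq_nonneg B)
    linarith
  have t2 : 3 / 2 * k * (g * B) ≤ G0 / 2 * g ^ 2 + k / (4 * q) * B ^ 2 := by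
    have hk9 : 9 * k ^ 2 / (8 * G0) ≤ k / (4 * q) := by
      rw [div_le_div_iff₀ (by positivity) (by positivity)]
      rw [le_div_iff₀ (by positivity)] at k3
      have := mul_le_mul_of_nonneg_left k3 kp.le
      linarith
    have : 3 / 2 * k * (g * B) ≤ G0 / 2 * g ^ 2 + 9 * k ^ 2 / (8 * G0) * B ^ 2 := by
      have : G0 / 2 * g ^ 2 + 9 * k ^ 2 / (8 * G0) * B ^ 2 - 3 / 2 * k * (g * B)
        = 1 / (2 * G0) * (G0 * g - 3 / 2 * k * B) ^ 2 := by field_simp; ring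
      have : 0 ≤ 1 / (2 * G0) * (G0 * g - 3 / 2 * k * B) ^ 2 := by positivity
      linarith
    have := mul_le_mul_of_nonneg_right hk9 (sq_nonneg B)
    linarith
  have t3 : min (G0 / 2) (k / (4 * q)) * (g ^ 2 + B ^ 2) ≤ G0 / 2 * g ^ 2 + k / (4 * q) * B ^ 2 := by
    have := mul_le_mul_of_nonneg_right (min_le_left (G0 / 2) (k / (4 * q))) (sq_nonneg g)
    have := mul_le_mul_of_nonneg_right (min_le_right (G0 / 2) (k / (4 * q))) (sq_nonneg B)
    linarith
  have t4 : (7 / 8 * k') * B ^ 2 ≥ 2 * (k / (4 * q)) * B ^ 2 := by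
    apply mul_le_mul_of_nonneg_right _ (sq_nonneg B)
    have : 2 * (k / (4 * q)) = 1 / 2 * (k / q) := by field_simp; ring
    rw [this]
    nlinarith [show 0 < k / q by positivity]
  have t5 : 0 ≤ k' * β * (g * B) := by positivity
  have hG' : q * β * g ^ 2 = G0 * g ^ 2 + q ^ 2 / (8 + 2 * q) * g ^ 2 := by rw [← hG]; ring
  rw [neg_div] at hsq
  generalize (q * g + k' * B) ^ 2 / (8 + 2 * q) = S at *
  linarith

/-- elementary bounds for the cut-off -/
lemma cutoff {a s ρ x t ω K : ℝ} (hρ : 0 < ρ) (hρ1 : ρ ≤ 1) (hω : 0 < ω)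
    (hx : |x - a| < ρ) (ht : s - ρ ^ 2 < t) (hts : t ≤ s) :
    ∃ J : ℝ, 1 ≤ J ∧ 1 / ρ ^ 2 ≤ J ∧ 0 < Zc a s ρ x t ∧ J * Zc a s ρ x t ≤ 2 ∧
      (4 * ω * (x - a) / (ρ ^ 2 - (x - a) ^ 2)) ^ 2 ≤ 16 * ω ^ 2 * J ∧
      ω / (t - (s - ρ ^ 2)) ≤ ω * J ∧
      ω * (4 / (ρ ^ 2 - (x - a) ^ 2) + 8 * (x - a) ^ 2 / (ρ ^ 2 - (x - a) ^ 2) ^ 2) ≤ 12 * ω * J ∧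
      K * (4 * ω * (x - a) / (ρ ^ 2 - (x - a) ^ 2)) ≤ (K ^ 2 + 16 * ω ^ 2) * J := by
  have hξ : (x - a) ^ 2 < ρ ^ 2 := by
    have := sq_lt_sq.2 (by rwa [abs_of_pos hρ] : |x - a| < |ρ|)
    exact this
  have hρ2 : 0 < ρ ^ 2 := by positivity
  have hρ21 : ρ ^ 2 ≤ 1 := by nlinarith
  unfold Zc
  set ξ := x - a
  set τ := t - (s - ρ ^ 2) with hτ
  have τp : 0 < τ := by linarith
  have τle : τ ≤ ρ ^ 2 := by linarith
  set r := ρ ^ 2 - ξ ^ 2 with hr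
  have rp : 0 < r := by linarith
  have rle : r ≤ ρ ^ 2 := by nlinarith [sq_nonneg ξ]
  have j1 : 1 / ρ ^ 2 ≤ 1 / τ := by gcongr
  have j0 : 1 ≤ 1 / ρ ^ 2 := by rw [le_div_iff₀ hρ2]; linarith
  have j2 : 0 ≤ ρ ^ 2 / r ^ 2 := by positivity
  have hξ0 := sq_nonneg ξ
  have he : (4 * ω * ξ / r) ^ 2 ≤ 16 * ω ^ 2 * (1 / τ + ρ ^ 2 / r ^ 2) := by
    have h1 : (4 * ω * ξ / r) ^ 2 = 16 * ω ^ 2 * (ξ ^ 2 / r ^ 2) := by field_simp; ring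
    rw [h1]
    have h2 : ξ ^ 2 / r ^ 2 ≤ ρ ^ 2 / r ^ 2 := by gcongr
    have : 0 ≤ 1 / τ := by positivity
    gcongr
    linarith
  refine ⟨1 / τ + ρ ^ 2 / r ^ 2, by linarith, by linarith, by positivity, ?_, he, ?_, ?_, ?_⟩
  · have : (1 / τ + ρ ^ 2 / r ^ 2) * (τ * (r ^ 2 / ρ ^ 4)) = (r / ρ ^ 2) ^ 2 + τ / ρ ^ 2 := by
      field_simp
    rw [this]
    have a1 : r / ρ ^ 2 ≤ 1 := by rw [div_le_one hρ2]; exact rle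
    have a2 : τ / ρ ^ 2 ≤ 1 := by rw [div_le_one hρ2]; exact τle
    have a3 : 0 ≤ r / ρ ^ 2 := by positivity
    nlinarith
  · rw [mul_add, mul_one_div]; have : 0 ≤ ω * (ρ ^ 2 / r ^ 2) := by positivity
    linarith
  · have h1 : 4 / r ≤ 4 * (ρ ^ 2 / r ^ 2) := by
      rw [show 4 * (ρ ^ 2 / r ^ 2) = 4 * ρ ^ 2 / r ^ 2 by ring, div_le_div_iff₀ rp (by positivity)]
      nlinarith
    have h2 : 8 * ξ ^ 2 / r ^ 2 ≤ 8 * (ρ ^ 2 / r ^ 2) := by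
      rw [show 8 * (ρ ^ 2 / r ^ 2) = 8 * ρ ^ 2 / r ^ 2 by ring]; gcongr
    have : 0 ≤ 1 / τ := by positivity
    nlinarith
  · set e := 4 * ω * ξ / r
    have : K * e ≤ K ^ 2 + e ^ 2 := by nlinarith [sq_nonneg (K - e), sq_nonneg (K + e)]
    have h3 : K ^ 2 ≤ K ^ 2 * (1 / τ + ρ ^ 2 / r ^ 2) := le_mul_of_one_le_right (sq_nonneg K) (by linarith)
    linarith

set_option maxHeartbeats 2000000 in
lemma stageU {q : ℝ} (hq : 0 < q) (K lam : ℝ) : ∃ k m0 : ℝ, 0 < k ∧ 0 < m0 ∧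
    ∀ {G : Set (ℝ × ℝ)} (_ : IsOpen G) {f f1 f2 f3 f4 : ℝ → ℝ → ℝ}
    (_ : FS K lam q G f f1 f2 f3 f4) {a s ρ : ℝ} (_ : 0 < ρ) (_ : ρ ≤ 1)
    (_ : ∀ x t, |x - a| ≤ ρ → s - ρ ^ 2 ≤ t → t ≤ s → (x, t) ∈ G),
    -(f2 a s + (-(q / 4)) * f1 a s ^ 2 + q / (2 * (1 + q)) * exp (q * f a s)) * exp (k * f a s)
      * (ρ ^ 2) ^ (1 + k / q) ≤ m0 := by
  obtain ⟨k, κ, kp, k1, κp, quad⟩ := quadU hq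
  set ω := 1 + k / q with hω
  have ωp : 0 < ω := by positivity
  set β : ℝ := q / (2 * (1 + q)) with hβ
  have βp : 0 < β := by positivity
  set C2 : ℝ := 2 / k * (16 * ω ^ 2) + |lam| + (K ^ 2 + 16 * ω ^ 2) + 16 * ω ^ 2 + ω + 12 * ω with hC2
  have C2p : 0 < C2 := by positivity
  set C3 : ℝ := β * |lam| * q + C2 with hC3
  have C3p : 0 < C3 := by positivity
  set C : ℝ := 2 * C3 / κ with hC
  have Cp : 0 < C := by positivity
  refine ⟨k, (2 * C) ^ ω, kp, by positivity, ?_⟩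
  intro G hG f f1 f2 f3 f4 hf a s ρ hρ hρ1 hcyl
  rcases LY_max hG hf (α := -(q / 4)) (β := β) (k := k) (ω := ω) hρ ωp hcyl with h | h
  · exact h.trans (by positivity)
  obtain ⟨x, t, B, hx, ht, hts, Bp, hP, hle, ineq⟩ := h
  refine hle.trans ?_
  obtain ⟨J, J1, J2, Zp, JZ, be, b1, b2, b3⟩ := cutoff (K := K) hρ hρ1 ωp hx ht hts
  have hgexp : exp (k * f x t) = exp (q * f x t) ^ (k / q) := by
    rw [← Real.exp_mul]; congr 1; field_simp
  rw [hgexp]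
  have gp := Real.exp_pos (q * f x t)
  generalize exp (q * f x t) = g at *
  generalize 4 * ω * (x - a) / (ρ ^ 2 - (x - a) ^ 2) = e at *
  generalize ω / (t - (s - ρ ^ 2)) = X1 at *
  generalize ω * (4 / (ρ ^ 2 - (x - a) ^ 2) + 8 * (x - a) ^ 2 / (ρ ^ 2 - (x - a) ^ 2) ^ 2) = X2 at *
  generalize Zc a s ρ x t = Z at *
  have hY : 0 ≤ f1 x t ^ 2 := sq_nonneg _
  have lamJ : -(|lam| * J) ≤ k * lam := by
    have h1 : -|lam| ≤ lam := neg_abs_le lam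
    have h2 : |lam| * k ≤ |lam| * J := by gcongr; linarith only [k1, J1]
    have := mul_le_mul_of_nonneg_left h1 kp.le
    linarith only [this, h2]
  have cross : 2 * (1 - k) * e * f1 x t ≤ k * (1 - k) / 2 * f1 x t ^ 2 + 2 / k * (16 * ω ^ 2) * J := by
    have h1 : 2 * e * f1 x t ≤ k / 2 * f1 x t ^ 2 + 2 / k * e ^ 2 := by
      have : k / 2 * f1 x t ^ 2 + 2 / k * e ^ 2 - 2 * e * f1 x t = 1 / (2 * k) * (k * f1 x t - 2 * e) ^ 2 := by
        field_simp; ring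
      have : 0 ≤ 1 / (2 * k) * (k * f1 x t - 2 * e) ^ 2 := by positivity
      linarith
    have h2 : (1 - k) * (2 * e * f1 x t) ≤ (1 - k) * (k / 2 * f1 x t ^ 2 + 2 / k * e ^ 2) := by
      apply mul_le_mul_of_nonneg_left h1; linarith
    have h3 : 2 / k * e ^ 2 ≤ 2 / k * (16 * ω ^ 2 * J) := by gcongr
    have h4 : (1 - k) * (2 / k * e ^ 2) ≤ 2 / k * e ^ 2 := by
      have h0 : 0 ≤ 2 / k * e ^ 2 := by positivity
      have h00 := mul_nonneg kp.le h0
      generalize 2 / k * e ^ 2 = S at *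
      linarith
    have h5 : (1 - k) * (k / 2 * f1 x t ^ 2 + 2 / k * e ^ 2) = k * (1 - k) / 2 * f1 x t ^ 2 + (1 - k) * (2 / k * e ^ 2) := by ring
    have h6 : (1 - k) * (2 * e * f1 x t) = 2 * (1 - k) * e * f1 x t := by ring
    have h7 : 2 / k * (16 * ω ^ 2 * J) = 2 / k * (16 * ω ^ 2) * J := by ring
    rw [h5, h6] at h2
    rw [h7] at h3
    linarith only [h2, h3, h4]
  have hbr : k * (1 - k) / 2 * f1 x t ^ 2 - k * g - C2 * J ≤ k * (1 - k) * f1 x t ^ 2 - k * g + k * lam - K * e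
      - 2 * (1 - k) * e * f1 x t - e ^ 2 - X1 - X2 := by
    rw [hC2]; linarith
  have hbr' := mul_le_mul_of_nonneg_left hbr Bp.le
  have hf2 : f2 x t = -(B - q / 4 * f1 x t ^ 2 + β * g) := by linarith
  have Q := quad B g (f1 x t ^ 2) Bp.le gp.le
  have hco : q + -(q / 4) - β * (1 + q) = q / 4 := by
    rw [hβ]; field_simp; ring
  rw [hco, hf2] at ineq
  have hlamg : β * lam * q * g ≤ β * |lam| * q * g := by
    have := le_abs_self lam
    gcongr
  have main : κ * (g ^ 2 + B ^ 2) ≤ β * |lam| * q * g + C2 * J * B := by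
    linarith
  have main2 : κ * (g ^ 2 + B ^ 2) ≤ C3 * J * (g + B) := by
    have h1 : β * |lam| * q * g ≤ β * |lam| * q * J * (g + B) := by
      have h2 : 0 ≤ β * |lam| * q := by positivity
      have h3 : g ≤ J * (g + B) := by
        have := mul_le_mul_of_nonneg_right J1 (show 0 ≤ g + B by linarith only [gp, Bp])
        linarith only [this, Bp]
      calc β * |lam| * q * g ≤ β * |lam| * q * (J * (g + B)) := by gcongr
        _ = _ := by ring
    have h4 : C2 * J * B ≤ C2 * J * (g + B) := by gcongr; linarith
    rw [hC3]; linarith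
  have gB : g + B ≤ C * J := by
    have h1 : κ * (g + B) ^ 2 ≤ 2 * C3 * J * (g + B) := by
      have := mul_nonneg κp.le (sq_nonneg (g - B))
      linarith only [this, main2]
    have h2 : κ * (g + B) ≤ 2 * C3 * J := by
      by_contra hcon
      push Not at hcon
      have := mul_lt_mul_of_pos_right hcon (show 0 < g + B by linarith only [gp, Bp])
      linarith only [this, h1]
    rw [hC, div_mul_eq_mul_div, le_div_iff₀ κp]; linarith
  have CJp : 0 < C * J := by positivity
  have hB : B ≤ C * J := by linarith
  have hg : g ≤ C * J := by linarith
  have hkq : 0 < k / q := by positivity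
  calc B * g ^ (k / q) * Z ^ ω ≤ (C * J) * (C * J) ^ (k / q) * Z ^ ω := by gcongr
    _ = (C * J) ^ ω * Z ^ ω := by rw [hω, Real.rpow_add CJp, Real.rpow_one]
    _ = (C * (J * Z)) ^ ω := by rw [← Real.mul_rpow CJp.le Zp.le, mul_assoc]
    _ ≤ (2 * C) ^ ω := by
      apply Real.rpow_le_rpow (by positivity) _ ωp.le
      have := mul_le_mul_of_nonneg_left JZ Cp.le
      linarith only [this]

lemma stageH (q : ℝ) (hq : 0 < q) (K lam Γ : ℝ) (hΓ : 0 < Γ) : ∃ m0 : ℝ, 0 < m0 ∧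
    ∀ {G : Set (ℝ × ℝ)} (_ : IsOpen G) {f f1 f2 f3 f4 : ℝ → ℝ → ℝ}
    (_ : FS K lam q G f f1 f2 f3 f4) {a s ρ : ℝ} (_ : 0 < ρ) (_ : ρ ≤ 1)
    (_ : ∀ x t, |x - a| ≤ ρ → s - ρ ^ 2 ≤ t → t ≤ s → (x, t) ∈ G)
    (_ : ∀ x t, |x - a| ≤ ρ → s - ρ ^ 2 ≤ t → t ≤ s → exp (q * f x t) ≤ Γ / ρ ^ 2),
    -(m0 / ρ ^ 2) ≤ f2 a s + (1 / 2) * f1 a s ^ 2 := by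
  set C : ℝ := q * Γ + (16 + (K ^ 2 + 16) + 16 + 1 + 12) with hC
  have Cp : 0 < C := by positivity
  refine ⟨2 * C, by positivity, ?_⟩
  intro G hG f f1 f2 f3 f4 hf a s ρ hρ hρ1 hcyl hg
  have hρ2 : 0 < ρ ^ 2 := by positivity
  suffices h : -(f2 a s + (1 / 2) * f1 a s ^ 2) * ρ ^ 2 ≤ 2 * C by
    rw [neg_le, div_eq_mul_one_div]
    rw [mul_one_div, le_div_iff₀ hρ2]; exact h
  rcases LY_max hG hf (α := 1 / 2) (β := 0) (k := 0) (ω := 1) hρ one_pos hcyl with h | h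
  · simp only [zero_mul, exp_zero, add_zero, Real.rpow_one, mul_one] at h
    exact h.trans (by positivity)
  obtain ⟨x, t, B, hx, ht, hts, Bp, hP, hle, ineq⟩ := h
  simp only [zero_mul, exp_zero, add_zero, Real.rpow_one, mul_one] at hle
  refine hle.trans ?_
  have hgx := hg x t hx.le ht.le hts
  obtain ⟨J, J1, J2, Zp, JZ, be, b1, b2, b3⟩ := cutoff (K := K) hρ hρ1 one_pos hx ht hts
  have gp := Real.exp_pos (q * f x t)
  generalize exp (q * f x t) = g at *
  have hgJ : g ≤ Γ * J := by
    refine hgx.trans ?_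
    rw [div_eq_mul_one_div]; gcongr
  generalize 4 * 1 * (x - a) / (ρ ^ 2 - (x - a) ^ 2) = e at *
  generalize 1 / (t - (s - ρ ^ 2)) = X1 at *
  generalize 1 * (4 / (ρ ^ 2 - (x - a) ^ 2) + 8 * (x - a) ^ 2 / (ρ ^ 2 - (x - a) ^ 2) ^ 2) = X2 at *
  generalize Zc a s ρ x t = Z at *
  have hY : 0 ≤ f1 x t ^ 2 := sq_nonneg _
  have hf2 : f2 x t = -(B + 1 / 2 * f1 x t ^ 2) := by linarith
  have cross : 2 * e * f1 x t ≤ f1 x t ^ 2 + e ^ 2 := by nlinarith [sq_nonneg (f1 x t - e)]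
  have hbr : - f1 x t ^ 2 - (16 + (K ^ 2 + 16) + 16 + 1 + 12) * J ≤ - K * e - 2 * e * f1 x t - e ^ 2 - X1 - X2 := by
    linarith
  have hbr' := mul_le_mul_of_nonneg_left hbr Bp.le
  have hpos : 0 ≤ q * g * f1 x t ^ 2 * (q + 1 / 2) := by positivity
  have hf22 : f2 x t ^ 2 ≥ B ^ 2 + B * f1 x t ^ 2 := by rw [hf2]; nlinarith
  have h1 : B ^ 2 ≤ q * g * B + B * ((16 + (K ^ 2 + 16) + 16 + 1 + 12) * J) := by
    linarith
  have h2 : q * g * B ≤ q * (Γ * J) * B := by gcongr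
  have hB : B ≤ C * J := by
    have : B * B ≤ B * (C * J) := by rw [hC]; linarith
    exact le_of_mul_le_mul_left this Bp
  calc B * Z ≤ C * J * Z := by gcongr
    _ = C * (J * Z) := by ring
    _ ≤ 2 * C := by nlinarith
end RS
end
open Real Set
noncomputable section
namespace RS
open Filter Topology

set_option maxHeartbeats 1000000 in
lemma univ_bound {q : ℝ} (hq : 0 < q) (K lam : ℝ) : ∃ Λ : ℝ, 0 < Λ ∧
    ∀ {G : Set (ℝ × ℝ)} (_ : IsOpen G) {f f1 f2 f3 f4 : ℝ → ℝ → ℝ}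
    (_ : FS K lam q G f f1 f2 f3 f4) {a s ρ : ℝ} (_ : 0 < ρ) (_ : ρ ≤ 1)
    (_ : ∀ x t, |x - a| ≤ ρ → s - ρ ^ 2 ≤ t → t ≤ s + ρ ^ 2 → (x, t) ∈ G),
    exp (q * f a s) ≤ Λ / ρ ^ 2 := by
  obtain ⟨k, m0, kp, m0p, hU⟩ := stageU hq K lam
  set C : ℝ := K ^ 2 / 4 + |lam| with hC
  have C0 : 0 ≤ C := by positivity
  set Λ : ℝ := max 1 (max (4 * (C + m0)) (8 / q + 1)) with hΛ
  have Λ1 : 1 ≤ Λ := le_max_left _ _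
  have Λ2 : 4 * (C + m0) ≤ Λ := (le_max_left _ _).trans (le_max_right _ _)
  have Λ3 : 8 / q + 1 ≤ Λ := (le_max_right _ _).trans (le_max_right _ _)
  clear_value Λ
  have Λp : 0 < Λ := by linarith
  refine ⟨Λ, Λp, ?_⟩
  intro G hG f f1 f2 f3 f4 hf a s ρ hρ hρ1 hcyl
  have hρ2 : 0 < ρ ^ 2 := by positivity
  have hρ21 : ρ ^ 2 ≤ 1 := by nlinarith
  by_contra hcon
  push Not at hcon
  set y : ℝ → ℝ := fun t => exp (-(q * f a t)) with hy
  set ft : ℝ → ℝ := fun t => f2 a t + f1 a t ^ 2 + K * f1 a t - lam + exp (q * f a t) with hft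
  have hmem : ∀ t ∈ Icc s (s + ρ ^ 2), (a, t) ∈ G := fun t ht =>
    hcyl a t (by simp [hρ.le]) (by linarith [ht.1]) ht.2
  have hder : ∀ t ∈ Icc s (s + ρ ^ 2), HasDerivAt y (y t * (-(q * ft t))) t := by
    intro t ht
    have h := hf.t0 (a, t) (hmem t ht)
    exact ((h.const_mul q).neg.exp)
  have hys : y s ≤ ρ ^ 2 / Λ := by
    have h1 : Λ / ρ ^ 2 * y s ≤ 1 := by
      have : exp (q * f a s) * y s = 1 := by rw [hy]; simp only; rw [← Real.exp_add]; simp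
      rw [← this]
      exact mul_le_mul_of_nonneg_right hcon.le (Real.exp_pos _).le
    rw [le_div_iff₀ Λp]
    have : Λ / ρ ^ 2 * y s * ρ ^ 2 = y s * Λ := by field_simp
    nlinarith
  have key : ∀ t ∈ Icc s (s + ρ ^ 2), y t ≤ ρ ^ 2 / Λ → y t * (-(q * ft t)) ≤ -(q / 4) := by
    intro t ht hyt
    have hU' := hU hG hf (a := a) (s := t) hρ hρ1 (fun x τ h1 h2 h3 => hcyl x τ h1 (by linarith [ht.1]) (by linarith [ht.2]))
    have yp : 0 < y t := Real.exp_pos _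
    set ω := 1 + k / q with hω
    have ωp : 1 ≤ ω := by have : 0 < k / q := by positivity
                          linarith
    have hgy : exp (q * f a t) * y t = 1 := by rw [hy]; simp only; rw [← Real.exp_add]; simp
    have eky : exp (k * f a t) = (y t) ^ (-(k / q)) := by
      rw [hy]; simp only; rw [← Real.exp_mul]; congr 1; field_simp
    -- m0 bound: -(P) y <= m0 (y/ρ²)^ω
    have h1 : -(f2 a t + (-(q / 4)) * f1 a t ^ 2 + q / (2 * (1 + q)) * exp (q * f a t)) * y t ≤ m0 * (1 / Λ) := by
      have h2 : (y t / ρ ^ 2) ^ ω ≤ 1 / Λ := by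
        have h3 : y t / ρ ^ 2 ≤ 1 / Λ := by
          rw [div_le_iff₀ hρ2]
          calc y t ≤ ρ ^ 2 / Λ := hyt
            _ = _ := by ring
        calc (y t / ρ ^ 2) ^ ω ≤ (1 / Λ) ^ ω := Real.rpow_le_rpow (by positivity) h3 (by linarith)
          _ ≤ (1 / Λ) ^ (1:ℝ) := Real.rpow_le_rpow_of_exponent_ge (by positivity) (by rw [div_le_one Λp]; exact Λ1) ωp
          _ = _ := Real.rpow_one _
      have h4 : exp (k * f a t) * (ρ ^ 2) ^ ω * (y t / ρ ^ 2) ^ ω = y t := by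
        rw [eky, Real.div_rpow yp.le hρ2.le, mul_assoc, mul_div_cancel₀ _ (by positivity), ← Real.rpow_add yp, hω]
        simp
      have hP : ∀ P : ℝ, P * exp (k * f a t) * (ρ ^ 2) ^ ω ≤ m0 → P * y t ≤ m0 * (1 / Λ) := by
        intro P hP
        calc P * y t = P * exp (k * f a t) * (ρ ^ 2) ^ ω * (y t / ρ ^ 2) ^ ω := by
              rw [mul_assoc, mul_assoc, ← mul_assoc (exp _), h4]
          _ ≤ m0 * (y t / ρ ^ 2) ^ ω := by gcongr
          _ ≤ m0 * (1 / Λ) := by gcongr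
      exact hP _ hU'
    have hβ : q / (2 * (1 + q)) ≤ 1 / 2 := by
      rw [div_le_div_iff₀ (by positivity) (by norm_num)]; linarith
    have gp := Real.exp_pos (q * f a t)
    simp only [hft]
    generalize exp (q * f a t) = g at *
    have hβg : q / (2 * (1 + q)) * g ≤ 1 / 2 * g := by gcongr
    have hlam : lam ≤ |lam| := le_abs_self _
    have hft' : 1 / 2 * g - C + (f2 a t + (-(q / 4)) * f1 a t ^ 2 + q / (2 * (1 + q)) * g) ≤
        f2 a t + f1 a t ^ 2 + K * f1 a t - lam + g := by
      have e1 := sq_nonneg (f1 a t + K / 2)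
      have e2 := mul_nonneg hq.le (sq_nonneg (f1 a t))
      rw [hC]
      linarith
    have h5 := mul_le_mul_of_nonneg_left hft' yp.le
    have h6 : y t ≤ 1 / Λ := hyt.trans (by gcongr)
    have h7 := mul_le_mul_of_nonneg_left h6 C0
    have h8 : (C + m0) * (1 / Λ) ≤ 1 / 4 := by
      rw [mul_one_div, div_le_div_iff₀ Λp (by norm_num)]; linarith
    generalize f2 a t + (-(q / 4)) * f1 a t ^ 2 + q / (2 * (1 + q)) * g = P at *
    generalize f2 a t + f1 a t ^ 2 + K * f1 a t - lam + g = Q at *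
    have h9 : 1 / 4 ≤ y t * Q := by linarith
    have := mul_le_mul_of_nonneg_left h9 hq.le
    linarith
  have hb : ∀ x, HasDerivAt (fun t => ρ ^ 2 / Λ - q / 8 * (t - s)) (-(q / 8)) x := by
    intro x
    refine ((((hasDerivAt_id x).sub_const s).const_mul (q / 8)).const_sub (ρ ^ 2 / Λ)).congr_deriv ?_
    simp
  have hfin := image_le_of_deriv_right_lt_deriv_boundary (a := s) (b := s + ρ ^ 2) (f := y)
    (f' := fun t => y t * (-(q * ft t)))
    (fun t ht => (hder t ht).continuousAt.continuousWithinAt)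
    (fun t ht => (hder t ⟨ht.1, ht.2.le⟩).hasDerivWithinAt)
    (B := fun t => ρ ^ 2 / Λ - q / 8 * (t - s)) (B' := fun _ => -(q / 8)) (by simpa using hys) hb
    (by
      intro t ht he
      have := key t ⟨ht.1, ht.2.le⟩ (by
        rw [he]; have : 0 ≤ q / 8 * (t - s) := mul_nonneg (by positivity) (by linarith [ht.1])
        linarith)
      linarith)
    (x := s + ρ ^ 2) ⟨by linarith, le_rfl⟩
  have yp : 0 < y (s + ρ ^ 2) := Real.exp_pos _
  have : 1 / Λ ≤ q / 8 := by
    rw [div_le_div_iff₀ Λp (by norm_num)]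
    have : 8 / q ≤ Λ := by linarith
    rw [div_le_iff₀ hq] at this; linarith
  have h2 : ρ ^ 2 / Λ = ρ ^ 2 * (1 / Λ) := by ring
  have := mul_le_mul_of_nonneg_left this hρ2.le
  linarith

lemma lower_ft {q : ℝ} (hq : 0 < q) (K lam : ℝ) : ∃ C : ℝ, 0 < C ∧
    ∀ {G : Set (ℝ × ℝ)} (_ : IsOpen G) {f f1 f2 f3 f4 : ℝ → ℝ → ℝ}
    (_ : FS K lam q G f f1 f2 f3 f4) {a s ρ : ℝ} (_ : 0 < ρ) (_ : ρ ≤ 1)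
    (_ : ∀ x t, |x - a| ≤ ρ → s - ρ ^ 2 ≤ t → t ≤ s + ρ ^ 2 → (x, t) ∈ G),
    1 / 4 * f1 a s ^ 2 - C / ρ ^ 2 ≤ f2 a s + f1 a s ^ 2 + K * f1 a s - lam + exp (q * f a s) := by
  obtain ⟨Λ, Λp, hΛ⟩ := univ_bound hq K lam
  obtain ⟨m0, m0p, hH⟩ := stageH q hq K lam Λ Λp
  refine ⟨K ^ 2 + |lam| + 4 * m0, by positivity, ?_⟩
  intro G hG f f1 f2 f3 f4 hf a s ρ hρ hρ1 hcyl
  have hρ2 : 0 < ρ ^ 2 := by positivity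
  have hρ21 : ρ ^ 2 ≤ 1 := by nlinarith
  have h := hH hG hf (a := a) (s := s) (ρ := ρ / 2) (by positivity) (by linarith)
    (fun x t h1 h2 h3 => hcyl x t (by linarith) (by nlinarith) (by linarith))
    (fun x t h1 h2 h3 => hΛ hG hf (by positivity) (by linarith) (fun x' t' h1' h2' h3' => by
      refine hcyl x' t' ?_ (by nlinarith) (by nlinarith)
      rw [abs_le] at *
      constructor <;> linarith [h1.1, h1.2, h1'.1, h1'.2]))
  have e1 : m0 / (ρ / 2) ^ 2 = 4 * m0 / ρ ^ 2 := by field_simp; norm_num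
  have e2 : (K ^ 2 + |lam| + 4 * m0) / ρ ^ 2 = (K ^ 2 + |lam|) / ρ ^ 2 + 4 * m0 / ρ ^ 2 := by ring
  have e3 : K ^ 2 + |lam| ≤ (K ^ 2 + |lam|) / ρ ^ 2 := by
    rw [le_div_iff₀ hρ2]
    have : 0 ≤ K ^ 2 + |lam| := by positivity
    nlinarith
  have := le_abs_self lam
  have gp := Real.exp_pos (q * f a s)
  rw [e1] at h
  rw [e2]
  nlinarith [sq_nonneg (f1 a s / 2 + K)]

/-- chain rule along a line -/
lemma diag {v v1 : ℝ → ℝ → ℝ} {c x t vt : ℝ}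
    (hx : ∀ᶠ z : ℝ × ℝ in 𝓝 (x, t), HasDerivAt (fun y => v y z.2) (v1 z.1 z.2) z.1)
    (hc : ContinuousAt (fun z : ℝ × ℝ => v1 z.1 z.2) (x, t))
    (ht : HasDerivAt (fun s => v x s) vt t) :
    HasDerivAt (fun s => v (x + c * (s - t)) s) (vt + c * v1 x t) t := by
  have h2 : HasDerivAt (fun s => v (x + c * (s - t)) s - v x s) (c * v1 x t) t := by
    rw [hasDerivAt_iff_isLittleO, Asymptotics.isLittleO_iff]
    intro ε hε
    set ε' := ε / (1 + |c|) with hε'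
    have hε'p : 0 < ε' := by positivity
    have hcε : |c| * ε' ≤ ε := by
      rw [hε', mul_div_assoc', div_le_iff₀ (by positivity)]; nlinarith [abs_nonneg c]
    obtain ⟨δ, hδ, hball⟩ := Metric.eventually_nhds_iff.1 (hx.and (Metric.continuousAt_iff'.1 hc ε' hε'p))
    have hδ' : 0 < δ / (1 + |c|) := by positivity
    have hδc : |c| * (δ / (1 + |c|)) < δ := by
      rw [mul_div_assoc', div_lt_iff₀ (by positivity)]; nlinarith [abs_nonneg c]
    have hδ1 : δ / (1 + |c|) ≤ δ := div_le_self hδ.le (by linarith [abs_nonneg c])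
    filter_upwards [Metric.ball_mem_nhds t hδ'] with s hs
    rw [Metric.mem_ball, Real.dist_eq] at hs
    have hin : ∀ y ∈ segment ℝ x (x + c * (s - t)), dist (y, s) (x, t) < δ := by
      intro y hy
      rw [segment_eq_uIcc, mem_uIcc] at hy
      have hy' : |y - x| ≤ |c * (s - t)| := by
        rcases hy with h | h
        · rw [abs_of_nonneg (by linarith)]; exact (by linarith : y - x ≤ c * (s - t)).trans (le_abs_self _)
        · rw [abs_of_nonpos (by linarith)]; exact (by linarith : -(y - x) ≤ -(c * (s - t))).trans (neg_le_abs _)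
      rw [Prod.dist_eq, max_lt_iff, Real.dist_eq, Real.dist_eq]
      refine ⟨lt_of_le_of_lt hy' ?_, hs.trans_le hδ1⟩
      rw [abs_mul]
      exact lt_of_le_of_lt (by gcongr) hδc
    have hmv := (convex_segment x (x + c * (s - t))).norm_image_sub_le_of_norm_hasDerivWithin_le
      (f := fun y => v y s - v1 x t * y) (f' := fun y => v1 y s - v1 x t) (C := ε')
      (fun y hy => (((hball (hin y hy)).1).sub (((hasDerivAt_id y).const_mul (v1 x t)).congr_deriv (mul_one _))).hasDerivWithinAt)
      (fun y hy => ((hball (hin y hy)).2).le) (left_mem_segment ℝ _ _) (right_mem_segment ℝ _ _)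
    simp only [Real.norm_eq_abs] at hmv ⊢
    have e : v (x + c * (s - t)) s - v x s - (v (x + c * (t - t)) t - v x t) - (s - t) • (c * v1 x t)
       = v (x + c * (s - t)) s - v1 x t * (x + c * (s - t)) - (v x s - v1 x t * x) := by
      simp; ring
    rw [e]
    refine hmv.trans ?_
    rw [show x + c * (s - t) - x = c * (s - t) by ring, abs_mul, ← mul_assoc]
    gcongr
    linarith
  refine ((ht.add h2).congr_of_eventuallyEq ?_)
  filter_upwards with s
  simp

lemma harnackF {q : ℝ} (hq : 0 < q) (K lam : ℝ) : ∃ C : ℝ, 0 < C ∧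
    ∀ {G : Set (ℝ × ℝ)} (_ : IsOpen G) {f f1 f2 f3 f4 : ℝ → ℝ → ℝ}
    (_ : FS K lam q G f f1 f2 f3 f4) {a x t1 t2 ρ : ℝ} (_ : 0 < ρ) (_ : ρ ≤ 1)
    (_ : ∀ y t, |y - a| ≤ 2 * ρ → t1 - ρ ^ 2 ≤ t → t ≤ t2 + ρ ^ 2 → (y, t) ∈ G)
    (_ : |x - a| ≤ ρ) (_ : (x - a) ^ 2 ≤ t2 - t1) (_ : t2 - t1 ≤ 100 * ρ ^ 2),
    f x t1 ≤ f a t2 + C := by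
  obtain ⟨C, Cp, hC⟩ := lower_ft hq K lam
  refine ⟨1 + 100 * C, by positivity, ?_⟩
  intro G hG f f1 f2 f3 f4 hf a x t1 t2 ρ hρ hρ1 hcyl hxa h1 h2
  have hρ2 : 0 < ρ ^ 2 := by positivity
  have h12 : t1 ≤ t2 := by nlinarith [sq_nonneg (x - a)]
  rcases h12.lt_or_eq with hlt | heq
  swap
  · have : x = a := by
      have : (x - a) ^ 2 = 0 := le_antisymm (by linarith) (sq_nonneg _)
      have := pow_eq_zero_iff (two_ne_zero) |>.1 this
      linarith
    rw [this, heq]; nlinarith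
  have hT : 0 < t2 - t1 := by linarith
  set c := (a - x) / (t2 - t1) with hc
  have hcT : c * (t2 - t1) = a - x := by rw [hc]; field_simp
  have hpt : ∀ τ ∈ Icc t1 t2, |x + c * (τ - t1) - a| ≤ ρ := by
    intro τ hτ
    have e : x + c * (τ - t1) - a = (x - a) * ((t2 - τ) / (t2 - t1)) := by
      rw [hc]; field_simp; ring
    rw [e, abs_mul]
    have : |(t2 - τ) / (t2 - t1)| ≤ 1 := by
      rw [abs_of_nonneg (div_nonneg (by linarith [hτ.2]) hT.le), div_le_one hT]; linarith [hτ.1]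
    calc |x - a| * |(t2 - τ) / (t2 - t1)| ≤ |x - a| * 1 := by gcongr
      _ ≤ ρ := by linarith
  have hmem : ∀ τ ∈ Icc t1 t2, (x + c * (τ - t1), τ) ∈ G := fun τ hτ =>
    hcyl _ _ (by linarith [hpt τ hτ]) (by linarith [hτ.1]) (by linarith [hτ.2])
  set X : ℝ → ℝ := fun τ => x + c * (τ - t1) with hX
  set ft : ℝ → ℝ := fun τ => f2 (X τ) τ + f1 (X τ) τ ^ 2 + K * f1 (X τ) τ - lam + exp (q * f (X τ) τ)
  have hder : ∀ τ ∈ Icc t1 t2, HasDerivAt (fun s => f (X s) s) (ft τ + c * f1 (X τ) τ) τ := by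
    intro τ hτ
    have hz := hmem τ hτ
    have := diag (v := f) (v1 := f1) (c := c) (x := X τ) (t := τ)
      (by filter_upwards [hG.mem_nhds hz] with z hz' using hf.d0 z hz')
      (hf.c1.continuousAt (hG.mem_nhds hz)) (hf.t0 _ hz)
    refine this.congr_of_eventuallyEq ?_
    filter_upwards with s
    simp only [hX]
    congr 1
    ring
  have hlow : ∀ τ ∈ Icc t1 t2, -(c ^ 2 + C / ρ ^ 2) ≤ ft τ + c * f1 (X τ) τ := by
    intro τ hτ
    have := hC hG hf (a := X τ) (s := τ) hρ hρ1 (fun y t h1 h2 h3 => hcyl y t (by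
      have h4 := hpt τ hτ
      rw [abs_le] at *
      constructor <;> linarith [h1.1, h1.2, h4.1, h4.2]) (by linarith [hτ.1]) (by linarith [hτ.2]))
    nlinarith [sq_nonneg (f1 (X τ) τ / 2 + c)]
  have hmono := (convex_Icc t1 t2).mul_sub_le_image_sub_of_le_deriv (f := fun s => f (X s) s)
    (C := -(c ^ 2 + C / ρ ^ 2)) (fun τ hτ => (hder τ hτ).continuousAt.continuousWithinAt)
    (fun τ hτ => (hder τ (interior_subset hτ)).differentiableAt.differentiableWithinAt)
    (fun τ hτ => by rw [(hder τ (interior_subset hτ)).deriv]; exact hlow τ (interior_subset hτ))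
    t1 ⟨le_rfl, h12⟩ t2 ⟨h12, le_rfl⟩ h12
  have e1 : X t1 = x := by simp [hX]
  have e2 : X t2 = a := by simp only [hX]; rw [hcT]; ring
  simp only [e1, e2] at hmono
  have h5 : c ^ 2 * (t2 - t1) ≤ 1 := by
    have : c ^ 2 * (t2 - t1) = (x - a) ^ 2 / (t2 - t1) := by rw [hc]; field_simp; ring
    rw [this, div_le_one hT]; exact h1
  have h6 : C / ρ ^ 2 * (t2 - t1) ≤ 100 * C := by
    calc C / ρ ^ 2 * (t2 - t1) ≤ C / ρ ^ 2 * (100 * ρ ^ 2) := by gcongr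
      _ = _ := by field_simp
  linarith
end RS
end
open Real Set
noncomputable section
namespace RS
open Filter Topology

def FF (lam p y : ℝ) : ℝ := -lam * y + y ^ p

lemma hasDeriv_rpow {r y : ℝ} (hy : 0 < y) (c : ℝ) : HasDerivAt (fun y => c * y ^ r) (c * r * y ^ (r - 1)) y := by
  refine ((Real.hasDerivAt_rpow_const (p := r) (Or.inl hy.ne')).const_mul c).congr_deriv ?_
  ring

lemma contDiff_rpow {r y : ℝ} (hy : 0 < y) (c : ℝ) : ContDiffAt ℝ 1 (fun y => c * y ^ r) y :=
  contDiffAt_const.mul (Real.contDiffAt_rpow_const_of_ne hy.ne')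

lemma reg_p {K lam p : ℝ} {G : Set (ℝ × ℝ)} (hG : IsOpen G) {v v1 v2 : ℝ → ℝ → ℝ}
    (hs : SolOn K G v v1 v2 (fun x t => FF lam p (v x t))) (hp : ∀ z ∈ G, 0 < v z.1 z.2)
    (hc : CtOn G v) : ∃ v3 v4, CtOn G v1 ∧ CtOn G v2 ∧
      SolOn K G v1 v2 v3 (fun x t => (-lam + p * v x t ^ (p - 1)) * v1 x t) ∧
      SolOn K G v2 v3 v4 (fun x t => (p * (p - 1) * v x t ^ (p - 1 - 1)) * v1 x t ^ 2
        + (-lam + p * v x t ^ (p - 1)) * v2 x t) := by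
  refine regularity hG (F := FF lam p) (F1 := fun y => -lam + p * y ^ (p - 1))
    (F2 := fun y => p * (p - 1) * y ^ (p - 1 - 1)) (F3 := fun y => p * (p - 1) * (p - 1 - 1) * y ^ (p - 1 - 1 - 1))
    ?_ ?_ ?_ ?_ ?_ ?_ ?_ hs hp hc
  · intro y hy
    have := ((hasDerivAt_id y).const_mul (-lam)).add (hasDeriv_rpow (r := p) hy 1)
    simp only [one_mul, mul_one, id] at this
    exact this
  · intro y hy
    exact (hasDeriv_rpow hy p).const_add _
  · intro y hy
    exact hasDeriv_rpow hy _
  · intro y hy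
    have := (contDiffAt_const (c := -lam)).mul (contDiffAt_id (𝕜 := ℝ) (n := 1) (x := y)) |>.add (contDiff_rpow (r := p) hy 1)
    simp only [one_mul, id] at this
    exact this
  · intro y hy
    exact contDiffAt_const.add (contDiff_rpow hy p)
  · intro y hy
    exact contDiff_rpow hy _
  · intro y hy
    exact contDiff_rpow hy _

set_option maxHeartbeats 1000000 in
lemma toFS {K lam p : ℝ} {G : Set (ℝ × ℝ)} (hG : IsOpen G) {v v1 v2 : ℝ → ℝ → ℝ}
    (hs : SolOn K G v v1 v2 (fun x t => FF lam p (v x t))) (hp : ∀ z ∈ G, 0 < v z.1 z.2)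
    (hc : CtOn G v) : ∃ f1 f2 f3 f4, FS K lam (p - 1) G (fun x t => Real.log (v x t)) f1 f2 f3 f4 := by
  obtain ⟨v3, v4, cv1, cv2, s1, s2⟩ := reg_p hG hs hp hc
  have hne : ∀ z ∈ G, v z.1 z.2 ≠ 0 := fun z hz => (hp z hz).ne'
  have hexp : ∀ z ∈ G, exp ((p - 1) * Real.log (v z.1 z.2)) = v z.1 z.2 ^ (p - 1) := by
    intro z hz
    rw [Real.rpow_def_of_pos (hp z hz), mul_comm]
  have hvp : ∀ z ∈ G, v z.1 z.2 ^ p = v z.1 z.2 ^ (p - 1) * v z.1 z.2 := by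
    intro z hz
    rw [← Real.rpow_add_one (hne z hz)]; congr 1; ring
  have hvp2 : ∀ z ∈ G, v z.1 z.2 ^ (p - 1 - 1) = v z.1 z.2 ^ (p - 1) / v z.1 z.2 := by
    intro z hz
    rw [Real.rpow_sub_one (hne z hz)]
  let f1 : ℝ → ℝ → ℝ := fun x t => v1 x t / v x t
  let f2 : ℝ → ℝ → ℝ := fun x t => v2 x t / v x t - (v1 x t / v x t) ^ 2
  let f3 : ℝ → ℝ → ℝ := fun x t => (v3 x t * v x t - v2 x t * v1 x t) / v x t ^ 2 - 2 * (f1 x t * f2 x t)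
  let f4 : ℝ → ℝ → ℝ := fun x t => ((v4 x t * v x t + v3 x t * v1 x t - (v3 x t * v1 x t + v2 x t * v2 x t)) * v x t ^ 2
     - (v3 x t * v x t - v2 x t * v1 x t) * (2 * v x t * v1 x t)) / (v x t ^ 2) ^ 2
     - 2 * (f2 x t * f2 x t + f1 x t * f3 x t)
  have D0 : DxOn G (fun x t => Real.log (v x t)) f1 := fun z hz => (hs z hz).1.log (hne z hz)
  have D1 : DxOn G f1 f2 := by
    intro z hz
    refine ((hs z hz).2.1.div (hs z hz).1 (hne z hz)).congr_deriv ?_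
    have := hne z hz
    simp only [f2]; field_simp
  have D2 : DxOn G f2 f3 := by
    intro z hz
    refine (((s1 z hz).2.1.div (hs z hz).1 (hne z hz)).sub ((D1 z hz).pow 2)).congr_deriv ?_
    have := hne z hz
    simp only [f3]; simp; ring
  have D3 : DxOn G f3 f4 := by
    intro z hz
    refine ((((((s2 z hz).2.1).mul (hs z hz).1).sub ((s1 z hz).2.1.mul (s1 z hz).1)).div ((hs z hz).1.pow 2)
      (pow_ne_zero 2 (hne z hz))).sub (((D1 z hz).mul (D2 z hz)).const_mul 2)).congr_deriv ?_
    simp only [f4]; simp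
  refine ⟨f1, f2, f3, f4, ?_, ?_, ?_, D0, D1, D2, D3, ?_, ?_, ?_⟩
  · exact ContinuousOn.log hc hne
  · exact ContinuousOn.div cv1 hc hne
  · exact (ContinuousOn.div cv2 hc hne).sub ((ContinuousOn.div cv1 hc hne).pow 2)
  · intro z hz
    refine ((hs z hz).2.2.log (hne z hz)).congr_deriv ?_
    rw [hexp z hz]
    simp only [f1, f2, FF]
    rw [hvp z hz]
    have := hne z hz
    field_simp; ring
  · intro z hz
    refine ((s1 z hz).2.2.div (hs z hz).2.2 (hne z hz)).congr_deriv ?_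
    rw [hexp z hz]
    simp only [f1, f2, f3, FF]
    rw [hvp z hz]
    have := hne z hz
    field_simp; ring
  · intro z hz
    refine (((s2 z hz).2.2.div (hs z hz).2.2 (hne z hz)).sub (((s1 z hz).2.2.div (hs z hz).2.2 (hne z hz)).pow 2)).congr_deriv ?_
    rw [hexp z hz]
    simp only [f1, f2, f3, f4, FF, hvp2 z hz]
    rw [hvp z hz]
    have := hne z hz
    generalize v z.1 z.2 ^ (p - 1) = w
    simp only [Pi.div_apply, Nat.cast_ofNat, Nat.reduceSub, pow_one]
    field_simp; ring

lemma harnack {p : ℝ} (hp : 1 < p) (K lam : ℝ) : ∃ C : ℝ, 1 ≤ C ∧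
    ∀ {G : Set (ℝ × ℝ)} (_ : IsOpen G) {v v1 v2 : ℝ → ℝ → ℝ}
    (_ : SolOn K G v v1 v2 (fun x t => FF lam p (v x t))) (_ : ∀ z ∈ G, 0 < v z.1 z.2)
    (_ : CtOn G v) {a x t1 t2 ρ : ℝ} (_ : 0 < ρ) (_ : ρ ≤ 1)
    (_ : ∀ y t, |y - a| ≤ 2 * ρ → t1 - ρ ^ 2 ≤ t → t ≤ t2 + ρ ^ 2 → (y, t) ∈ G)
    (_ : |x - a| ≤ ρ) (_ : (x - a) ^ 2 ≤ t2 - t1) (_ : t2 - t1 ≤ 100 * ρ ^ 2),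
    v x t1 ≤ C * v a t2 := by
  obtain ⟨C, Cp, h⟩ := harnackF (q := p - 1) (by linarith) K lam
  refine ⟨exp C, Real.one_le_exp Cp.le, ?_⟩
  intro G hG v v1 v2 hs hpos hc a x t1 t2 ρ hρ hρ1 hcyl hxa h1 h2
  obtain ⟨f1, f2, f3, f4, hf⟩ := toFS hG hs hpos hc
  have := h hG hf hρ hρ1 hcyl hxa h1 h2
  have h12 : t1 ≤ t2 := by nlinarith [sq_nonneg (x - a)]
  have m1 : (x, t1) ∈ G := hcyl x t1 (by linarith) (by nlinarith) (by nlinarith)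
  have m2 : (a, t2) ∈ G := hcyl a t2 (by simp [hρ.le]) (by nlinarith) (by nlinarith)
  have p1 := hpos _ m1
  have p2 := hpos _ m2
  simp only at p1 p2
  calc v x t1 = exp (Real.log (v x t1)) := (Real.exp_log p1).symm
    _ ≤ exp (Real.log (v a t2) + C) := Real.exp_le_exp.2 this
    _ = _ := by rw [Real.exp_add, Real.exp_log p2, mul_comm]
end RS
end
open Real Set
noncomputable section
namespace RS
open Filter Topology

lemma mp {D : Set (ℝ × ℝ)} (hD : IsCompact D) {w : ℝ → ℝ → ℝ} (hw : CtOn D w)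
    (h : ∀ z ∈ D, w z.1 z.2 ≤ 0 ∨ ∃ (w1 : ℝ → ℝ) (c2 ct : ℝ), (∀ᶠ x in 𝓝 z.1, (x, z.2) ∈ D) ∧
      (∀ᶠ s in 𝓝[<] z.2, (z.1, s) ∈ D) ∧ (∀ᶠ x in 𝓝 z.1, HasDerivAt (fun x => w x z.2) (w1 x) x) ∧
      HasDerivAt w1 c2 z.1 ∧ HasDerivAt (fun s => w z.1 s) ct z.2 ∧ (w1 z.1 = 0 → c2 ≤ 0 → ct < 0)) :
    ∀ z ∈ D, w z.1 z.2 ≤ 0 := by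
  intro z0 hz0
  obtain ⟨z, hz, hmax⟩ := hD.exists_isMaxOn ⟨z0, hz0⟩ hw
  refine (hmax hz0).trans ?_
  simp only
  rcases h z hz with h | ⟨w1, c2, ct, e1, e2, d1, d2, dt, hc⟩
  · exact h
  exfalso
  have hl : IsLocalMax (fun x => w x z.2) z.1 := by
    filter_upwards [e1] with x hx using hmax hx
  obtain ⟨i1, i2⟩ := snd_test d1 d2 hl
  have := left_test dt (by filter_upwards [e2] with s hs using hmax hs)
  linarith [hc i1 i2]

/-- corner barrier -/
def Ed (a c x t : ℝ) : ℝ := (x - a) ^ 2 + 16 * (t - c)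
def Eb (a c x t : ℝ) : ℝ := -Real.log (Ed a c x t) + 120 * (t - c) / Ed a c x t
def Eb1 (a c x t : ℝ) : ℝ := -(2 * (x - a)) / Ed a c x t - 240 * (t - c) * (x - a) / Ed a c x t ^ 2
def Eb2 (a c x t : ℝ) : ℝ := -2 / Ed a c x t + 4 * (x - a) ^ 2 / Ed a c x t ^ 2 - 240 * (t - c) / Ed a c x t ^ 2
  + 960 * (t - c) * (x - a) ^ 2 / Ed a c x t ^ 3
def Ebt (a c x t : ℝ) : ℝ := 104 / Ed a c x t - 1920 * (t - c) / Ed a c x t ^ 2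

lemma Ed_x (a c x t : ℝ) : HasDerivAt (fun y => Ed a c y t) (2 * (x - a)) x := by
  unfold Ed
  refine ((((hasDerivAt_id x).sub_const a).pow 2).add_const _).congr_deriv ?_
  simp
lemma Ed_t (a c x t : ℝ) : HasDerivAt (fun s => Ed a c x s) 16 t := by
  unfold Ed
  refine ((((hasDerivAt_id t).sub_const c).const_mul 16).const_add _).congr_deriv ?_
  simp
lemma Ed_cont (a c : ℝ) : Continuous (fun z : ℝ × ℝ => Ed a c z.1 z.2) := by unfold Ed; fun_prop

lemma Eb_x {a c x t : ℝ} (h : 0 < Ed a c x t) : HasDerivAt (fun y => Eb a c y t) (Eb1 a c x t) x := by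
  have hd := Ed_x a c x t
  refine ((hd.log h.ne').neg.add ((hasDerivAt_const x (120 * (t - c))).div hd h.ne')).congr_deriv ?_
  unfold Eb1
  field_simp; ring
lemma Eb_xx {a c x t : ℝ} (h : 0 < Ed a c x t) : HasDerivAt (fun y => Eb1 a c y t) (Eb2 a c x t) x := by
  have hd := Ed_x a c x t
  have hx : HasDerivAt (fun y => y - a) 1 x := (hasDerivAt_id x).sub_const a
  refine (((hx.const_mul 2).neg.div hd h.ne').sub
    ((hx.const_mul (240 * (t - c))).div (hd.pow 2) (pow_ne_zero 2 h.ne'))).congr_deriv ?_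
  unfold Eb2
  simp only [Nat.cast_ofNat, Nat.reduceSub, pow_one, Pi.neg_apply, Pi.pow_apply]
  generalize Ed a c x t = D at *
  field_simp; ring
lemma Eb_t {a c x t : ℝ} (h : 0 < Ed a c x t) : HasDerivAt (fun s => Eb a c x s) (Ebt a c x t) t := by
  have hd := Ed_t a c x t
  have hx : HasDerivAt (fun y => y - c) 1 t := (hasDerivAt_id t).sub_const c
  refine ((hd.log h.ne').neg.add ((hx.const_mul 120).div hd h.ne')).congr_deriv ?_
  unfold Ebt
  generalize Ed a c x t = D at *
  field_simp; ring

lemma Eb_super {K a c x t : ℝ} (h : 0 < Ed a c x t) (ht : c ≤ t) (hK : 17 * |K * (x - a)| ≤ 1) :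
    0 ≤ Ebt a c x t - Eb2 a c x t - K * Eb1 a c x t := by
  have hD : Ed a c x t = (x - a) ^ 2 + 16 * (t - c) := rfl
  unfold Ebt Eb2 Eb1
  generalize Ed a c x t = D at *
  have τ0 : 0 ≤ t - c := by linarith
  generalize t - c = τ at *
  generalize x - a = ξ at *
  have e : 104 / D - 1920 * τ / D ^ 2 - (-2 / D + 4 * ξ ^ 2 / D ^ 2 - 240 * τ / D ^ 2 + 960 * τ * ξ ^ 2 / D ^ 3)
    - K * (-(2 * ξ) / D - 240 * τ * ξ / D ^ 2)
    = (106 * D ^ 2 - 1680 * τ * D - 4 * ξ ^ 2 * D - 960 * τ * ξ ^ 2 + K * ξ * (2 * D ^ 2 + 240 * τ * D)) / D ^ 3 := by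
    field_simp; ring
  rw [e]
  apply div_nonneg _ (by positivity)
  have h16 : 16 * τ ≤ D := by rw [hD]; nlinarith [sq_nonneg ξ]
  have h1 : 960 * τ * ξ ^ 2 ≤ 60 * D * ξ ^ 2 := by nlinarith [mul_le_mul_of_nonneg_right h16 (sq_nonneg ξ)]
  have h2 : 240 * τ * D ≤ 15 * D ^ 2 := by nlinarith [mul_le_mul_of_nonneg_right h16 h.le]
  have h3 : -(|K * ξ| * (17 * D ^ 2)) ≤ K * ξ * (2 * D ^ 2 + 240 * τ * D) := by
    have a1 : |K * ξ| * (2 * D ^ 2 + 240 * τ * D) ≤ |K * ξ| * (17 * D ^ 2) := by gcongr; linarith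
    have a2 := mul_le_mul_of_nonneg_right (neg_abs_le (K * ξ)) (show 0 ≤ 2 * D ^ 2 + 240 * τ * D by positivity)
    linarith
  have h4 : |K * ξ| * (17 * D ^ 2) ≤ D ^ 2 := by
    have := mul_le_mul_of_nonneg_right hK (sq_nonneg D)
    linarith
  have h5 : 106 * D ^ 2 = 106 * ξ ^ 2 * D + 1696 * τ * D := by rw [hD]; ring
  have h6 : D ^ 2 = ξ ^ 2 * D + 16 * τ * D := by rw [hD]; ring
  have h7 : 0 ≤ ξ ^ 2 * D := by positivity
  linarith

lemma Eb_ge {a c x t : ℝ} (h : 0 < Ed a c x t) (ht : c ≤ t) : -Real.log (Ed a c x t) ≤ Eb a c x t := by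
  unfold Eb
  have : 0 ≤ 120 * (t - c) / Ed a c x t := div_nonneg (by linarith) h.le
  linarith

set_option maxHeartbeats 1000000 in
lemma rectMP {K a b c d M : ℝ} (hM : 0 ≤ M) {v v1 v2 H Φ Φ1 Φ2 Φt : ℝ → ℝ → ℝ}
    (hsmall : (b - a) ^ 2 + 16 * (d - c) ≤ 1) (hK : 17 * (|K| * (b - a)) ≤ 1)
    (hcont : ∀ x t, a ≤ x → x ≤ b → c ≤ t → t ≤ d → 0 < Ed a c x t → 0 < Ed b c x t →
      ContinuousAt (fun z : ℝ × ℝ => v z.1 z.2) (x, t))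
    (hsol : ∀ x t, a < x → x < b → c < t → t ≤ d → SolAt K v v1 v2 H x t)
    (hΦc : Continuous (fun z : ℝ × ℝ => Φ z.1 z.2))
    (hΦx : ∀ x t, HasDerivAt (fun y => Φ y t) (Φ1 x t) x)
    (hΦxx : ∀ x t, HasDerivAt (fun y => Φ1 y t) (Φ2 x t) x)
    (hΦt : ∀ x t, HasDerivAt (fun s => Φ x s) (Φt x t) t)
    (hsup : ∀ x t, a < x → x < b → c < t → t ≤ d → H x t < Φt x t - Φ2 x t - K * Φ1 x t)
    (hb : ∀ x t, a ≤ x → x ≤ b → c ≤ t → t ≤ d → v x t ≤ Φ x t + M)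
    (hba : ∀ t, c ≤ t → t ≤ d → v a t ≤ Φ a t) (hbb : ∀ t, c ≤ t → t ≤ d → v b t ≤ Φ b t)
    (hbc : ∀ x, a ≤ x → x ≤ b → v x c ≤ Φ x c) {x0 t0 : ℝ} (hx0 : a < x0) (hx0' : x0 < b)
    (ht0 : c < t0) (ht0' : t0 ≤ d) : v x0 t0 ≤ Φ x0 t0 := by
  have Ed1 : ∀ x t, a ≤ x → x ≤ b → c ≤ t → t ≤ d → Ed a c x t ≤ 1 ∧ Ed b c x t ≤ 1 := by
    intro x t h1 h2 h3 h4
    have i1 : (x - a) ^ 2 ≤ (b - a) ^ 2 := by apply pow_le_pow_left₀ <;> linarith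
    have i2 : (x - b) ^ 2 ≤ (b - a) ^ 2 := by
      rw [← neg_sq]; apply pow_le_pow_left₀ <;> linarith
    unfold Ed
    constructor <;> linarith
  have Ebn : ∀ x t, a ≤ x → x ≤ b → c ≤ t → t ≤ d → 0 < Ed a c x t → 0 < Ed b c x t →
      0 ≤ Eb a c x t ∧ 0 ≤ Eb b c x t := by
    intro x t h1 h2 h3 h4 pa pb
    obtain ⟨e1, e2⟩ := Ed1 x t h1 h2 h3 h4
    have := Eb_ge pa h3
    have := Eb_ge pb h3
    have := Real.log_nonpos pa.le e1
    have := Real.log_nonpos pb.le e2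
    constructor <;> linarith
  have key : ∀ ε : ℝ, 0 < ε → v x0 t0 - Φ x0 t0 - ε * (Eb a c x0 t0 + Eb b c x0 t0) ≤ 0 := by
    intro ε hε
    set θ := Real.exp (-(M / ε)) with hθ
    have θp : 0 < θ := Real.exp_pos _
    let w : ℝ → ℝ → ℝ := fun x t => v x t - Φ x t - ε * (Eb a c x t + Eb b c x t)
    have hnear : ∀ x t, a ≤ x → x ≤ b → c ≤ t → t ≤ d → 0 < Ed a c x t → 0 < Ed b c x t →
        (Ed a c x t ≤ θ ∨ Ed b c x t ≤ θ) → w x t ≤ 0 := by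
      intro x t h1 h2 h3 h4 pa pb hor
      obtain ⟨n1, n2⟩ := Ebn x t h1 h2 h3 h4 pa pb
      have hbd := hb x t h1 h2 h3 h4
      have hge : M / ε ≤ Eb a c x t + Eb b c x t := by
        rcases hor with h | h
        · have := Eb_ge pa h3
          have hl := Real.log_le_log pa h
          rw [hθ, Real.log_exp] at hl
          linarith
        · have := Eb_ge pb h3
          have hl := Real.log_le_log pb h
          rw [hθ, Real.log_exp] at hl
          linarith
      rw [div_le_iff₀ hε] at hge
      simp only [w]
      linarith
    let D : Set (ℝ × ℝ) := (Icc a b ×ˢ Icc c d) ∩ ({z | θ ≤ Ed a c z.1 z.2} ∩ {z | θ ≤ Ed b c z.1 z.2})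
    have hDc : IsCompact D := (isCompact_Icc.prod isCompact_Icc).inter_right
      ((isClosed_le continuous_const (Ed_cont a c)).inter (isClosed_le continuous_const (Ed_cont b c)))
    have hEc : ∀ e, ∀ z : ℝ × ℝ, 0 < Ed e c z.1 z.2 → ContinuousAt (fun z : ℝ × ℝ => Eb e c z.1 z.2) z := by
      intro e z hz
      unfold Eb
      have := (Ed_cont e c).continuousAt (x := z)
      exact ((this.log hz.ne').neg).add (ContinuousAt.div (by fun_prop) this hz.ne')
    have hwc : CtOn D w := by
      rintro ⟨x, t⟩ ⟨⟨⟨h1, h2⟩, h3, h4⟩, h5, h6⟩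
      have pa : 0 < Ed a c x t := lt_of_lt_of_le θp h5
      have pb : 0 < Ed b c x t := lt_of_lt_of_le θp h6
      exact (((hcont x t h1 h2 h3 h4 pa pb).sub hΦc.continuousAt).sub
        (continuousAt_const.mul ((hEc a (x, t) pa).add (hEc b (x, t) pb)))).continuousWithinAt
    have hall := mp hDc hwc ?_
    · have pa : 0 < Ed a c x0 t0 := by unfold Ed; nlinarith [sq_nonneg (x0 - a)]
      have pb : 0 < Ed b c x0 t0 := by unfold Ed; nlinarith [sq_nonneg (x0 - b)]
      by_cases hD : (x0, t0) ∈ D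
      · exact hall _ hD
      · refine hnear x0 t0 hx0.le hx0'.le ht0.le ht0' pa pb ?_
        by_contra hcon
        push Not at hcon
        exact hD ⟨⟨⟨hx0.le, hx0'.le⟩, ht0.le, ht0'⟩, hcon.1.le, hcon.2.le⟩
    rintro ⟨x, t⟩ ⟨⟨⟨h1, h2⟩, h3, h4⟩, h5, h6⟩
    simp only [mem_ofPred_eq] at h1 h2 h3 h4 h5 h6 ⊢
    have pa : 0 < Ed a c x t := lt_of_lt_of_le θp h5
    have pb : 0 < Ed b c x t := lt_of_lt_of_le θp h6
    obtain ⟨n1, n2⟩ := Ebn x t h1 h2 h3 h4 pa pb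
    have nE : 0 ≤ ε * (Eb a c x t + Eb b c x t) := by positivity
    by_cases hle : w x t ≤ 0
    · exact Or.inl hle
    right
    have hxa : a < x := by
      rcases h1.lt_or_eq with h | h
      · exact h
      · subst h; exact absurd (by have := hba t h3 h4; simp only [w]; linarith) hle
    have hxb : x < b := by
      rcases h2.lt_or_eq with h | h
      · exact h
      · subst h; exact absurd (by have := hbb t h3 h4; simp only [w]; linarith) hle
    have htc : c < t := by
      rcases h3.lt_or_eq with h | h
      · exact h
      · subst h; exact absurd (by have := hbc x h1 h2; simp only [w]; linarith) hle
    have hDa : θ < Ed a c x t := by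
      by_contra hcon; push Not at hcon
      exact hle (hnear x t h1 h2 h3 h4 pa pb (Or.inl hcon))
    have hDb : θ < Ed b c x t := by
      by_contra hcon; push Not at hcon
      exact hle (hnear x t h1 h2 h3 h4 pa pb (Or.inr hcon))
    have cxa := (Ed_x a c x t).continuousAt.eventually (lt_mem_nhds hDa)
    have cxb := (Ed_x b c x t).continuousAt.eventually (lt_mem_nhds hDb)
    have cta := (Ed_t a c x t).continuousAt.eventually (lt_mem_nhds hDa)
    have ctb := (Ed_t b c x t).continuousAt.eventually (lt_mem_nhds hDb)
    refine ⟨fun y => v1 y t - Φ1 y t - ε * (Eb1 a c y t + Eb1 b c y t),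
      v2 x t - Φ2 x t - ε * (Eb2 a c x t + Eb2 b c x t),
      (v2 x t + K * v1 x t + H x t) - Φt x t - ε * (Ebt a c x t + Ebt b c x t), ?_, ?_, ?_, ?_, ?_, ?_⟩
    · filter_upwards [Ioo_mem_nhds hxa hxb, cxa, cxb] with y hy ha hb
      exact ⟨⟨⟨hy.1.le, hy.2.le⟩, h3, h4⟩, ha.le, hb.le⟩
    · filter_upwards [Ioo_mem_nhdsLT htc, nhdsWithin_le_nhds cta, nhdsWithin_le_nhds ctb] with s hs ha hb
      exact ⟨⟨⟨h1, h2⟩, hs.1.le, hs.2.le.trans h4⟩, ha.le, hb.le⟩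
    · filter_upwards [Ioo_mem_nhds hxa hxb, cxa, cxb] with y hy ha hb
      exact ((hsol y t hy.1 hy.2 htc h4).1.sub (hΦx y t)).sub
        (((Eb_x (θp.trans ha)).add (Eb_x (θp.trans hb))).const_mul ε)
    · exact ((hsol x t hxa hxb htc h4).2.1.sub (hΦxx x t)).sub
        (((Eb_xx pa).add (Eb_xx pb)).const_mul ε)
    · exact ((hsol x t hxa hxb htc h4).2.2.sub (hΦt x t)).sub
        (((Eb_t pa).add (Eb_t pb)).const_mul ε)
    · intro z1 z2
      have hKe : ∀ e, |x - e| ≤ b - a → 17 * |K * (x - e)| ≤ 1 := by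
        intro e he
        rw [abs_mul]
        have := mul_le_mul_of_nonneg_left he (abs_nonneg K)
        linarith
      have sa := Eb_super pa h3 (hKe a (by rw [abs_le]; constructor <;> linarith))
      have sb := Eb_super pb h3 (hKe b (by rw [abs_le]; constructor <;> linarith))
      have s := mul_nonneg hε.le (add_nonneg sa sb)
      have hs := hsup x t hxa hxb htc h4
      have hv1 : v1 x t = Φ1 x t + ε * (Eb1 a c x t + Eb1 b c x t) := by linarith
      rw [hv1]
      linarith
  have pa : 0 < Ed a c x0 t0 := by unfold Ed; nlinarith [sq_nonneg (x0 - a)]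
  have pb : 0 < Ed b c x0 t0 := by unfold Ed; nlinarith [sq_nonneg (x0 - b)]
  obtain ⟨n1, n2⟩ := Ebn x0 t0 hx0.le hx0'.le ht0.le ht0' pa pb
  set E := Eb a c x0 t0 + Eb b c x0 t0 with hE
  have En : 0 ≤ E := by positivity
  apply le_of_forall_pos_le_add
  intro ε hε
  have := key (ε / (E + 1)) (by positivity)
  have h2 : ε / (E + 1) * E ≤ ε := by
    rw [div_mul_eq_mul_div, div_le_iff₀ (by positivity)]; nlinarith
  linarith
end RS
end
open Real Set
noncomputable section
namespace RS
open Filter Topology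

set_option maxHeartbeats 1000000 in
lemma sideUp {K n M1 M2 η x1 t1 : ℝ} {B : Set (ℝ × ℝ)} {w w1 w2 H : ℝ → ℝ → ℝ}
    (hη : 0 < η) (hη1 : η ≤ 1 / 100) (hKη : 40 * (|K| * η) ≤ 1) (hM1 : 0 < M1) (hM2 : M2 * η ^ 2 < 3 * M1)
    (hn : 0 ≤ n) (hz1 : (x1, t1) ∈ B) (hB : IsCompact (B ∩ {z | InQ (x1, t1) η z.1 z.2}))
    (hsol : ∀ x t, InQ (x1, t1) η x t → SolAt K w w1 w2 H x t)
    (hw : ∀ x t, InQ (x1, t1) η x t → |w x t| ≤ M1)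
    (hH : ∀ x t, InQ (x1, t1) η x t → |H x t| ≤ M2)
    (hct : ∀ x t, InQ (x1, t1) η x t → (x, t) ∉ B → ContinuousAt (fun z : ℝ × ℝ => w z.1 z.2) (x, t))
    (hcol : ∀ x t, InQ (x1, t1) η x t → (x, t) ∈ B →
      (∀ s, |s - t1| ≤ η → |w x s - w x t| ≤ n * |s - t|) ∧
      (∀ y, |y - x1| ≤ η → |w y t - w x t| ≤ n * |y - x|))
    {y s : ℝ} (hy : x1 ≤ y) (hy' : y ≤ x1 + η ^ 2) (hs : t1 - η / 2 ≤ s) (hs' : s ≤ t1 + η) :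
    w y s ≤ w x1 t1 + (4 * n + 20 * M1) * η := by
  have hself : InQ (x1, t1) η x1 t1 := inQ_self (x1, t1) hη
  have hη2 : η ^ 2 < η := by nlinarith
  have nη : 0 ≤ n * η := by positivity
  have mη : 0 ≤ M1 * η := by positivity
  have inQ_iff : ∀ x t, InQ (x1, t1) η x t ↔ (x1 - η ≤ x ∧ x ≤ x1 + η) ∧ (t1 - η ≤ t ∧ t ≤ t1 + η) := by
    intro x t
    unfold InQ
    simp only [abs_le]
    constructor
    · rintro ⟨⟨h1, h2⟩, h3, h4⟩; refine ⟨⟨?_, ?_⟩, ?_, ?_⟩ <;> linarith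
    · rintro ⟨⟨h1, h2⟩, h3, h4⟩; refine ⟨⟨?_, ?_⟩, ?_, ?_⟩ <;> linarith
  -- point bound
  have hpt : ∀ x t, InQ (x1, t1) η x t → (x, t) ∈ B → w x t ≤ w x1 t1 + 2 * (n * η) := by
    intro x t hq hb
    have h1 := (hcol x t hq hb).2 x1 (by simp [hη.le])
    have h2 := (hcol x1 t1 hself hz1).1 t hq.2
    have i1 : |x1 - x| ≤ η := by rw [abs_sub_comm]; exact hq.1
    have i2 : |t - t1| ≤ η := hq.2
    have j1 := mul_le_mul_of_nonneg_left i1 hn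
    have j2 := mul_le_mul_of_nonneg_left i2 hn
    have k1 := abs_le.1 h1
    have k2 := abs_le.1 h2
    linarith [k1.1, k1.2, k2.1, k2.2]
  let X : Set ℝ := Set.image Prod.fst (B ∩ {z | InQ (x1, t1) η z.1 z.2})
  let T : Set ℝ := Set.image Prod.snd (B ∩ {z | InQ (x1, t1) η z.1 z.2})
  have hXc : IsCompact X := hB.image continuous_fst
  have hTc : IsCompact T := hB.image continuous_snd
  have hX : ∀ x ∈ X, ∀ t, InQ (x1, t1) η x t → w x t ≤ w x1 t1 + 4 * (n * η) := by
    rintro _ ⟨⟨x, t⟩, ⟨hb, hq⟩, rfl⟩ s hsq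
    simp only [mem_ofPred_eq] at hq hsq ⊢
    have h0 := hpt x t hq hb
    have h1 := abs_le.1 ((hcol x t hq hb).1 s hsq.2)
    have i1 : |s - t| ≤ 2 * η := by
      have := abs_le.1 hsq.2; have h4 := abs_le.1 hq.2
      simp only at this h4
      rw [abs_le]; constructor <;> linarith [this.1, this.2, h4.1, h4.2]
    have j1 := mul_le_mul_of_nonneg_left i1 hn
    linarith [h1.1, h1.2]
  have hT : ∀ t ∈ T, ∀ x, InQ (x1, t1) η x t → w x t ≤ w x1 t1 + 4 * (n * η) := by
    rintro _ ⟨⟨x, t⟩, ⟨hb, hq⟩, rfl⟩ y hyq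
    simp only [mem_ofPred_eq] at hq hyq ⊢
    have h0 := hpt x t hq hb
    have h1 := abs_le.1 ((hcol x t hq hb).2 y hyq.1)
    have i1 : |y - x| ≤ 2 * η := by
      have := abs_le.1 hyq.1; have h4 := abs_le.1 hq.1
      simp only at this h4
      rw [abs_le]; constructor <;> linarith [this.1, this.2, h4.1, h4.2]
    have j1 := mul_le_mul_of_nonneg_left i1 hn
    linarith [h1.1, h1.2]
  have hx1X : x1 ∈ X := ⟨(x1, t1), ⟨hz1, hself⟩, rfl⟩
  have hysQ : InQ (x1, t1) η y s := by rw [inQ_iff]; refine ⟨⟨?_, ?_⟩, ?_, ?_⟩ <;> linarith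
  by_cases hyX : y ∈ X
  · have := hX y hyX s hysQ; linarith
  by_cases hsT : s ∈ T
  · have := hT s hsT y hysQ; linarith
  obtain ⟨a, ⟨haX, hay⟩, ha⟩ := (hXc.inter_right (isClosed_Iic (a := y))).exists_isGreatest ⟨x1, hx1X, hy⟩
  obtain ⟨b, ⟨hbX, hyb⟩, hb⟩ := ((hXc.union (isCompact_singleton (x := x1 + η))).inter_right
    (isClosed_Ici (a := y))).exists_isLeast ⟨x1 + η, Or.inr rfl, by simp only [mem_Ici]; linarith⟩
  obtain ⟨c, ⟨hcT, hcs⟩, hc⟩ := ((hTc.union (isCompact_singleton (x := t1 - η))).inter_right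
    (isClosed_Iic (a := s))).exists_isGreatest ⟨t1 - η, Or.inr rfl, by simp only [mem_Iic]; linarith⟩
  simp only [mem_Iic, mem_Ici] at hay hyb hcs
  have hay' : a < y := lt_of_le_of_ne hay (fun h => hyX (h ▸ haX))
  have hyb' : y < b := by
    refine lt_of_le_of_ne hyb (fun h => ?_)
    rcases hbX with h' | h'
    · exact hyX (h ▸ h')
    · rw [mem_singleton_iff] at h'; linarith
  have hcs' : c < s := by
    refine lt_of_le_of_ne hcs (fun h => ?_)
    rcases hcT with h' | h'
    · exact hsT (h ▸ h')
    · rw [mem_singleton_iff] at h'; linarith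
  have hx1a : x1 ≤ a := ha ⟨hx1X, hy⟩
  have hbη : b ≤ x1 + η := hb ⟨Or.inr rfl, by simp only [mem_Ici]; linarith⟩
  have hcη : t1 - η ≤ c := hc ⟨Or.inr rfl, by simp only [mem_Iic]; linarith⟩
  have hXn : ∀ x, a < x → x < b → x ∉ X := by
    intro x h1 h2 hx
    rcases le_total x y with h | h
    · exact absurd (ha ⟨hx, h⟩) (not_le.2 h1)
    · exact absurd (hb ⟨Or.inl hx, h⟩) (not_le.2 h2)
  have hTn : ∀ t, c < t → t ≤ s → t ∉ T := fun t h1 h2 ht => absurd (hc ⟨Or.inl ht, h2⟩) (not_le.2 h1)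
  have hQ : ∀ x t, a ≤ x → x ≤ b → c ≤ t → t ≤ s → InQ (x1, t1) η x t := by
    intro x t h1 h2 h3 h4
    rw [inQ_iff]; refine ⟨⟨?_, ?_⟩, ?_, ?_⟩ <;> linarith
  set V := w x1 t1 with hV
  have hVM := abs_le.1 (hw x1 t1 hself)
  set i : ℝ := 1 / η with hi
  have ip : 0 < i := by positivity
  have iη : i * η = 1 := by rw [hi]; field_simp
  let e : ℝ → ℝ := fun t => exp (-(i ^ 2 / 2) * (t - (t1 - η)))
  have ep : ∀ t, 0 < e t := fun t => Real.exp_pos _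
  let Φ : ℝ → ℝ → ℝ := fun x t => V + 4 * (n * η) + 2 * M1 * (2 * (x - x1) * i - (x - x1) ^ 2 * i ^ 2)
    + 2 * M1 * (e t * (2 - (x - x1) ^ 2 * i ^ 2))
  let Φ1 : ℝ → ℝ → ℝ := fun x t => 2 * M1 * (2 * i - 2 * (x - x1) * i ^ 2) + 2 * M1 * (e t * (-(2 * (x - x1) * i ^ 2)))
  let Φ2 : ℝ → ℝ → ℝ := fun x t => -(4 * M1 * i ^ 2) - 4 * M1 * (e t * i ^ 2)
  let Φt : ℝ → ℝ → ℝ := fun x t => 2 * M1 * ((e t * (-(i ^ 2 / 2))) * (2 - (x - x1) ^ 2 * i ^ 2))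
  have he : ∀ t, HasDerivAt e (e t * (-(i ^ 2 / 2))) t := by
    intro t
    refine ((((hasDerivAt_id t).sub_const (t1 - η)).const_mul (-(i ^ 2 / 2))).exp).congr_deriv ?_
    simp [e]
  have hsub : ∀ x, HasDerivAt (fun y => y - x1) 1 x := fun x => (hasDerivAt_id x).sub_const x1
  -- bounds of pieces on the strip
  have hξ : ∀ x, a ≤ x → x ≤ b → 0 ≤ (x - x1) * i ∧ (x - x1) * i ≤ 1 := by
    intro x h1 h2
    refine ⟨mul_nonneg (by linarith) ip.le, ?_⟩
    calc (x - x1) * i ≤ η * i := by apply mul_le_mul_of_nonneg_right _ ip.le; linarith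
      _ = 1 := by rw [mul_comm]; exact iη
  have hparts : ∀ x t, a ≤ x → x ≤ b → 0 ≤ 2 * M1 * (2 * (x - x1) * i - (x - x1) ^ 2 * i ^ 2) ∧
      2 * M1 * e t ≤ 2 * M1 * (e t * (2 - (x - x1) ^ 2 * i ^ 2)) := by
    intro x t h1 h2
    obtain ⟨k1, k2⟩ := hξ x h1 h2
    constructor
    · have : 2 * (x - x1) * i - (x - x1) ^ 2 * i ^ 2 = ((x - x1) * i) * (2 - (x - x1) * i) := by ring
      rw [this]
      have : 0 ≤ 2 - (x - x1) * i := by linarith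
      positivity
    · have : (x - x1) ^ 2 * i ^ 2 ≤ 1 := by
        have : (x - x1) ^ 2 * i ^ 2 = ((x - x1) * i) ^ 2 := by ring
        rw [this]; exact pow_le_one₀ k1 k2
      apply mul_le_mul_of_nonneg_left _ (by positivity)
      have := mul_le_mul_of_nonneg_left (show 1 ≤ 2 - (x - x1) ^ 2 * i ^ 2 by linarith) (ep t).le
      linarith
  have hΦge : ∀ x t, a ≤ x → x ≤ b → V + 4 * (n * η) ≤ Φ x t := by
    intro x t h1 h2
    obtain ⟨k1, k2⟩ := hparts x t h1 h2
    have := mul_pos hM1 (ep t)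
    simp only [Φ]; linarith
  have main : w y s ≤ Φ y s := by
    refine rectMP (K := K) (a := a) (b := b) (c := c) (d := s) (M := 2 * M1) (v := w) (v1 := w1) (v2 := w2)
      (H := H) (Φ := Φ) (Φ1 := Φ1) (Φ2 := Φ2) (Φt := Φt) (by positivity) ?_ ?_ ?_ ?_ ?_ ?_ ?_ ?_ ?_ ?_ ?_ ?_ ?_
      hay' hyb' hcs' le_rfl
    · have : (b - a) ^ 2 ≤ η ^ 2 := by apply pow_le_pow_left₀ <;> linarith
      linarith
    · have := mul_le_mul_of_nonneg_left (show b - a ≤ η by linarith) (abs_nonneg K)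
      have : 0 ≤ |K| * η := by positivity
      linarith
    · intro x t h1 h2 h3 h4 pa pb
      have hq := hQ x t h1 h2 h3 h4
      refine hct x t hq (fun hmem => ?_)
      rcases h3.lt_or_eq with h | h
      · exact hTn t h h4 ⟨(x, t), ⟨hmem, hq⟩, rfl⟩
      · have ha' : a < x := by
          refine lt_of_le_of_ne h1 (fun h' => ?_)
          unfold Ed at pa; rw [← h, ← h'] at pa; simp at pa
        have hb' : x < b := by
          refine lt_of_le_of_ne h2 (fun h' => ?_)
          unfold Ed at pb; rw [← h, h'] at pb; simp at pb
        exact hXn x ha' hb' ⟨(x, t), ⟨hmem, hq⟩, rfl⟩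
    · intro x t h1 h2 h3 h4
      exact hsol x t (hQ x t h1.le h2.le h3.le h4)
    · simp only [Φ, e]; fun_prop
    · intro x t
      refine (((((((hsub x).const_mul 2).mul_const i).sub (((hsub x).pow 2).mul_const (i ^ 2))).const_mul (2 * M1)).const_add
        (V + 4 * (n * η))).add (((((((hsub x).pow 2).mul_const (i ^ 2))).const_sub 2).const_mul (e t)).const_mul (2 * M1))).congr_deriv ?_
      simp only [Φ1]; simp
    · intro x t
      refine ((((((hsub x).const_mul 2).mul_const (i ^ 2)).const_sub (2 * i)).const_mul (2 * M1)).add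
        ((((((hsub x).const_mul 2).mul_const (i ^ 2)).neg).const_mul (e t)).const_mul (2 * M1))).congr_deriv ?_
      simp only [Φ2]; ring
    · intro x t
      exact (((he t).mul_const (2 - (x - x1) ^ 2 * i ^ 2)).const_mul (2 * M1)).const_add _
    · intro x t h1 h2 h3 h4
      have hHle := (abs_le.1 (hH x t (hQ x t h1.le h2.le h3.le h4))).2
      have hM2' : M2 < 3 * M1 * i ^ 2 := by
        have : M2 = M2 * η ^ 2 * i ^ 2 := by
          have : η ^ 2 * i ^ 2 = 1 := by rw [← mul_pow, mul_comm, iη, one_pow]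
          rw [mul_assoc, this, mul_one]
        rw [this]
        exact mul_lt_mul_of_pos_right hM2 (by positivity)
      have hKi : 40 * |K| ≤ i := by
        have := mul_le_mul_of_nonneg_right hKη ip.le
        have h5 : 40 * (|K| * η) * i = 40 * |K| * (i * η) := by ring
        rw [h5, iη] at this; linarith
      obtain ⟨k1, k2⟩ := hξ x h1.le h2.le
      have et := ep t
      simp only [Φt, Φ2, Φ1]
      generalize e t = ee at *
      have hKb : K * (2 * M1 * (2 * i - 2 * (x - x1) * i ^ 2) + 2 * M1 * (ee * (-(2 * (x - x1) * i ^ 2))))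
          ≤ M1 * i ^ 2 / 10 * (1 + ee) := by
        have e1 : K * (2 * M1 * (2 * i - 2 * (x - x1) * i ^ 2) + 2 * M1 * (ee * (-(2 * (x - x1) * i ^ 2))))
          = K * (4 * M1 * i * ((1 - (x - x1) * i) - ee * ((x - x1) * i))) := by ring
        rw [e1]
        have e2 : |(1 - (x - x1) * i) - ee * ((x - x1) * i)| ≤ 1 + ee := by
          have := mul_nonneg et.le k1
          have := mul_le_mul_of_nonneg_left k2 et.le
          rw [abs_le]; constructor <;> linarith
        calc K * (4 * M1 * i * ((1 - (x - x1) * i) - ee * ((x - x1) * i)))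
            ≤ |K * (4 * M1 * i * ((1 - (x - x1) * i) - ee * ((x - x1) * i)))| := le_abs_self _
          _ = |K| * (4 * M1 * i * |(1 - (x - x1) * i) - ee * ((x - x1) * i)|) := by
            rw [abs_mul, abs_mul, abs_of_pos (show 0 < 4 * M1 * i by positivity)]
          _ ≤ (i / 40) * (4 * M1 * i * (1 + ee)) := by
            apply mul_le_mul (by linarith) _ (by positivity) (by positivity)
            gcongr
          _ = _ := by ring
      have p1 : 0 ≤ M1 * i ^ 2 := by positivity
      have p2 : 0 ≤ M1 * i ^ 2 * ee := by positivity
      have p3 : 0 ≤ M1 * ee * i ^ 2 * ((x - x1) ^ 2 * i ^ 2) := by positivity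
      linarith
    · intro x t h1 h2 h3 h4
      have := hΦge x t h1 h2
      have := (abs_le.1 (hw x t (hQ x t h1 h2 h3 h4))).2
      linarith [hVM.1]
    · intro t h3 h4
      exact (hX a haX t (hQ a t le_rfl (by linarith) h3 h4)).trans (hΦge a t le_rfl (by linarith))
    · intro t h3 h4
      have hq := hQ b t (by linarith) le_rfl h3 h4
      rcases hbX with h | h
      · exact (hX b h t hq).trans (hΦge b t (by linarith) le_rfl)
      · rw [mem_singleton_iff] at h
        obtain ⟨k1, k2⟩ := hparts b t (by linarith) le_rfl
        have k3 : (b - x1) * i = 1 := by rw [h, add_sub_cancel_left, mul_comm]; exact iη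
        have k4 : 2 * (b - x1) * i - (b - x1) ^ 2 * i ^ 2 = 1 := by
          have : 2 * (b - x1) * i - (b - x1) ^ 2 * i ^ 2 = 2 * ((b - x1) * i) - ((b - x1) * i) ^ 2 := by ring
          rw [this, k3]; norm_num
        have := mul_pos hM1 (ep t)
        have := (abs_le.1 (hw b t hq)).2
        simp only [Φ]
        rw [k4]
        linarith [hVM.1]
    · intro x h1 h2
      have hq := hQ x c h1 h2 le_rfl hcs
      rcases hcT with h | h
      · exact (hT c h x hq).trans (hΦge x c h1 h2)
      · rw [mem_singleton_iff] at h
        obtain ⟨k1, k2⟩ := hparts x c h1 h2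
        have : e c = 1 := by simp [e, h]
        rw [this] at k2
        have := (abs_le.1 (hw x c hq)).2
        simp only [Φ]
        simp only [‹e c = 1›]
        linarith [hVM.1]
  refine main.trans ?_
  have f1 : 2 * M1 * (2 * (y - x1) * i - (y - x1) ^ 2 * i ^ 2) ≤ 4 * (M1 * η) := by
    have : (y - x1) * i ≤ η := by
      calc (y - x1) * i ≤ η ^ 2 * i := by apply mul_le_mul_of_nonneg_right _ ip.le; linarith
        _ = η * (i * η) := by ring
        _ = η := by rw [iη, mul_one]
    have h2 := mul_le_mul_of_nonneg_left this hM1.le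
    have h3 : 0 ≤ M1 * ((y - x1) ^ 2 * i ^ 2) := by positivity
    linarith
  have f2 : 2 * M1 * (e s * (2 - (y - x1) ^ 2 * i ^ 2)) ≤ 16 * (M1 * η) := by
    have h1 : e s ≤ 4 * η := by
      have h2 : -(i ^ 2 / 2) * (s - (t1 - η)) ≤ -(i / 4) := by
        have : i / 4 = i ^ 2 / 2 * (η / 2) := by
          calc i / 4 = i / 4 * (i * η) := by rw [iη, mul_one]
            _ = _ := by ring
        have h3 := mul_le_mul_of_nonneg_left (show η / 2 ≤ s - (t1 - η) by linarith) (show 0 ≤ i ^ 2 / 2 by positivity)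
        linarith
      calc e s ≤ exp (-(i / 4)) := Real.exp_le_exp.2 h2
        _ = (exp (i / 4))⁻¹ := Real.exp_neg _
        _ ≤ (i / 4)⁻¹ := by
          apply inv_anti₀ (by positivity)
          linarith [Real.add_one_le_exp (i / 4)]
        _ = 4 * η := by rw [hi]; field_simp
    have h4 : e s * (2 - (y - x1) ^ 2 * i ^ 2) ≤ e s * 2 := by
      apply mul_le_mul_of_nonneg_left _ (ep s).le
      have : 0 ≤ (y - x1) ^ 2 * i ^ 2 := by positivity
      linarith
    have h5 := mul_le_mul_of_nonneg_left (h4.trans (by linarith : e s * 2 ≤ 8 * η)) (show 0 ≤ 2 * M1 by positivity)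
    linarith
  simp only [Φ]
  linarith
end RS
end
open Real Set
noncomputable section
namespace RS
open Filter Topology

structure Grid (K n M1 M2 η x1 t1 : ℝ) (B : Set (ℝ × ℝ)) (w w1 w2 H : ℝ → ℝ → ℝ) : Prop where
  hz1 : (x1, t1) ∈ B
  hB : IsCompact (B ∩ {z | InQ (x1, t1) η z.1 z.2})
  hsol : ∀ x t, InQ (x1, t1) η x t → SolAt K w w1 w2 H x t
  hw : ∀ x t, InQ (x1, t1) η x t → |w x t| ≤ M1
  hH : ∀ x t, InQ (x1, t1) η x t → |H x t| ≤ M2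
  hct : ∀ x t, InQ (x1, t1) η x t → (x, t) ∉ B → ContinuousAt (fun z : ℝ × ℝ => w z.1 z.2) (x, t)
  hcol : ∀ x t, InQ (x1, t1) η x t → (x, t) ∈ B →
      (∀ s, |s - t1| ≤ η → |w x s - w x t| ≤ n * |s - t|) ∧
      (∀ y, |y - x1| ≤ η → |w y t - w x t| ≤ n * |y - x|)

lemma Grid.neg {K n M1 M2 η x1 t1 : ℝ} {B : Set (ℝ × ℝ)} {w w1 w2 H : ℝ → ℝ → ℝ}
    (g : Grid K n M1 M2 η x1 t1 B w w1 w2 H) :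
    Grid K n M1 M2 η x1 t1 B (fun x t => -w x t) (fun x t => -w1 x t) (fun x t => -w2 x t) (fun x t => -H x t) where
  hz1 := g.hz1
  hB := g.hB
  hsol x t h := by
    obtain ⟨a, b, c⟩ := g.hsol x t h
    exact ⟨a.neg, b.neg, c.neg.congr_deriv (by ring)⟩
  hw x t h := by rw [abs_neg]; exact g.hw x t h
  hH x t h := by rw [abs_neg]; exact g.hH x t h
  hct x t h h' := (g.hct x t h h').neg
  hcol x t h h' := by
    refine ⟨fun s hs => ?_, fun y hy => ?_⟩
    · rw [show -w x s - -w x t = -(w x s - w x t) by ring, abs_neg]; exact (g.hcol x t h h').1 s hs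
    · rw [show -w y t - -w x t = -(w y t - w x t) by ring, abs_neg]; exact (g.hcol x t h h').2 y hy

lemma hasDerivAt_refl {f : ℝ → ℝ} {c x : ℝ} (h : HasDerivAt f c (-x)) : HasDerivAt (fun y => f (-y)) (-c) x := by
  refine (HasDerivAt.comp x h (hasDerivAt_neg x)).congr_deriv ?_
  ring

lemma Grid.refl {K n M1 M2 η x1 t1 : ℝ} {B : Set (ℝ × ℝ)} {w w1 w2 H : ℝ → ℝ → ℝ}
    (g : Grid K n M1 M2 η x1 t1 B w w1 w2 H) :
    Grid (-K) n M1 M2 η (-x1) t1 {z | (-z.1, z.2) ∈ B} (fun x t => w (-x) t) (fun x t => -w1 (-x) t)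
      (fun x t => w2 (-x) t) (fun x t => H (-x) t) := by
  have ab : ∀ x y : ℝ, |x - -y| = |-x - y| := fun x y => by
    rw [show x - -y = -(-x - y) by ring, abs_neg]
  have q : ∀ x t, InQ (-x1, t1) η x t → InQ (x1, t1) η (-x) t := by
    intro x t h
    exact ⟨by have := h.1; simp only at this ⊢; rwa [ab] at this, h.2⟩
  refine ⟨?_, ?_, ?_, ?_, ?_, ?_, ?_⟩
  · simpa using g.hz1
  · have := g.hB.image (f := fun z : ℝ × ℝ => ((-z.1, z.2) : ℝ × ℝ)) (by fun_prop)
    convert this using 1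
    ext ⟨x, t⟩
    simp only [mem_inter_iff, mem_ofPred_eq, mem_image, Prod.exists, Prod.mk.injEq]
    constructor
    · rintro ⟨h1, h2⟩
      exact ⟨-x, t, ⟨h1, q x t h2⟩, by simp, rfl⟩
    · rintro ⟨y, s, ⟨h1, h2⟩, rfl, rfl⟩
      refine ⟨by simpa using h1, ?_, h2.2⟩
      have := h2.1
      simp only at this ⊢
      rw [ab, neg_neg]; exact this
  · intro x t h
    obtain ⟨a, b, c⟩ := g.hsol _ t (q x t h)
    refine ⟨hasDerivAt_refl a, (hasDerivAt_refl b).neg.congr_deriv (by ring), c.congr_deriv (by ring)⟩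
  · intro x t h; exact g.hw _ t (q x t h)
  · intro x t h; exact g.hH _ t (q x t h)
  · intro x t h h'
    have h1 := g.hct _ t (q x t h) h'
    exact ContinuousAt.comp (f := fun z : ℝ × ℝ => ((-z.1, z.2) : ℝ × ℝ)) (x := (x, t)) h1 (by fun_prop)
  · intro x t h h'
    have h1 := g.hcol _ t (q x t h) h'
    refine ⟨h1.1, fun y hy => ?_⟩
    have := h1.2 (-y) (by rwa [ab] at hy)
    rwa [show -y - -x = -(y - x) by ring, abs_neg] at this

lemma Grid.up {K n M1 M2 η x1 t1 : ℝ} {B : Set (ℝ × ℝ)} {w w1 w2 H : ℝ → ℝ → ℝ}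
    (g : Grid K n M1 M2 η x1 t1 B w w1 w2 H)
    (hη : 0 < η) (hη1 : η ≤ 1 / 100) (hKη : 40 * (|K| * η) ≤ 1) (hM1 : 0 < M1) (hM2 : M2 * η ^ 2 < 3 * M1)
    (hn : 0 ≤ n) {y s : ℝ} (hy : |y - x1| ≤ η ^ 2) (hs : |s - t1| ≤ η / 2) :
    w y s ≤ w x1 t1 + (4 * n + 20 * M1) * η := by
  rw [abs_le] at hy hs
  rcases le_total x1 y with h | h
  · exact sideUp hη hη1 hKη hM1 hM2 hn g.hz1 g.hB g.hsol g.hw g.hH g.hct g.hcol h (by linarith) (by linarith) (by linarith)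
  · have g' := g.refl
    have := sideUp (y := -y) (s := s) hη hη1 (by rwa [abs_neg]) hM1 hM2 hn g'.hz1 g'.hB g'.hsol g'.hw g'.hH g'.hct g'.hcol
      (by linarith) (by linarith) (by linarith) (by linarith)
    simpa only [neg_neg] using this

lemma Grid.abs {K n M1 M2 η x1 t1 : ℝ} {B : Set (ℝ × ℝ)} {w w1 w2 H : ℝ → ℝ → ℝ}
    (g : Grid K n M1 M2 η x1 t1 B w w1 w2 H)
    (hη : 0 < η) (hη1 : η ≤ 1 / 100) (hKη : 40 * (|K| * η) ≤ 1) (hM1 : 0 < M1) (hM2 : M2 * η ^ 2 < 3 * M1)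
    (hn : 0 ≤ n) {y s : ℝ} (hy : |y - x1| ≤ η ^ 2) (hs : |s - t1| ≤ η / 2) :
    |w y s - w x1 t1| ≤ (4 * n + 20 * M1) * η := by
  have h1 := g.up hη hη1 hKη hM1 hM2 hn hy hs
  have h2 := g.neg.up hη hη1 hKη hM1 hM2 hn hy hs
  rw [abs_le]; constructor <;> linarith

/-- continuity at the points of `B`, from the grid structure at all small scales -/
lemma cont_of_grid {K n M1 M2 η0 x1 t1 : ℝ} {B : Set (ℝ × ℝ)} {w w1 w2 H : ℝ → ℝ → ℝ}
    (hη0 : 0 < η0) (hM1 : 0 < M1) (hn : 0 ≤ n)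
    (g : ∀ η, 0 < η → η ≤ η0 → Grid K n M1 M2 η x1 t1 B w w1 w2 H) :
    ContinuousAt (fun z : ℝ × ℝ => w z.1 z.2) (x1, t1) := by
  rw [Metric.continuousAt_iff]
  intro ε hε
  have hL : 0 < 4 * n + 20 * M1 := by positivity
  have ev : ∀ᶠ η in 𝓝[>] (0:ℝ), 0 < η ∧ η ≤ η0 ∧ η ≤ 1 / 100 ∧ 40 * (|K| * η) ≤ 1 ∧ M2 * η ^ 2 < 3 * M1 ∧
      (4 * n + 20 * M1) * η < ε := by
    have e0 : ∀ᶠ η in 𝓝[>] (0:ℝ), 0 < η := self_mem_nhdsWithin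
    have c1 : ∀ᶠ η in 𝓝 (0:ℝ), η < η0 := gt_mem_nhds hη0
    have c2 : ∀ᶠ η in 𝓝 (0:ℝ), η < 1 / 100 := gt_mem_nhds (by norm_num)
    have c3 : ∀ᶠ η in 𝓝 (0:ℝ), 40 * (|K| * η) < 1 :=
      (show ContinuousAt (fun η => 40 * (|K| * η)) 0 by fun_prop).tendsto.eventually (gt_mem_nhds (by simp))
    have c4 : ∀ᶠ η in 𝓝 (0:ℝ), M2 * η ^ 2 < 3 * M1 :=
      (show ContinuousAt (fun η => M2 * η ^ 2) 0 by fun_prop).tendsto.eventually (gt_mem_nhds (by simp; exact hM1))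
    have c5 : ∀ᶠ η in 𝓝 (0:ℝ), (4 * n + 20 * M1) * η < ε :=
      (show ContinuousAt (fun η => (4 * n + 20 * M1) * η) 0 by fun_prop).tendsto.eventually (gt_mem_nhds (by simp; exact hε))
    filter_upwards [e0, nhdsWithin_le_nhds c1, nhdsWithin_le_nhds c2, nhdsWithin_le_nhds c3, nhdsWithin_le_nhds c4,
      nhdsWithin_le_nhds c5] with η h0 h1 h2 h3 h4 h5
    exact ⟨h0, h1.le, h2.le, h3.le, h4, h5⟩
  obtain ⟨η, h0, h1, h2, h3, h4, h5⟩ := ev.exists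
  refine ⟨min (η ^ 2) (η / 2), by positivity, ?_⟩
  rintro ⟨y, s⟩ hd
  rw [Prod.dist_eq, max_lt_iff, lt_min_iff, lt_min_iff] at hd
  simp only [Real.dist_eq] at hd ⊢
  exact lt_of_le_of_lt ((g η h0 h1).abs h0 h2 h3 hM1 h4 hn hd.1.1.le hd.2.2.le) h5

/-- the Lipschitz condition along the coordinate lines at a point -/
def LipPt (Ω : Set (ℝ × ℝ)) (v : ℝ → ℝ → ℝ) (n : ℝ) (z : ℝ × ℝ) : Prop :=
  (∀ s, |s - z.2| < 1 / n → (z.1, s) ∈ Ω → |v z.1 s - v z.1 z.2| ≤ n * |s - z.2|) ∧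
  (∀ y, |y - z.1| < 1 / n → (y, z.2) ∈ Ω → |v y z.2 - v z.1 z.2| ≤ n * |y - z.1|)

lemma lip_of_deriv {f : ℝ → ℝ} {c x : ℝ} (h : HasDerivAt f c x) :
    ∀ᶠ n : ℕ in atTop, ∀ y, |y - x| < 1 / ((n:ℝ) + 1) → |f y - f x| ≤ ((n:ℝ) + 1) * |y - x| := by
  obtain ⟨C, hC⟩ := h.differentiableAt.isBigO_sub.bound
  obtain ⟨δ, hδ, hb⟩ := Metric.eventually_nhds_iff.1 hC
  obtain ⟨n0, hn0⟩ := exists_nat_gt (max C (1 / δ))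
  filter_upwards [eventually_ge_atTop n0] with n hn y hy
  have hn' : (n0 : ℝ) ≤ n := by exact_mod_cast hn
  have h1 : C ≤ (n:ℝ) + 1 := by linarith [le_max_left C (1 / δ)]
  have h2 : 1 / δ ≤ (n:ℝ) + 1 := by linarith [le_max_right C (1 / δ)]
  have h3 : 1 / ((n:ℝ) + 1) ≤ δ := by
    rw [div_le_iff₀ hδ] at h2
    rw [div_le_iff₀ (by positivity)]; linarith
  have := hb (y := y) (by rw [Real.dist_eq]; linarith)
  simp only [Real.norm_eq_abs] at this
  exact this.trans (by gcongr)

set_option maxHeartbeats 1000000 in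
lemma baire_step {Ω B : Set (ℝ × ℝ)} (hΩ : IsOpen Ω) (hBΩ : B ⊆ Ω) (hΩB : IsOpen (Ω \ B)) (hne : B.Nonempty)
    {v vx vt : ℝ → ℝ → ℝ} (hx : ∀ z ∈ Ω, HasDerivAt (fun y => v y z.2) (vx z.1 z.2) z.1)
    (ht : ∀ z ∈ Ω, HasDerivAt (fun s => v z.1 s) (vt z.1 z.2) z.2) :
    ∃ z0 ∈ B, ∃ n r : ℝ, 0 < n ∧ 0 < r ∧ ∀ z ∈ B, InQ z0 r z.1 z.2 → LipPt Ω v n z := by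
  have hBeq : B = Ω ∩ (Ω \ B)ᶜ := by
    ext z; constructor
    · intro h; exact ⟨hBΩ h, fun h' => h'.2 h⟩
    · rintro ⟨h1, h2⟩; by_contra h3; exact h2 ⟨h1, h3⟩
  have hlc : IsLocallyClosed B := by rw [hBeq]; exact hΩ.isLocallyClosed.inter hΩB.isClosed_compl.isLocallyClosed
  haveI : LocallyCompactSpace B := hlc.locallyCompactSpace
  haveI : Nonempty B := hne.to_subtype
  let S : ℕ → Set B := fun n => {z | LipPt Ω v ((n:ℝ) + 1) z.1}
  have hcl : ∀ n, IsClosed (S n) := by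
    intro n
    have np : (0:ℝ) < (n:ℝ) + 1 := by positivity
    apply IsSeqClosed.isClosed
    intro zk z hk hlim
    have hl : Tendsto (fun k => (zk k).1) atTop (𝓝 z.1) := (continuous_subtype_val.tendsto z).comp hlim
    have hl1 : Tendsto (fun k => (zk k).1.1) atTop (𝓝 z.1.1) := (continuous_fst.tendsto _).comp hl
    have hl2 : Tendsto (fun k => (zk k).1.2) atTop (𝓝 z.1.2) := (continuous_snd.tendsto _).comp hl
    have hzΩ := hBΩ z.2
    have cx : ∀ y s, (y, s) ∈ Ω → ∀ {a : ℕ → ℝ}, Tendsto a atTop (𝓝 y) → Tendsto (fun k => v (a k) s) atTop (𝓝 (v y s)) :=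
      fun y s h a ha => ((hx (y, s) h).continuousAt.tendsto).comp ha
    have ct : ∀ y s, (y, s) ∈ Ω → ∀ {a : ℕ → ℝ}, Tendsto a atTop (𝓝 s) → Tendsto (fun k => v y (a k)) atTop (𝓝 (v y s)) :=
      fun y s h a ha => ((ht (y, s) h).continuousAt.tendsto).comp ha
    have evx : ∀ y s, (y, s) ∈ Ω → ∀ {a : ℕ → ℝ}, Tendsto a atTop (𝓝 y) → ∀ᶠ k in atTop, (a k, s) ∈ Ω :=
      fun y s h a ha => (ha.prodMk_nhds tendsto_const_nhds).eventually (hΩ.mem_nhds h)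
    have evt : ∀ y s, (y, s) ∈ Ω → ∀ {a : ℕ → ℝ}, Tendsto a atTop (𝓝 s) → ∀ᶠ k in atTop, (y, a k) ∈ Ω :=
      fun y s h a ha => (tendsto_const_nhds.prodMk_nhds ha).eventually (hΩ.mem_nhds h)
    have absl : ∀ (s c : ℝ) {a : ℕ → ℝ}, Tendsto a atTop (𝓝 c) → Tendsto (fun k => |s - a k|) atTop (𝓝 |s - c|) :=
      fun s c a ha => (tendsto_const_nhds.sub ha).abs
    -- values along the sequence converge
    have hval : Tendsto (fun k => v (zk k).1.1 (zk k).1.2) atTop (𝓝 (v z.1.1 z.1.2)) := by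
      have h1 := cx z.1.1 z.1.2 hzΩ hl1
      have h2 : Tendsto (fun k => ((n:ℝ) + 1) * |z.1.2 - (zk k).1.2|) atTop (𝓝 0) := by
        have := (absl z.1.2 z.1.2 hl2).const_mul ((n:ℝ) + 1)
        simpa using this
      have h3 : Tendsto (fun k => v (zk k).1.1 z.1.2 - v (zk k).1.1 (zk k).1.2) atTop (𝓝 0) := by
        refine squeeze_zero_norm' ?_ h2
        have e1 : ∀ᶠ k in atTop, |z.1.2 - (zk k).1.2| < 1 / ((n:ℝ) + 1) :=
          (absl z.1.2 z.1.2 hl2).eventually (gt_mem_nhds (by simp; positivity))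
        filter_upwards [e1, evx _ _ hzΩ hl1] with k h4 h5
        exact (hk k).1 _ h4 h5
      have := h1.sub h3
      simpa using this
    refine ⟨fun s hs hsΩ => ?_, fun y hy hyΩ => ?_⟩
    · have h1 := cx z.1.1 s hsΩ hl1
      refine le_of_tendsto_of_tendsto ((h1.sub hval).abs) ((absl s z.1.2 hl2).const_mul _) ?_
      filter_upwards [(absl s z.1.2 hl2).eventually (gt_mem_nhds hs), evx _ _ hsΩ hl1] with k h4 h5
      exact (hk k).1 _ h4 h5
    · have h1 := ct y z.1.2 hyΩ hl2
      refine le_of_tendsto_of_tendsto ((h1.sub hval).abs) ((absl y z.1.1 hl1).const_mul _) ?_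
      filter_upwards [(absl y z.1.1 hl1).eventually (gt_mem_nhds hy), evt _ _ hyΩ hl2] with k h4 h5
      exact (hk k).2 _ h4 h5
  have hun : ⋃ n, S n = univ := by
    rw [eq_univ_iff_forall]
    intro z
    have hz := hBΩ z.2
    obtain ⟨n, h1, h2⟩ := ((lip_of_deriv (hx z.1 hz)).and (lip_of_deriv (ht z.1 hz))).exists
    rw [mem_iUnion]
    exact ⟨n, fun s hs _ => h2 s hs, fun y hy _ => h1 y hy⟩
  obtain ⟨n, z, hz⟩ := nonempty_interior_of_iUnion_of_closed hcl hun
  rw [mem_interior_iff_mem_nhds, nhds_subtype_eq_comap, mem_comap] at hz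
  obtain ⟨U, hU, hUS⟩ := hz
  obtain ⟨ε, hε, hball⟩ := Metric.mem_nhds_iff.1 hU
  refine ⟨z.1, z.2, (n:ℝ) + 1, ε / 2, by positivity, by positivity, fun y hy hq => ?_⟩
  have : (⟨y, hy⟩ : B) ∈ S n := hUS (by
    apply hball
    rw [Metric.mem_ball, Prod.dist_eq, max_lt_iff, Real.dist_eq, Real.dist_eq]
    exact ⟨lt_of_le_of_lt hq.1 (by linarith), lt_of_le_of_lt hq.2 (by linarith)⟩)
  exact this
end RS
end
open Real Set
noncomputable section
namespace RS
open Filter Topology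

lemma inQ_compact (c : ℝ × ℝ) (r : ℝ) : IsCompact {z : ℝ × ℝ | InQ c r z.1 z.2} := by
  have : {z : ℝ × ℝ | InQ c r z.1 z.2} = Metric.closedBall c.1 r ×ˢ Metric.closedBall c.2 r := by
    ext z
    simp only [mem_ofPred_eq, mem_prod, Metric.mem_closedBall, Real.dist_eq, InQ]
  rw [this]
  exact (isCompact_closedBall _ _).prod (isCompact_closedBall _ _)

set_option maxHeartbeats 1000000 in
/-- bound near a point of the singular set -/
lemma bound_near {K lam p : ℝ} (hp : 1 < p) {G B Ω : Set (ℝ × ℝ)} (hG : IsOpen G)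
    {v v1 v2 : ℝ → ℝ → ℝ} (hs : SolOn K G v v1 v2 (fun x t => FF lam p (v x t)))
    (hpos : ∀ z ∈ G, 0 < v z.1 z.2) (hc : CtOn G v) {z0 : ℝ × ℝ} (hz0 : z0 ∈ B) {n r : ℝ} (hn : 0 < n)
    (hr : 0 < r) (hr1 : r ≤ 1 / 100) (hnr : 2 * r < 1 / n)
    (hQ : ∀ x t, InQ z0 r x t → (x, t) ∈ Ω) (hGB : ∀ x t, (x, t) ∈ Ω → (x, t) ∉ B → (x, t) ∈ G)
    (hcB : IsCompact (B ∩ {z : ℝ × ℝ | InQ z0 r z.1 z.2})) (hv0 : 0 < v z0.1 z0.2)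
    (hL : ∀ z ∈ B, InQ z0 r z.1 z.2 → LipPt Ω v n z) :
    ∃ M, 0 < M ∧ ∀ x t, InQ z0 (r / 4) x t → v x t ≤ M := by
  obtain ⟨C, hC, har⟩ := harnack hp K lam
  set D := B ∩ {z : ℝ × ℝ | InQ z0 r z.1 z.2} with hD
  have hz0Q : InQ z0 r z0.1 z0.2 := inQ_self z0 hr
  have hz0D : z0 ∈ D := ⟨hz0, hz0Q⟩
  have tri : ∀ a b c : ℝ, |a - c| ≤ r → |b - c| ≤ r → |a - b| < 1 / n ∧ |a - b| ≤ 2 * r := by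
    intro a b c h1 h2
    rw [abs_le] at h1 h2
    have : |a - b| ≤ 2 * r := by rw [abs_le]; constructor <;> linarith
    exact ⟨by linarith, this⟩
  -- column and row estimates
  have colL : ∀ z ∈ D, ∀ s, |s - z0.2| ≤ r → |v z.1 s - v z.1 z.2| ≤ n * (2 * r) := by
    intro z hz s hs'
    have h := tri s z.2 z0.2 hs' hz.2.2
    exact ((hL z hz.1 hz.2).1 s h.1 (hQ _ _ ⟨hz.2.1, hs'⟩)).trans (by gcongr; exact h.2)
  have rowL : ∀ z ∈ D, ∀ y, |y - z0.1| ≤ r → |v y z.2 - v z.1 z.2| ≤ n * (2 * r) := by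
    intro z hz s hs'
    have h := tri s z.1 z0.1 hs' hz.2.1
    exact ((hL z hz.1 hz.2).2 s h.1 (hQ _ _ ⟨hs', hz.2.2⟩)).trans (by gcongr; exact h.2)
  obtain ⟨M0, hM0⟩ : ∃ M0, M0 = v z0.1 z0.2 + 6 * (n * r) := ⟨_, rfl⟩
  have hM0p : 0 < M0 := by rw [hM0]; positivity
  have colB : ∀ z ∈ D, ∀ s, |s - z0.2| ≤ r → v z.1 s ≤ M0 := by
    intro z hz s hs'
    have h1 := colL z hz s hs'
    have h2 := colL z hz z0.2 hz0Q.2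
    have h3 := rowL z0 hz0D z.1 hz.2.1
    rw [abs_le] at h1 h2 h3
    linarith [h1.2, h2.1, h3.2]
  have rowB : ∀ z ∈ D, ∀ y, |y - z0.1| ≤ r → v y z.2 ≤ M0 := by
    intro z hz s hs'
    have h1 := rowL z hz s hs'
    have h2 := rowL z hz z0.1 hz0Q.1
    have h3 := colL z0 hz0D z.2 hz.2.2
    rw [abs_le] at h1 h2 h3
    linarith [h1.2, h2.1, h3.2]
  have C0 : 0 < C := by linarith
  have hCM : C * M0 ≤ C * (C * M0) := by
    have : 0 < C * M0 := by positivity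
    nlinarith
  have hCM' : M0 ≤ C * M0 := by nlinarith
  refine ⟨C * (C * M0), by positivity, fun x t hxt => ?_⟩
  have hx := abs_le.1 hxt.1
  have ht := abs_le.1 hxt.2
  by_cases hxX : ∃ z ∈ D, z.1 = x
  · obtain ⟨z, hz, rfl⟩ := hxX
    exact (colB z hz t (by rw [abs_le]; constructor <;> linarith)).trans (by linarith)
  push Not at hxX
  -- nearest column
  obtain ⟨zm, hzm, hmin⟩ := hcB.exists_isMinOn ⟨z0, hz0D⟩ (f := fun z => |z.1 - x|) (by fun_prop)
  obtain ⟨ρ, hρ⟩ : ∃ ρ, ρ = |zm.1 - x| := ⟨_, rfl⟩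
  have hρ0 : 0 < ρ := by
    rw [hρ, abs_pos, sub_ne_zero]; exact hxX zm hzm
  have hnear : ∀ z ∈ D, ρ ≤ |z.1 - x| := fun z hz => by rw [hρ]; exact hmin hz
  have hρr : ρ ≤ r / 4 := by
    refine (hnear z0 hz0D).trans ?_
    rw [abs_sub_comm]; exact hxt.1
  have hρ2 : ρ ^ 2 ≤ r / 1600 := by nlinarith
  have hρ2p : 0 < ρ ^ 2 := by positivity
  have hzx : zm.1 - x ≤ ρ ∧ -ρ ≤ zm.1 - x := by
    have : |zm.1 - x| ≤ ρ := hρ.ge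
    rw [abs_le] at this; exact ⟨this.2, this.1⟩
  -- column strip
  have strip : ∀ y s, |y - x| ≤ 2 * (ρ / 3) → |s - z0.2| ≤ r → (y, s) ∈ G := by
    intro y s hy hs'
    have hy' := abs_le.1 hy
    have q : InQ z0 r y s := ⟨by rw [abs_le]; constructor <;> linarith, hs'⟩
    refine hGB y s (hQ _ _ q) (fun hb => ?_)
    have := hnear (y, s) ⟨hb, q⟩
    simp only at this
    linarith
  by_cases hT : ∃ z ∈ D, t ≤ z.2 ∧ z.2 ≤ t + 10 * ρ ^ 2
  · obtain ⟨z, hz, h1, h2⟩ := hT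
    have h := har hG hs hpos hc (a := x) (x := x) (t1 := t) (t2 := z.2) (ρ := ρ / 3) (by positivity) (by linarith)
      (fun y s hy h3 h4 => strip y s hy (by rw [abs_le]; constructor <;> nlinarith))
      (by simp; positivity) (by simpa using h1) (by nlinarith)
    have h' := rowB z hz x (by rw [abs_le]; constructor <;> linarith)
    calc v x t ≤ C * v x z.2 := h
      _ ≤ C * M0 := by gcongr
      _ ≤ _ := hCM
  · push Not at hT
    have h := har hG hs hpos hc (a := x) (x := x) (t1 := t) (t2 := t + 4 * ρ ^ 2) (ρ := ρ / 3) (by positivity) (by linarith)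
      (fun y s hy h3 h4 => strip y s hy (by rw [abs_le]; constructor <;> nlinarith))
      (by simp; positivity) (by nlinarith) (by nlinarith)
    have h2 := har hG hs hpos hc (a := zm.1) (x := x) (t1 := t + 4 * ρ ^ 2) (t2 := t + 6 * ρ ^ 2) (ρ := ρ) hρ0 (by linarith)
      (fun y s hy h3 h4 => by
        have hy' := abs_le.1 hy
        have q : InQ z0 r y s := ⟨by rw [abs_le]; constructor <;> linarith, by rw [abs_le]; constructor <;> linarith⟩
        refine hGB y s (hQ _ _ q) (fun hb => ?_)
        have := hT (y, s) ⟨hb, q⟩ (by simp only; linarith)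
        simp only at this
        linarith)
      (by rw [abs_le]; constructor <;> linarith) (by nlinarith) (by nlinarith)
    have h3 := colB zm hzm (t + 6 * ρ ^ 2) (by rw [abs_le]; constructor <;> linarith)
    calc v x t ≤ C * v x (t + 4 * ρ ^ 2) := h
      _ ≤ C * (C * v zm.1 (t + 6 * ρ ^ 2)) := by gcongr
      _ ≤ C * (C * M0) := by gcongr

set_option maxHeartbeats 1000000 in
/-- separately regular positive solutions are jointly continuous -/
lemma joint_cont {K lam p : ℝ} (hp : 1 < p) {Ω : Set (ℝ × ℝ)} (hΩ : IsOpen Ω)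
    {v v1 v2 : ℝ → ℝ → ℝ} (hs : SolOn K Ω v v1 v2 (fun x t => FF lam p (v x t)))
    (hpos : ∀ z ∈ Ω, 0 < v z.1 z.2) : CtOn Ω v := by
  set f : ℝ × ℝ → ℝ := fun z => v z.1 z.2 with hf
  set G : Set (ℝ × ℝ) := interior {z | z ∈ Ω ∧ ContinuousAt f z} with hGdef
  have hG : IsOpen G := isOpen_interior
  have hGs : ∀ z ∈ G, z ∈ Ω ∧ ContinuousAt f z := fun z hz => by have h := interior_subset hz; exact h
  have hcG : CtOn G v := fun z hz => (hGs z hz).2.continuousWithinAt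
  set B := Ω \ G with hB
  rcases B.eq_empty_or_nonempty with hE | hne
  · intro z hz
    have : z ∈ G := by by_contra h; exact (hE ▸ (⟨hz, h⟩ : z ∈ B) : z ∈ (∅ : Set _))
    exact (hGs z this).2.continuousWithinAt
  exfalso
  have hΩB : IsOpen (Ω \ B) := by
    have : Ω \ B = G := by
      rw [hB, sdiff_sdiff_cancel_left]; exact fun z hz => (hGs z hz).1
    rw [this]; exact hG
  obtain ⟨z0, hz0, n, r', hn, hr', hL'⟩ := baire_step (v := v) (vx := v1)
    (vt := fun x t => v2 x t + K * v1 x t + FF lam p (v x t)) hΩ sdiff_subset hΩB hne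
    (fun z hz => (hs z hz).1) (fun z hz => (hs z hz).2.2)
  obtain ⟨ε, hε, hball⟩ := Metric.isOpen_iff.1 hΩ z0 hz0.1
  obtain ⟨r, hr⟩ : ∃ r, r = min (min r' (ε / 2)) (min (1 / 100) (1 / (4 * n))) := ⟨_, rfl⟩
  have hr0 : 0 < r := by rw [hr]; positivity
  have r1 : r ≤ r' := by rw [hr]; exact (min_le_left _ _).trans (min_le_left _ _)
  have r2 : r ≤ ε / 2 := by rw [hr]; exact (min_le_left _ _).trans (min_le_right _ _)
  have r3 : r ≤ 1 / 100 := by rw [hr]; exact (min_le_right _ _).trans (min_le_left _ _)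
  have r4 : r ≤ 1 / (4 * n) := by rw [hr]; exact (min_le_right _ _).trans (min_le_right _ _)
  have hnr : 2 * r < 1 / n := by
    have : 1 / (4 * n) = (1 / n) / 4 := by field_simp
    have : 0 < 1 / n := by positivity
    linarith
  have hQ : ∀ x t, InQ z0 r x t → (x, t) ∈ Ω := by
    intro x t h
    apply hball
    rw [Metric.mem_ball, Prod.dist_eq, max_lt_iff, Real.dist_eq, Real.dist_eq]
    exact ⟨lt_of_le_of_lt h.1 (by linarith), lt_of_le_of_lt h.2 (by linarith)⟩
  have hcp : ∀ (c : ℝ × ℝ) (ρ : ℝ), (∀ x t, InQ c ρ x t → (x, t) ∈ Ω) →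
      IsCompact (B ∩ {z : ℝ × ℝ | InQ c ρ z.1 z.2}) := by
    intro c ρ h
    have : B ∩ {z : ℝ × ℝ | InQ c ρ z.1 z.2} = {z : ℝ × ℝ | InQ c ρ z.1 z.2} \ G := by
      ext z
      constructor
      · rintro ⟨h1, h2⟩; exact ⟨h2, h1.2⟩
      · rintro ⟨h1, h2⟩; exact ⟨⟨h _ _ h1, h2⟩, h1⟩
    rw [this]
    exact (inQ_compact c ρ).diff hG
  have hL : ∀ z ∈ B, InQ z0 r z.1 z.2 → LipPt Ω v n z := fun z hz hq => hL' z hz (hq.mono r1)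
  have hGB : ∀ x t, (x, t) ∈ Ω → (x, t) ∉ B → (x, t) ∈ G := by
    intro x t h1 h2; by_contra h3; exact h2 ⟨h1, h3⟩
  obtain ⟨M, hM, hbd⟩ := bound_near hp hG (fun z hz => hs z (hGs z hz).1) (fun z hz => hpos z (hGs z hz).1) hcG
    hz0 hn hr0 r3 hnr hQ hGB (hcp z0 r hQ) (hpos z0 hz0.1) hL
  have hzG : z0 ∈ G := by
    rw [hGdef, mem_interior_iff_mem_nhds]
    filter_upwards [inQ_nhds z0 (show 0 < r / 8 by positivity)] with z1 hz1
    have hz1Ω : z1 ∈ Ω := hQ _ _ (hz1.mono (by linarith))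
    refine ⟨hz1Ω, ?_⟩
    by_cases hb : z1 ∈ B
    swap
    · exact (hGs z1 (hGB _ _ hz1Ω hb)).2
    refine cont_of_grid (K := K) (n := n) (M1 := M) (M2 := |lam| * M + M ^ p) (η0 := r / 8) (B := B)
      (w1 := v1) (w2 := v2) (H := fun x t => FF lam p (v x t)) (by positivity) hM hn.le ?_
    intro η h0 h1
    have sub : ∀ x t, InQ (z1.1, z1.2) η x t → InQ z0 (r / 4) x t := by
      intro x t h
      have a1 := abs_le.1 h.1
      have a2 := abs_le.1 h.2
      have b1 := abs_le.1 hz1.1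
      have b2 := abs_le.1 hz1.2
      simp only at a1 a2
      constructor <;> (rw [abs_le]; constructor <;> linarith)
    have subr : ∀ x t, InQ (z1.1, z1.2) η x t → InQ z0 r x t := fun x t h => (sub x t h).mono (by linarith)
    have vb : ∀ x t, InQ (z1.1, z1.2) η x t → |v x t| ≤ M := by
      intro x t h
      rw [abs_of_pos (hpos (x, t) (hQ _ _ (subr x t h)))]
      exact hbd x t (sub x t h)
    refine ⟨hb, hcp _ _ (fun x t h => hQ _ _ (subr x t h)), fun x t h => hs (x, t) (hQ _ _ (subr x t h)), vb, ?_, ?_, ?_⟩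
    · intro x t h
      have hv := hpos (x, t) (hQ _ _ (subr x t h))
      simp only at hv
      have hv2 := hbd x t (sub x t h)
      simp only [FF]
      refine (abs_add_le _ _).trans ?_
      rw [abs_mul, abs_neg, abs_of_pos hv, abs_of_pos (Real.rpow_pos_of_pos hv p)]
      have : v x t ^ p ≤ M ^ p := Real.rpow_le_rpow hv.le hv2 (by linarith)
      gcongr
    · intro x t h hb'
      exact (hGs _ (hGB _ _ (hQ _ _ (subr x t h)) hb')).2
    · intro x t h hb'
      have l := hL (x, t) hb' (subr x t h)
      have a1 := abs_le.1 h.1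
      have a2 := abs_le.1 h.2
      simp only at a1 a2
      refine ⟨fun s hs' => l.1 s ?_ ?_, fun y hy => l.2 y ?_ ?_⟩
      · have := abs_le.1 hs'
        refine lt_of_le_of_lt ?_ hnr
        simp only
        rw [abs_le]; constructor <;> linarith
      · exact hQ _ _ (subr x s ⟨h.1, hs'⟩)
      · have := abs_le.1 hy
        refine lt_of_le_of_lt ?_ hnr
        simp only
        rw [abs_le]; constructor <;> linarith
      · exact hQ _ _ (subr y t ⟨hy, h.2⟩)
  exact hz0.2 hzG
end RS
end
namespace RS
open Filter Topology

lemma transf {N p σ₂ δ : ℝ} (hδ : δ * (p - 1) = -(σ₂ + 2)) {I : Set ℝ} {u : ℝ → ℝ → ℝ}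
    (hu : IsClassicalRadialSolution N 1 p (-2) σ₂ I u) :
    ∃ v1 v2 : ℝ → ℝ → ℝ,
      SolOn (N - 2 + 2 * δ) (univ ×ˢ I) (fun x t => exp (-δ * x) * u (exp x) t) v1 v2
        (fun x t => FF (-δ * (N - 2 + δ)) p (exp (-δ * x) * u (exp x) t)) := by
  refine ⟨fun x t => exp (-δ * x) * (-δ * u (exp x) t + exp x * deriv (fun ρ => u ρ t) (exp x)),
    fun x t => exp (-δ * x) * (δ ^ 2 * u (exp x) t + (1 - 2 * δ) * (exp x * deriv (fun ρ => u ρ t) (exp x))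
      + exp x ^ 2 * deriv (deriv (fun ρ => u ρ t)) (exp x)), ?_⟩
  rintro ⟨x, t⟩ ⟨-, ht⟩
  obtain ⟨h1, h2, h3, h4, h5⟩ := hu (exp x) (exp_pos x) t ht
  simp only [Real.rpow_one] at h3 h4 h5
  have e0 : HasDerivAt (fun y => exp (-δ * y)) (exp (-δ * x) * -δ) x := by
    refine (((hasDerivAt_id x).const_mul (-δ)).exp).congr_deriv ?_
    simp
  have ex := Real.hasDerivAt_exp x
  have d0 : HasDerivAt (fun y => u (exp y) t) (deriv (fun ρ => u ρ t) (exp x) * exp x) x :=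
    HasDerivAt.comp (h₂ := fun ρ => u ρ t) x h3.hasDerivAt ex
  have d1 : HasDerivAt (fun y => deriv (fun ρ => u ρ t) (exp y)) (deriv (deriv (fun ρ => u ρ t)) (exp x) * exp x) x :=
    HasDerivAt.comp (h₂ := deriv (fun ρ => u ρ t)) x h4.hasDerivAt ex
  refine ⟨?_, ?_, ?_⟩
  · refine (e0.mul d0).congr_deriv ?_
    ring
  · refine (e0.mul ((d0.const_mul (-δ)).add (ex.mul d1))).congr_deriv ?_
    simp only [Pi.mul_apply, Pi.add_apply]
    ring
  · refine (h2.hasDerivAt.const_mul (exp (-δ * x))).congr_deriv ?_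
    simp only [FF]
    have r2 : exp x ^ (-2:ℝ) = (exp x ^ 2)⁻¹ := by
      rw [Real.rpow_neg (exp_pos x).le]; norm_cast
    have rs : exp x ^ σ₂ = exp (x * σ₂) := by rw [← Real.exp_mul]
    have rp : (exp (-δ * x) * u (exp x) t) ^ p = exp (-δ * x * p) * u (exp x) t ^ p := by
      rw [Real.mul_rpow (exp_pos _).le h1.le, ← Real.exp_mul]
    have re : exp (-δ * x * p) = exp (-δ * x) * exp x ^ 2 * exp (x * σ₂) := by
      rw [← Real.exp_nat_mul, ← Real.exp_add, ← Real.exp_add]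
      congr 1
      push_cast
      linear_combination (-x) * hδ
    rw [r2, rs] at h5
    rw [rp, re]
    have ep := exp_pos x
    have h6 : deriv (fun τ => u (exp x) τ) t = exp x ^ 2 * deriv (deriv fun ρ => u ρ t) (exp x)
        + (N - 1) * exp x * deriv (fun ρ => u ρ t) (exp x) + exp x ^ 2 * exp (x * σ₂) * u (exp x) t ^ p := by
      field_simp at h5
      linear_combination h5
    rw [h6]
    ring
end RS

theorem statement5 (N p σ₂ : ℝ) (hp : 1 < p)
    (δ K lam : ℝ) (hδ : δ = -(σ₂ + 2) / (p - 1))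
    (hK : K = N - 2 - 2 * (σ₂ + 2) / (p - 1))
    (hlam : lam = ((σ₂ + 2) / (p - 1)) * (N - 2 - (σ₂ + 2) / (p - 1)))
    (I : Set ℝ) (hIopen : IsOpen I) (hIconn : I.OrdConnected)
    (u : ℝ → ℝ → ℝ)
    (hu : IsClassicalRadialSolution N 1 p (-2) σ₂ I u) :
    ∀ ybar : ℝ, ∀ t ∈ I,
      deriv (fun τ => Real.exp (-δ * (ybar - K * τ)) * u (Real.exp (ybar - K * τ)) τ) t =
        deriv (deriv (fun η => Real.exp (-δ * (η - K * t)) * u (Real.exp (η - K * t)) t)) ybar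
          - lam * (Real.exp (-δ * (ybar - K * t)) * u (Real.exp (ybar - K * t)) t)
          + (Real.exp (-δ * (ybar - K * t)) * u (Real.exp (ybar - K * t)) t) ^ p := by
  intro ybar t ht
  have hp1 : p - 1 ≠ 0 := by linarith
  have hd : (σ₂ + 2) / (p - 1) = -δ := by rw [hδ]; ring
  have hδ' : δ * (p - 1) = -(σ₂ + 2) := by rw [hδ]; field_simp
  have hK' : N - 2 + 2 * δ = K := by rw [hK, hδ]; ring
  have hl' : -δ * (N - 2 + δ) = lam := by rw [hlam, hd]; ring
  obtain ⟨v1, v2, hs⟩ := RS.transf hδ' hu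
  rw [hK', hl'] at hs
  obtain ⟨v, hv⟩ : ∃ v : ℝ → ℝ → ℝ, v = fun x t => Real.exp (-δ * x) * u (Real.exp x) t := ⟨_, rfl⟩
  have hs' : RS.SolOn K (univ ×ˢ I) v v1 v2 (fun x t => RS.FF lam p (v x t)) := by rw [hv]; exact hs
  have hΩ : IsOpen ((univ : Set ℝ) ×ˢ I) := isOpen_univ.prod hIopen
  have hpos : ∀ z ∈ (univ : Set ℝ) ×ˢ I, 0 < v z.1 z.2 := by
    intro z hz
    rw [hv]
    exact mul_pos (Real.exp_pos _) (hu _ (Real.exp_pos _) _ hz.2).1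
  have hc := RS.joint_cont hp hΩ hs' hpos
  obtain ⟨-, -, hc1, -⟩ := RS.reg_p hΩ hs' hpos hc
  have hmem : ∀ x : ℝ, (x, t) ∈ (univ : Set ℝ) ×ˢ I := fun x => ⟨mem_univ _, ht⟩
  have hsol := hs' _ (hmem (ybar - K * t))
  have hv' : ∀ x s, Real.exp (-δ * x) * u (Real.exp x) s = v x s := fun x s => by rw [hv]
  simp only [hv']
  have ht1 : HasDerivAt (fun τ => v (ybar - K * τ) τ)
      (v2 (ybar - K * t) t + K * v1 (ybar - K * t) t + RS.FF lam p (v (ybar - K * t) t)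
        + (-K) * v1 (ybar - K * t) t) t := by
    have h := RS.diag (v := v) (v1 := v1) (c := -K) (x := ybar - K * t) (t := t)
      (by filter_upwards [hΩ.mem_nhds (hmem (ybar - K * t))] with z hz using (hs' z hz).1)
      (hc1.continuousAt (hΩ.mem_nhds (hmem (ybar - K * t)))) hsol.2.2
    have e : (fun τ => v (ybar - K * τ) τ) = fun s => v (ybar - K * t + -K * (s - t)) s := by
      funext s; congr 1; ring
    rw [e]; exact h
  have hx1 : deriv (fun η => v (η - K * t) t) = fun η => v1 (η - K * t) t := by
    funext η
    exact ((hs' _ (hmem (η - K * t))).1.comp_sub_const η (K * t)).deriv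
  have hx2 : deriv (fun η => v1 (η - K * t) t) ybar = v2 (ybar - K * t) t :=
    (hsol.2.1.comp_sub_const ybar (K * t)).deriv
  rw [ht1.deriv, hx1, hx2]
  simp only [RS.FF]
  ring
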